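/- arXiv:2103.16873 — 3 statements merged into one kernel-verified Lean document; each statement's English description precedes it below -/
import Mathlib

section
/- Let f : ℂ → ℂ be meromorphic on all of ℂ and suppose f(s) = T(s,s,s) for every complex s with Re s > 2/3. Then f(s) tends to 1/3 as s tends to 0 through values s ≠ 0. -/
open Real Complex

/-- The Tornheim double zeta function, as a double series over positive integers. -/
noncomputable def tornheim (s t u : ℂ) : ℂ :=
  ∑' p : ℕ+ × ℕ+, 1 / ((p.1 : ℂ) ^ s * (p.2 : ℂ) ^ t * ((p.1 : ℂ) + (p.2 : ℂ)) ^ u)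


namespace TornAux

/-- Euler-Maclaurin on a unit cell. -/
lemma cell (u u1 u2 u3 : ℝ → ℂ) (a M : ℝ)
    (h0 : ∀ t ∈ Set.Icc a (a + 1), HasDerivAt u (u1 t) t)
    (h1 : ∀ t ∈ Set.Icc a (a + 1), HasDerivAt u1 (u2 t) t)
    (h2 : ∀ t ∈ Set.Icc a (a + 1), HasDerivAt u2 (u3 t) t)
    (h3 : ContinuousOn u3 (Set.Icc a (a + 1)))
    (hM : ∀ t ∈ Set.Icc a (a + 1), ‖u3 t‖ ≤ M) :
    ‖(u a + u (a + 1)) / 2 - (∫ t in a..(a + 1), u t) - (u1 (a + 1) - u1 a) / 12‖ ≤ M := by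
  have hle : a ≤ a + 1 := by linarith
  have hI : Set.uIcc a (a + 1) = Set.Icc a (a + 1) := Set.uIcc_of_le hle
  set p : ℝ → ℂ := fun t => ((t : ℂ) - a) * ((t : ℂ) - a - 1 / 2) * ((t : ℂ) - a - 1) / 6 with hp
  have hpc : Continuous p := by fun_prop
  have hu : ContinuousOn u (Set.Icc a (a + 1)) := fun t ht => (h0 t ht).continuousAt.continuousWithinAt
  have hui : IntervalIntegrable u MeasureTheory.volume a (a + 1) := by
    apply ContinuousOn.intervalIntegrable; rwa [hI]
  have hpi : IntervalIntegrable (fun t => p t * u3 t) MeasureTheory.volume a (a + 1) := by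
    apply ContinuousOn.intervalIntegrable; rw [hI]; exact hpc.continuousOn.mul h3
  have key : ∫ t in a..(a + 1), (p t * u3 t + u t) =
      (u a + u (a + 1)) / 2 - (u1 (a + 1) - u1 a) / 12 := by
    have hd : ∀ t ∈ Set.uIcc a (a + 1), HasDerivAt (fun t : ℝ => p t * u2 t
        - (((t : ℂ) - a) ^ 2 / 2 - ((t : ℂ) - a) / 2 + 1 / 12) * u1 t
        + ((t : ℂ) - a - 1 / 2) * u t) (p t * u3 t + u t) t := by
      intro t ht
      rw [hI] at ht
      have e0 : HasDerivAt (fun t : ℝ => (t : ℂ) - a) 1 t := by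
        simpa using (Complex.ofRealCLM.hasDerivAt (x := t)).sub_const (a : ℂ)
      have e1 := ((e0.mul (e0.sub_const (1 / 2 : ℂ))).mul (e0.sub_const (1 : ℂ))).div_const 6
      have e2 := (((e0.pow 2).div_const 2).sub (e0.div_const 2)).add_const (1 / 12 : ℂ)
      have e3 := e0.sub_const (1 / 2 : ℂ)
      have := ((e1.mul (h2 t ht)).sub (e2.mul (h1 t ht))).add (e3.mul (h0 t ht))
      refine this.congr_deriv ?_
      simp only [hp, Pi.mul_apply, Pi.sub_apply, Pi.pow_apply]
      push_cast
      ring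
    rw [intervalIntegral.integral_eq_sub_of_hasDerivAt hd (hpi.add hui)]
    simp only [hp]
    push_cast
    ring
  rw [intervalIntegral.integral_add hpi hui] at key
  have : (u a + u (a + 1)) / 2 - (∫ t in a..(a + 1), u t) - (u1 (a + 1) - u1 a) / 12 =
      ∫ t in a..(a + 1), p t * u3 t := by linear_combination -key
  rw [this]
  have hb := intervalIntegral.norm_integral_le_of_norm_le_const (a := a) (b := a + 1)
    (f := fun t => p t * u3 t) (C := M) ?_
  · simpa using hb
  · intro t ht
    rw [Set.uIoc_of_le hle] at ht
    have ht' : t ∈ Set.Icc a (a + 1) := ⟨ht.1.le, ht.2⟩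
    have hpn : ‖p t‖ ≤ 1 := by
      have : p t = (((t - a) * (t - a - 1 / 2) * (t - a - 1) / 6 : ℝ) : ℂ) := by
        simp only [hp]; push_cast; ring
      rw [this, Complex.norm_real, Real.norm_eq_abs]
      have a1 : |t - a| ≤ 1 := by rw [abs_le]; constructor <;> linarith [ht'.1, ht'.2]
      have a2 : |t - a - 1 / 2| ≤ 1 := by rw [abs_le]; constructor <;> linarith [ht'.1, ht'.2]
      have a3 : |t - a - 1| ≤ 1 := by rw [abs_le]; constructor <;> linarith [ht'.1, ht'.2]
      rw [abs_div, abs_mul, abs_mul]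
      have : |t - a| * |t - a - 1 / 2| * |t - a - 1| ≤ 1 * 1 * 1 := by gcongr
      rw [abs_of_pos (by norm_num : (0 : ℝ) < 6)]
      linarith
    rw [norm_mul]
    calc ‖p t‖ * ‖u3 t‖ ≤ 1 * M := by
          gcongr
          exact hM t ht'
      _ = M := one_mul M

lemma hasDerivAt_cpow (r : ℂ) {x : ℝ} (hx : 0 < x) :
    HasDerivAt (fun t : ℝ => (t : ℂ) ^ r) (r * (x : ℂ) ^ (r - 1)) x := by
  have h := (Complex.hasStrictDerivAt_cpow_const (x := (x : ℂ)) (c := r)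
    (Complex.ofReal_mem_slitPlane.2 hx)).hasDerivAt
  exact h.comp_ofReal

lemma norm_cpow {x : ℝ} (hx : 0 < x) (r : ℂ) : ‖(x : ℂ) ^ r‖ = x ^ r.re :=
  Complex.norm_cpow_eq_rpow_re_of_pos hx r

/-- cell error for `t ^ (-w)` -/
noncomputable def eps (m : ℕ) (w : ℂ) : ℂ :=
  ((m : ℂ) ^ (-w) + ((m + 1 : ℕ) : ℂ) ^ (-w)) / 2
    - (((m + 1 : ℕ) : ℂ) ^ (1 - w) - (m : ℂ) ^ (1 - w)) / (1 - w)
    + w * (((m + 1 : ℕ) : ℂ) ^ (-w - 1) - (m : ℂ) ^ (-w - 1)) / 12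

lemma eps_bound {m : ℕ} (hm : 1 ≤ m) {w : ℂ} (hw1 : w ≠ 1) (hw : -3 ≤ w.re) :
    ‖eps m w‖ ≤ ‖w‖ * ‖w + 1‖ * ‖w + 2‖ * (m : ℝ) ^ (-w.re - 3) := by
  have hm0 : (0 : ℝ) < m := by exact_mod_cast hm
  have hpos : ∀ t ∈ Set.Icc (m : ℝ) (m + 1), 0 < t := fun t ht => lt_of_lt_of_le hm0 ht.1
  have hc := cell (fun t => (t : ℂ) ^ (-w)) (fun t => (-w) * (t : ℂ) ^ (-w - 1))
    (fun t => (-w) * ((-w - 1) * (t : ℂ) ^ (-w - 1 - 1)))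
    (fun t => (-w) * ((-w - 1) * ((-w - 1 - 1) * (t : ℂ) ^ (-w - 1 - 1 - 1)))) m
    (‖w‖ * ‖w + 1‖ * ‖w + 2‖ * (m : ℝ) ^ (-w.re - 3))
    (fun t ht => hasDerivAt_cpow _ (hpos t ht))
    (fun t ht => (hasDerivAt_cpow _ (hpos t ht)).const_mul _)
    (fun t ht => ((hasDerivAt_cpow _ (hpos t ht)).const_mul _).const_mul _)
    (fun t ht => ((((hasDerivAt_cpow _ (hpos t ht)).const_mul _).const_mul _).const_mul
      _).continuousAt.continuousWithinAt)
    (by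
      intro t ht
      have e1 : ‖-w‖ = ‖w‖ := norm_neg w
      have e2 : ‖-w - 1‖ = ‖w + 1‖ := by rw [← norm_neg]; congr 1; ring
      have e3 : ‖-w - 1 - 1‖ = ‖w + 2‖ := by rw [← norm_neg]; congr 1; ring
      have e4 : (-w - 1 - 1 - 1).re = -w.re - 3 := by
        simp only [Complex.sub_re, Complex.neg_re, Complex.one_re]; ring
      rw [norm_mul, norm_mul, norm_mul, norm_cpow (hpos t ht), e1, e2, e3, e4, mul_assoc, mul_assoc]
      gcongr ‖w‖ * (‖w + 1‖ * (‖w + 2‖ * ?_))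
      exact Real.rpow_le_rpow_of_nonpos hm0 ht.1 (by linarith))
  have hint : ∫ t in (m : ℝ)..(m + 1), (t : ℂ) ^ (-w) =
      (((m + 1 : ℕ) : ℂ) ^ (1 - w) - (m : ℂ) ^ (1 - w)) / (1 - w) := by
    rw [integral_cpow (Or.inr ⟨fun h => hw1 (by linear_combination -h), by
      rw [Set.uIcc_of_le (by linarith)]; intro h; exact absurd (hpos 0 h) (lt_irrefl _)⟩)]
    have : -w + 1 = 1 - w := by ring
    rw [this]; push_cast; ring
  rw [hint] at hc
  refine le_trans (le_of_eq ?_) hc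
  congr 1
  unfold eps
  push_cast
  ring

lemma sum_pow_aux {n : ℕ} (hn : 1 ≤ n) {w : ℂ} :
    ∑ m ∈ Finset.Ico 1 n, (m : ℂ) ^ (-w) + (n : ℂ) ^ (-w) / 2 =
      1 / 2 + ((n : ℂ) ^ (1 - w) - 1) / (1 - w) - w * ((n : ℂ) ^ (-w - 1) - 1) / 12
        + ∑ m ∈ Finset.Ico 1 n, eps m w := by
  induction n, hn using Nat.le_induction with
  | base => simp
  | succ n hn ih =>
    rw [Finset.sum_Ico_succ_top hn, Finset.sum_Ico_succ_top hn]
    have : eps n w = ((n : ℂ) ^ (-w) + ((n + 1 : ℕ) : ℂ) ^ (-w)) / 2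
      - (((n + 1 : ℕ) : ℂ) ^ (1 - w) - (n : ℂ) ^ (1 - w)) / (1 - w)
      + w * (((n + 1 : ℕ) : ℂ) ^ (-w - 1) - (n : ℂ) ^ (-w - 1)) / 12 := rfl
    rw [this]
    linear_combination ih

/-- constant term (it is `ζ(w)`) -/
noncomputable def cst (w : ℂ) : ℂ := 1 / 2 - 1 / (1 - w) + w / 12 + ∑' m : ℕ, eps (m + 1) w

lemma eps_summable {w : ℂ} (hw1 : w ≠ 1) (hw : -2 < w.re) : Summable fun m : ℕ => eps (m + 1) w := by
  refine Summable.of_norm_bounded (g := fun m : ℕ => ‖w‖ * ‖w + 1‖ * ‖w + 2‖ *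
    ((m + 1 : ℕ) : ℝ) ^ (-w.re - 3)) ?_ fun m => eps_bound (by omega) hw1 (by linarith)
  apply Summable.mul_left
  exact (summable_nat_add_iff 1).2 (Real.summable_nat_rpow.2 (by linarith))

lemma sum_pow {n : ℕ} (hn : 1 ≤ n) {w : ℂ} (hw1 : w ≠ 1) (hw : -2 < w.re) :
    ∑ m ∈ Finset.Ico 1 n, (m : ℂ) ^ (-w) + (n : ℂ) ^ (-w) / 2 =
      cst w + (n : ℂ) ^ (1 - w) / (1 - w) - w * (n : ℂ) ^ (-w - 1) / 12
        - ∑' m : ℕ, eps (m + n) w := by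
  rw [sum_pow_aux hn, cst]
  have h := (eps_summable hw1 hw).sum_add_tsum_nat_add (n - 1)
  have h1 : ∑ i ∈ Finset.range (n - 1), eps (i + 1) w = ∑ m ∈ Finset.Ico 1 n, eps m w := by
    rw [Finset.sum_Ico_eq_sum_range]
    exact Finset.sum_congr rfl fun i _ => by rw [add_comm]
  have h2 : ∀ i : ℕ, i + (n - 1) + 1 = i + n := fun i => by omega
  simp only [h1, h2] at h
  rw [← h]
  ring

end TornAux

namespace TornAux

noncomputable def rho (s : ℂ) (x : ℝ) : ℂ := ((1 + x : ℝ) : ℂ) ^ (-s) - 1 + s * x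
noncomputable def rho1 (s : ℂ) (x : ℝ) : ℂ := (-s) * ((1 + x : ℝ) : ℂ) ^ (-s - 1) + s
noncomputable def rho2 (s : ℂ) (x : ℝ) : ℂ := (-s) * ((-s - 1) * ((1 + x : ℝ) : ℂ) ^ (-s - 1 - 1))
noncomputable def rho3 (s : ℂ) (x : ℝ) : ℂ :=
  (-s) * ((-s - 1) * ((-s - 1 - 1) * ((1 + x : ℝ) : ℂ) ^ (-s - 1 - 1 - 1)))
noncomputable def al0 (s : ℂ) (x : ℝ) : ℂ := (x : ℂ) ^ (-s)
noncomputable def al1 (s : ℂ) (x : ℝ) : ℂ := (-s) * (x : ℂ) ^ (-s - 1)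
noncomputable def al2 (s : ℂ) (x : ℝ) : ℂ := (-s) * ((-s - 1) * (x : ℂ) ^ (-s - 1 - 1))
noncomputable def al3 (s : ℂ) (x : ℝ) : ℂ :=
  (-s) * ((-s - 1) * ((-s - 1 - 1) * (x : ℂ) ^ (-s - 1 - 1 - 1)))

lemma hasDerivAt_cpow_one_add (r : ℂ) {x : ℝ} (hx : 0 ≤ x) :
    HasDerivAt (fun t : ℝ => ((1 + t : ℝ) : ℂ) ^ r) (r * ((1 + x : ℝ) : ℂ) ^ (r - 1)) x := by
  have h := hasDerivAt_cpow r (x := 1 + x) (by linarith)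
  exact h.comp_const_add 1 x

lemma rho_deriv (s : ℂ) {x : ℝ} (hx : 0 ≤ x) : HasDerivAt (rho s) (rho1 s x) x := by
  have h := ((hasDerivAt_cpow_one_add (-s) hx).sub_const 1).add
    ((Complex.ofRealCLM.hasDerivAt (x := x)).const_mul s)
  refine (h.congr_deriv ?_)
  simp [rho1]

lemma rho1_deriv (s : ℂ) {x : ℝ} (hx : 0 ≤ x) : HasDerivAt (rho1 s) (rho2 s x) x :=
  ((hasDerivAt_cpow_one_add (-s - 1) hx).const_mul _).add_const _

lemma rho2_deriv (s : ℂ) {x : ℝ} (hx : 0 ≤ x) : HasDerivAt (rho2 s) (rho3 s x) x :=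
  ((hasDerivAt_cpow_one_add (-s - 1 - 1) hx).const_mul _).const_mul _

lemma rho3_cont (s : ℂ) {x : ℝ} (hx : 0 ≤ x) : ContinuousAt (rho3 s) x :=
  (((hasDerivAt_cpow_one_add (-s - 1 - 1 - 1) hx).const_mul _).const_mul _).const_mul _
    |>.continuousAt

lemma al0_deriv (s : ℂ) {x : ℝ} (hx : 0 < x) : HasDerivAt (al0 s) (al1 s x) x :=
  hasDerivAt_cpow _ hx

lemma al1_deriv (s : ℂ) {x : ℝ} (hx : 0 < x) : HasDerivAt (al1 s) (al2 s x) x :=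
  (hasDerivAt_cpow _ hx).const_mul _

lemma al2_deriv (s : ℂ) {x : ℝ} (hx : 0 < x) : HasDerivAt (al2 s) (al3 s x) x :=
  ((hasDerivAt_cpow _ hx).const_mul _).const_mul _

lemma al3_cont (s : ℂ) {x : ℝ} (hx : 0 < x) : ContinuousAt (al3 s) x :=
  (((hasDerivAt_cpow _ hx).const_mul _).const_mul _).const_mul _ |>.continuousAt

lemma norm_n1 {s : ℂ} (h : ‖s‖ ≤ 1) : ‖-s‖ ≤ 1 := by rwa [norm_neg]
lemma norm_n2 {s : ℂ} (h : ‖s‖ ≤ 1) : ‖-s - 1‖ ≤ 2 := by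
  refine (norm_sub_le _ _).trans ?_
  rw [norm_neg, norm_one]; linarith
lemma norm_n3 {s : ℂ} (h : ‖s‖ ≤ 1) : ‖-s - 1 - 1‖ ≤ 3 := by
  refine (norm_sub_le _ _).trans ?_
  rw [norm_one]; linarith [norm_n2 h]

lemma one_add_bd {x : ℝ} (hx : 0 ≤ x) {r : ℂ} (hr : r.re ≤ 0) : ‖((1 + x : ℝ) : ℂ) ^ r‖ ≤ 1 := by
  rw [norm_cpow (by linarith)]
  exact Real.rpow_le_one_of_one_le_of_nonpos (by linarith) hr

lemma rho2_bd {s : ℂ} (h : ‖s‖ ≤ 1) (hs : -1 ≤ s.re) {x : ℝ} (hx : 0 ≤ x) : ‖rho2 s x‖ ≤ 2 := by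
  unfold rho2
  rw [norm_mul, norm_mul]
  calc ‖-s‖ * (‖-s - 1‖ * ‖((1 + x : ℝ) : ℂ) ^ (-s - 1 - 1)‖) ≤ 1 * (2 * 1) := by
        gcongr
        · exact norm_n1 h
        · exact norm_n2 h
        · exact one_add_bd hx (by simp; linarith)
    _ = 2 := by norm_num

lemma rho3_bd {s : ℂ} (h : ‖s‖ ≤ 1) (hs : -1 ≤ s.re) {x : ℝ} (hx : 0 ≤ x) : ‖rho3 s x‖ ≤ 6 := by
  unfold rho3
  rw [norm_mul, norm_mul, norm_mul]
  calc ‖-s‖ * (‖-s - 1‖ * (‖-s - 1 - 1‖ * ‖((1 + x : ℝ) : ℂ) ^ (-s - 1 - 1 - 1)‖)) ≤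
      1 * (2 * (3 * 1)) := by
        gcongr
        · exact norm_n1 h
        · exact norm_n2 h
        · exact norm_n3 h
        · exact one_add_bd hx (by simp; linarith)
    _ = 6 := by norm_num

lemma rho1_bd {s : ℂ} (h : ‖s‖ ≤ 1) (hs : -1 ≤ s.re) {x : ℝ} (hx : 0 ≤ x) :
    ‖rho1 s x‖ ≤ 2 * x := by
  have := norm_image_sub_le_of_norm_deriv_le_segment' (f := rho1 s) (f' := rho2 s) (a := 0) (b := x)
    (C := 2) (fun t ht => (rho1_deriv s ht.1).hasDerivWithinAt)
    (fun t ht => rho2_bd h hs ht.1) x ⟨hx, le_rfl⟩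
  simpa [rho1] using this

lemma rho_bd {s : ℂ} (h : ‖s‖ ≤ 1) (hs : -1 ≤ s.re) {x : ℝ} (hx : 0 ≤ x) :
    ‖rho s x‖ ≤ 2 * x ^ 2 := by
  have := norm_image_sub_le_of_norm_deriv_le_segment' (f := rho s) (f' := rho1 s) (a := 0) (b := x)
    (C := 2 * x) (fun t ht => (rho_deriv s ht.1).hasDerivWithinAt)
    (fun t ht => (rho1_bd h hs ht.1).trans (by linarith [ht.2])) x ⟨hx, le_rfl⟩
  have h2 : rho s x - rho s 0 = rho s x := by simp [rho]
  rw [h2] at this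
  nlinarith

lemma al0_bd {s : ℂ} {x : ℝ} (hx : 0 < x) : ‖al0 s x‖ = x ^ (-s.re) := by
  unfold al0; rw [norm_cpow hx]; simp

lemma rpow_mul_x {x : ℝ} (hx : 0 < x) (a : ℝ) : x ^ a = x ^ (a - 1) * x := by
  rw [Real.rpow_sub_one hx.ne']; field_simp

lemma al1_bd {s : ℂ} (h : ‖s‖ ≤ 1) {x : ℝ} (hx : 0 < x) : ‖al1 s x‖ ≤ x ^ (-s.re - 1) := by
  unfold al1; rw [norm_mul, norm_cpow hx]
  have e : (-s - 1).re = -s.re - 1 := by simp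
  rw [e]
  calc _ ≤ 1 * x ^ (-s.re - 1) := by gcongr; exact norm_n1 h
    _ = _ := one_mul _

lemma al2_bd {s : ℂ} (h : ‖s‖ ≤ 1) {x : ℝ} (hx : 0 < x) :
    ‖al2 s x‖ ≤ 2 * x ^ (-s.re - 1 - 1) := by
  unfold al2; rw [norm_mul, norm_mul, norm_cpow hx]
  have e : (-s - 1 - 1).re = -s.re - 1 - 1 := by simp
  rw [e]
  calc _ ≤ 1 * (2 * x ^ (-s.re - 1 - 1)) := by
        gcongr
        · exact norm_n1 h
        · exact norm_n2 h
    _ = _ := one_mul _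

lemma al3_bd {s : ℂ} (h : ‖s‖ ≤ 1) {x : ℝ} (hx : 0 < x) :
    ‖al3 s x‖ ≤ 6 * x ^ (-s.re - 1 - 1 - 1) := by
  unfold al3; rw [norm_mul, norm_mul, norm_mul, norm_cpow hx]
  have e : (-s - 1 - 1 - 1).re = -s.re - 1 - 1 - 1 := by simp
  rw [e]
  calc _ ≤ 1 * (2 * (3 * x ^ (-s.re - 1 - 1 - 1))) := by
        gcongr
        · exact norm_n1 h
        · exact norm_n2 h
        · exact norm_n3 h
    _ = _ := by ring

noncomputable def hh (s : ℂ) (x : ℝ) : ℂ := al0 s x * rho s x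
noncomputable def hh1 (s : ℂ) (x : ℝ) : ℂ := al1 s x * rho s x + al0 s x * rho1 s x
noncomputable def hh2 (s : ℂ) (x : ℝ) : ℂ :=
  al2 s x * rho s x + 2 * (al1 s x * rho1 s x) + al0 s x * rho2 s x
noncomputable def hh3 (s : ℂ) (x : ℝ) : ℂ :=
  al3 s x * rho s x + 3 * (al2 s x * rho1 s x) + 3 * (al1 s x * rho2 s x) + al0 s x * rho3 s x

lemma hh_deriv (s : ℂ) {x : ℝ} (hx : 0 < x) : HasDerivAt (hh s) (hh1 s x) x :=
  (al0_deriv s hx).mul (rho_deriv s hx.le)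

lemma hh1_deriv (s : ℂ) {x : ℝ} (hx : 0 < x) : HasDerivAt (hh1 s) (hh2 s x) x := by
  refine (((al1_deriv s hx).mul (rho_deriv s hx.le)).add
    ((al0_deriv s hx).mul (rho1_deriv s hx.le))).congr_deriv ?_
  unfold hh2; ring

lemma hh2_deriv (s : ℂ) {x : ℝ} (hx : 0 < x) : HasDerivAt (hh2 s) (hh3 s x) x := by
  refine ((((al2_deriv s hx).mul (rho_deriv s hx.le)).add
    (((al1_deriv s hx).mul (rho1_deriv s hx.le)).const_mul 2)).add
    ((al0_deriv s hx).mul (rho2_deriv s hx.le))).congr_deriv ?_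
  unfold hh3; ring

lemma hh3_cont (s : ℂ) {x : ℝ} (hx : 0 < x) : ContinuousAt (hh3 s) x := by
  have a0 := (al0_deriv s hx).continuousAt
  have a1 := (al1_deriv s hx).continuousAt
  have a2 := (al2_deriv s hx).continuousAt
  have a3 := al3_cont s hx
  have r0 := (rho_deriv s hx.le).continuousAt
  have r1 := (rho1_deriv s hx.le).continuousAt
  have r2 := (rho2_deriv s hx.le).continuousAt
  have r3 := rho3_cont s hx.le
  unfold hh3
  exact (((a3.mul r0).add (continuousAt_const.mul (a2.mul r1))).add
    (continuousAt_const.mul (a1.mul r2))).add (a0.mul r3)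

lemma hh_bd {s : ℂ} (h : ‖s‖ ≤ 1) (hs : -1 ≤ s.re) {x : ℝ} (hx : 0 < x) :
    ‖hh s x‖ ≤ 2 * (x ^ (-s.re) * x ^ 2) := by
  unfold hh
  rw [norm_mul, al0_bd hx]
  calc _ ≤ x ^ (-s.re) * (2 * x ^ 2) := by gcongr; exact rho_bd h hs hx.le
    _ = _ := by ring

lemma hh1_bd {s : ℂ} (h : ‖s‖ ≤ 1) (hs : -1 ≤ s.re) {x : ℝ} (hx : 0 < x) :
    ‖hh1 s x‖ ≤ 4 * (x ^ (-s.re) * x) := by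
  unfold hh1
  refine (norm_add_le _ _).trans ?_
  rw [norm_mul, norm_mul, al0_bd hx]
  calc _ ≤ x ^ (-s.re - 1) * (2 * x ^ 2) + x ^ (-s.re) * (2 * x) := by
        gcongr
        · exact al1_bd h hx
        · exact rho_bd h hs hx.le
        · exact rho1_bd h hs hx.le
    _ = _ := by rw [rpow_mul_x hx (-s.re)]; ring

lemma hh3_bd {s : ℂ} (h : ‖s‖ ≤ 1) (hs : -1 ≤ s.re) {x : ℝ} (hx : 0 < x) (hx1 : x ≤ 1) :
    ‖hh3 s x‖ ≤ 36 * x ^ (-s.re - 1) := by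
  have t3 : ‖(3 : ℂ)‖ = 3 := by simp
  unfold hh3
  refine (norm_add₄_le).trans ?_
  simp only [norm_mul, al0_bd hx, t3]
  calc _ ≤ (6 * x ^ (-s.re - 1 - 1 - 1)) * (2 * x ^ 2) + 3 * ((2 * x ^ (-s.re - 1 - 1)) * (2 * x))
        + 3 * (x ^ (-s.re - 1) * 2) + x ^ (-s.re) * 6 := by
        gcongr
        · exact al3_bd h hx
        · exact rho_bd h hs hx.le
        · exact al2_bd h hx
        · exact rho1_bd h hs hx.le
        · exact al1_bd h hx
        · exact rho2_bd h hs hx.le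
        · exact rho3_bd h hs hx.le
    _ = 30 * x ^ (-s.re - 1) + 6 * (x ^ (-s.re - 1) * x) := by
        rw [rpow_mul_x hx (-s.re), rpow_mul_x hx (-s.re - 1), rpow_mul_x hx (-s.re - 1 - 1)]; ring
    _ ≤ 30 * x ^ (-s.re - 1) + 6 * (x ^ (-s.re - 1) * 1) := by gcongr
    _ = _ := by ring

lemma hh_int {s : ℂ} (hs : s.re < 1) {a b : ℝ} (ha : 0 ≤ a) (hb : 0 ≤ b) :
    IntervalIntegrable (hh s) MeasureTheory.volume a b := by
  unfold hh al0
  apply IntervalIntegrable.mul_continuousOn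
  · exact intervalIntegral.intervalIntegrable_cpow' (by simp; linarith)
  · intro t ht
    have : 0 ≤ t := le_trans (le_min ha hb) ht.1
    exact (rho_deriv s this).continuousAt.continuousWithinAt

/-- trapezoid sum of `hh` -/
lemma hh_sum {s : ℂ} (h : ‖s‖ ≤ 1) (hs : -1 ≤ s.re) (hs1 : s.re < 1) {n : ℕ} (hn : 1 ≤ n) :
    ‖∑ m ∈ Finset.Ico 1 n, hh s (m / n) + hh s 1 / 2 - n * (∫ x in (0 : ℝ)..1, hh s x)
      - hh1 s 1 / 12 / n‖ ≤ 36 * ((n : ℝ) ^ (s.re - 2) *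
        (1 + ∑ m ∈ Finset.Ico 1 n, (m : ℝ) ^ (-s.re - 1))) := by
  have hn0 : (0 : ℝ) < n := by exact_mod_cast hn
  have hnc : (n : ℂ) ≠ 0 := by exact_mod_cast (by omega : n ≠ 0)
  -- cell error
  set E : ℕ → ℂ := fun m => (hh s (m / n) + hh s ((m + 1 : ℕ) / n)) / 2
    - n * (∫ x in ((m : ℝ) / n)..((m + 1 : ℕ) / n), hh s x)
    - (hh1 s ((m + 1 : ℕ) / n) / n - hh1 s (m / n) / n) / 12 with hE
  have hEb : ∀ m ∈ Finset.Ico 1 n, ‖E m‖ ≤ 36 * ((n : ℝ) ^ (s.re - 2) * (m : ℝ) ^ (-s.re - 1)) := by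
    intro m hm
    rw [Finset.mem_Ico] at hm
    have hm0 : (0 : ℝ) < m := by exact_mod_cast hm.1
    have hmn : (m : ℝ) + 1 ≤ n := by exact_mod_cast hm.2
    have hpos : ∀ t ∈ Set.Icc (m : ℝ) (m + 1), 0 < t / n :=
      fun t ht => div_pos (lt_of_lt_of_le hm0 ht.1) hn0
    have hd : ∀ (u u' : ℝ → ℂ) (t : ℝ), HasDerivAt u (u' (t / n)) (t / n) →
        HasDerivAt (fun t : ℝ => u (t / n)) (u' (t / n) / n) t := by
      intro u u' t hu
      have h1 : HasDerivAt (fun t : ℝ => t / n) (1 / n) t := (hasDerivAt_id t).div_const _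
      have := HasDerivAt.scomp t (h := fun t : ℝ => t / (n : ℝ)) hu h1
      refine this.congr_deriv ?_
      rw [Complex.real_smul]; push_cast; ring
    have hc := cell (fun t => hh s (t / n)) (fun t => hh1 s (t / n) / n)
      (fun t => hh2 s (t / n) / n / n) (fun t => hh3 s (t / n) / n / n / n) m
      (36 * ((n : ℝ) ^ (s.re - 2) * (m : ℝ) ^ (-s.re - 1)))
      (fun t ht => hd _ _ t (hh_deriv s (hpos t ht)))
      (fun t ht => (hd _ _ t (hh1_deriv s (hpos t ht))).div_const _)
      (fun t ht => ((hd _ _ t (hh2_deriv s (hpos t ht))).div_const _).div_const _)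
      (fun t ht => by
        have := hh3_cont s (hpos t ht)
        have h2 : ContinuousAt (fun t : ℝ => hh3 s (t / n)) t :=
          ContinuousAt.comp (f := fun t : ℝ => t / (n : ℝ)) this (by fun_prop)
        exact (((h2.div_const _).div_const _).div_const _).continuousWithinAt)
      (by
        intro t ht
        have hb := hh3_bd h hs (hpos t ht) ((div_le_one hn0).2 (ht.2.trans hmn))
        have hmono : (t / n) ^ (-s.re - 1) ≤ ((m : ℝ) / n) ^ (-s.re - 1) :=
          Real.rpow_le_rpow_of_nonpos (div_pos hm0 hn0) (by gcongr; exact ht.1) (by linarith)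
        have e : ((m : ℝ) / n) ^ (-s.re - 1) / n / n / n =
            (n : ℝ) ^ (s.re - 2) * (m : ℝ) ^ (-s.re - 1) := by
          rw [Real.div_rpow hm0.le hn0.le]
          have : (n : ℝ) ^ (s.re - 2) = ((n : ℝ) ^ (-s.re - 1))⁻¹ / n / n / n := by
            rw [← Real.rpow_neg hn0.le]
            have : s.re - 2 = -(-s.re - 1) - 1 - 1 - 1 := by ring
            rw [this, Real.rpow_sub_one hn0.ne', Real.rpow_sub_one hn0.ne', Real.rpow_sub_one hn0.ne']
          rw [this]; ring
        rw [norm_div, norm_div, norm_div, Complex.norm_natCast, ← e]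
        calc _ ≤ (36 * ((m : ℝ) / n) ^ (-s.re - 1)) / n / n / n := by
              gcongr
              exact hb.trans (by gcongr)
          _ = _ := by ring)
    refine le_trans (le_of_eq ?_) hc
    congr 1
    have hint : ∫ t in (m : ℝ)..(m + 1), hh s (t / n) =
        n * (∫ x in ((m : ℝ) / n)..((m + 1 : ℕ) / n), hh s x) := by
      rw [intervalIntegral.integral_comp_div _ hn0.ne', Complex.real_smul]
      push_cast; rfl
    rw [hint]
    simp only [hE]
    push_cast
    ring
  -- telescoping
  have tele : ∀ k : ℕ, 1 ≤ k → ∑ m ∈ Finset.Ico 1 k, hh s (m / n) + hh s (k / n) / 2 =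
      hh s (1 / n) / 2 + n * (∫ x in ((1 : ℝ) / n)..(k / n), hh s x)
        + (hh1 s (k / n) / n - hh1 s (1 / n) / n) / 12 + ∑ m ∈ Finset.Ico 1 k, E m := by
    intro k hk
    induction k, hk using Nat.le_induction with
    | base => simp
    | succ k hk ih =>
      rw [Finset.sum_Ico_succ_top hk, Finset.sum_Ico_succ_top hk]
      have hadd := intervalIntegral.integral_add_adjacent_intervals (μ := MeasureTheory.volume)
        (hh_int hs1 (a := 1 / n) (b := k / n) (by positivity) (by positivity))
        (hh_int hs1 (a := k / n) (b := (k + 1 : ℕ) / n) (by positivity) (by positivity))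
      rw [← hadd]
      simp only [hE]
      linear_combination ih
  have ht := tele n hn
  rw [div_self hn0.ne'] at ht
  have hadd := intervalIntegral.integral_add_adjacent_intervals (μ := MeasureTheory.volume)
        (hh_int hs1 (a := 0) (b := 1 / n) le_rfl (by positivity))
        (hh_int hs1 (a := 1 / n) (b := 1) (by positivity) (by positivity))
  have hx : (0 : ℝ) < 1 / n := by positivity
  have hr : ∑ m ∈ Finset.Ico 1 n, hh s (m / n) + hh s 1 / 2 - n * (∫ x in (0 : ℝ)..1, hh s x)
      - hh1 s 1 / 12 / n = hh s (1 / n) / 2 + (-(n * (∫ x in (0 : ℝ)..(1 / n), hh s x)))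
        + (-(hh1 s (1 / n) / 12 / n)) + ∑ m ∈ Finset.Ico 1 n, E m := by
    rw [← hadd]; linear_combination ht
  have hpw : ((1 : ℝ) / n) ^ (-s.re) * (1 / n) ^ 2 = (n : ℝ) ^ (s.re - 2) := by
    rw [one_div, Real.inv_rpow hn0.le, Real.rpow_neg hn0.le, inv_inv, Real.rpow_sub hn0]
    norm_num
    rfl
  have b1 : ‖hh s (1 / n) / 2‖ ≤ (n : ℝ) ^ (s.re - 2) := by
    rw [norm_div, ← hpw]
    have := hh_bd h hs hx
    have t2 : ‖(2 : ℂ)‖ = 2 := by simp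
    rw [t2]; linarith
  have b2 : ‖-(n * (∫ x in (0 : ℝ)..(1 / n), hh s x))‖ ≤ 2 * (n : ℝ) ^ (s.re - 2) := by
    have := intervalIntegral.norm_integral_le_of_norm_le_const (a := 0) (b := 1 / n)
      (f := hh s) (C := 2 * (n : ℝ) ^ (s.re - 2)) (by
        intro x hx'
        rw [Set.uIoc_of_le hx.le] at hx'
        refine (hh_bd h hs hx'.1).trans ?_
        rw [← hpw]
        have e : ∀ y : ℝ, 0 < y → y ^ (-s.re) * y ^ 2 = y ^ (2 - s.re) := by
          intro y hy
          rw [← Real.rpow_natCast y 2, ← Real.rpow_add hy]; congr 1; push_cast; ring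
        rw [e _ hx'.1, e _ hx]
        gcongr
        · linarith [hx'.1]
        · linarith
        · exact hx'.2)
    rw [norm_neg, norm_mul, Complex.norm_natCast]
    rw [sub_zero, abs_of_pos hx] at this
    calc _ ≤ (n : ℝ) * (2 * (n : ℝ) ^ (s.re - 2) * (1 / n)) := by gcongr
      _ = _ := by field_simp
  have b3 : ‖-(hh1 s (1 / n) / 12 / n)‖ ≤ (n : ℝ) ^ (s.re - 2) := by
    rw [norm_neg, norm_div, norm_div, Complex.norm_natCast, ← hpw]
    have t2 : ‖(12 : ℂ)‖ = 12 := by simp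
    have := hh1_bd h hs hx
    have hp : 0 ≤ ((1 : ℝ) / n) ^ (-s.re) * (1 / n) ^ 2 := by positivity
    rw [t2]
    calc _ ≤ (4 * (((1 : ℝ) / n) ^ (-s.re) * (1 / n))) / 12 / n := by gcongr
      _ = (1 / 3) * (((1 : ℝ) / n) ^ (-s.re) * (1 / n) ^ 2) := by ring
      _ ≤ _ := by linarith
  have b4 : ‖∑ m ∈ Finset.Ico 1 n, E m‖ ≤
      36 * ((n : ℝ) ^ (s.re - 2) * ∑ m ∈ Finset.Ico 1 n, (m : ℝ) ^ (-s.re - 1)) := by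
    refine (norm_sum_le _ _).trans ((Finset.sum_le_sum hEb).trans (le_of_eq ?_))
    rw [← Finset.mul_sum, ← Finset.mul_sum]
  rw [hr]
  refine norm_add₄_le.trans ?_
  have hp : 0 ≤ (n : ℝ) ^ (s.re - 2) := by positivity
  linarith

end TornAux

namespace TornAux

/-- the domain of continuation -/
def UU : Set ℂ := Metric.ball (3 / 8 : ℂ) (1 / 2)

lemma UU_facts {s : ℂ} (hs : s ∈ UU) : ‖s‖ ≤ 1 ∧ -(1 / 8) < s.re ∧ s.re < 7 / 8 := by
  rw [UU, Metric.mem_ball, dist_eq_norm] at hs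
  have h1 := (Complex.abs_re_le_norm (s - 3 / 8)).trans_lt hs
  have h38 : (3 / 8 : ℂ) = ((3 / 8 : ℝ) : ℂ) := by push_cast; ring
  have h2 : (s - 3 / 8).re = s.re - 3 / 8 := by rw [h38, Complex.sub_re, Complex.ofReal_re]
  rw [h2, abs_lt] at h1
  refine ⟨?_, by linarith [h1.1], by linarith [h1.2]⟩
  have h3 : ‖s‖ ≤ ‖s - 3 / 8‖ + ‖(3 / 8 : ℂ)‖ := by
    simpa using norm_add_le (s - 3 / 8) (3 / 8)
  have h4 : ‖(3 / 8 : ℂ)‖ = 3 / 8 := by rw [h38, Complex.norm_real]; norm_num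
  rw [h4] at h3
  linarith

noncomputable def AA (s : ℂ) : ℂ :=
  ∫ x in (0 : ℝ)..1, (x : ℂ) ^ (-s) * ((1 + x : ℝ) : ℂ) ^ (-s)

noncomputable def dd (s : ℂ) : ℂ := -((2 : ℂ) ^ (-s) + (2 : ℂ) ^ (-s - 1)) / 12

lemma cpow_one_sub_pos {x : ℝ} (hx : 0 < x) (s : ℂ) :
    (x : ℂ) ^ (1 - s) = x * (x : ℂ) ^ (-s) := by
  have hx' : (x : ℂ) ≠ 0 := by exact_mod_cast hx.ne'
  rw [sub_eq_add_neg, Complex.cpow_add _ _ hx', Complex.cpow_one]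

lemma AA_eq {s : ℂ} (hs : s.re < 1) :
    AA s = 1 / (1 - s) - s / (2 - s) + ∫ x in (0 : ℝ)..1, hh s x := by
  have i1 : IntervalIntegrable (fun x : ℝ => (x : ℂ) ^ (-s)) MeasureTheory.volume 0 1 :=
    intervalIntegral.intervalIntegrable_cpow' (by simp; linarith)
  have i2 : IntervalIntegrable (fun x : ℝ => (x : ℂ) ^ (1 - s)) MeasureTheory.volume 0 1 :=
    intervalIntegral.intervalIntegrable_cpow' (by simp; linarith)
  have i3 : IntervalIntegrable (hh s) MeasureTheory.volume 0 1 :=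
    hh_int hs le_rfl zero_le_one
  have e1 : ∫ x in (0 : ℝ)..1, (x : ℂ) ^ (-s) = 1 / (1 - s) := by
    rw [integral_cpow (Or.inl (by simp; linarith))]
    have : -s + 1 = 1 - s := by ring
    have h0 : (1 - s) ≠ 0 := by
      intro h; have := congrArg Complex.re h; simp at this; linarith
    rw [this]; simp [Complex.zero_cpow h0]
  have e2 : ∫ x in (0 : ℝ)..1, (x : ℂ) ^ (1 - s) = 1 / (2 - s) := by
    rw [integral_cpow (Or.inl (by simp; linarith))]
    have : 1 - s + 1 = 2 - s := by ring
    have h0 : (2 - s) ≠ 0 := by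
      intro h; have := congrArg Complex.re h; simp at this; linarith
    rw [this]; simp [Complex.zero_cpow h0]
  have : AA s = ∫ x in (0 : ℝ)..1, ((x : ℂ) ^ (-s) - s * (x : ℂ) ^ (1 - s) + hh s x) := by
    unfold AA
    refine intervalIntegral.integral_congr_ae (Filter.Eventually.of_forall fun x hx => ?_)
    rw [Set.uIoc_of_le zero_le_one] at hx
    rw [cpow_one_sub_pos hx.1, hh, al0, rho]
    ring
  rw [this, intervalIntegral.integral_add (i1.sub (i2.const_mul s)) i3,
    intervalIntegral.integral_sub i1 (i2.const_mul s), intervalIntegral.integral_const_mul, e1, e2]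
  ring

lemma dd_eq (s : ℂ) : s * dd s = (-s + s * (s - 1) + hh1 s 1) / 12 := by
  unfold dd hh1 al1 al0 rho rho1
  have : ((1 + 1 : ℝ) : ℂ) = 2 := by push_cast; norm_num
  rw [this]
  simp only [Complex.ofReal_one, Complex.one_cpow]
  ring

noncomputable def RR (n : ℕ) (s : ℂ) : ℂ :=
  ∑ m ∈ Finset.Ico 1 n, (m : ℂ) ^ (-s) * (n : ℂ) ^ (-s) * ((m : ℂ) + n) ^ (-s)
    + (n : ℂ) ^ (-s) * (n : ℂ) ^ (-s) * ((n : ℂ) + n) ^ (-s) / 2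
    - AA s * (n * ((n : ℂ) ^ (-s)) ^ 3) - cst s * ((n : ℂ) ^ (-s)) ^ 2
    + s * cst (s - 1) * (((n : ℂ) ^ (-s)) ^ 2 / n) - s * dd s * (((n : ℂ) ^ (-s)) ^ 3 / n)

lemma term_eq {m n : ℕ} (hm : 1 ≤ m) (hn : 1 ≤ n) (s : ℂ) :
    (m : ℂ) ^ (-s) * (n : ℂ) ^ (-s) * ((m : ℂ) + n) ^ (-s) =
      ((n : ℂ) ^ (-s)) ^ 2 * (m : ℂ) ^ (-s) - s * (((n : ℂ) ^ (-s)) ^ 2 / n) * (m : ℂ) ^ (-(s - 1))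
        + ((n : ℂ) ^ (-s)) ^ 3 * hh s (m / n) := by
  have hm0 : (0 : ℝ) < m := by exact_mod_cast hm
  have hn0 : (0 : ℝ) < n := by exact_mod_cast hn
  have hnc : (n : ℂ) ≠ 0 := by exact_mod_cast hn0.ne'
  have h1 : (m : ℂ) ^ (-s) = (n : ℂ) ^ (-s) * (((m / n : ℝ)) : ℂ) ^ (-s) := by
    rw [← Complex.ofReal_natCast n, ← Complex.mul_cpow_ofReal_nonneg hn0.le (by positivity)]
    congr 1; push_cast; field_simp
  have h2 : ((m : ℂ) + n) ^ (-s) = (n : ℂ) ^ (-s) * ((1 + m / n : ℝ) : ℂ) ^ (-s) := by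
    rw [← Complex.ofReal_natCast n, ← Complex.mul_cpow_ofReal_nonneg hn0.le (by positivity)]
    congr 1; push_cast; field_simp; ring
  have h3 : (m : ℂ) ^ (-(s - 1)) = m * (m : ℂ) ^ (-s) := by
    have := cpow_one_sub_pos hm0 s
    simp only [Complex.ofReal_natCast] at this
    rw [← this]; congr 1; ring
  rw [h3, h2, hh, al0, rho, h1]
  push_cast
  field_simp
  ring

lemma RR_eq {n : ℕ} (hn : 1 ≤ n) {s : ℂ} (hs : s ∈ UU) :
    RR n s = -(((n : ℂ) ^ (-s)) ^ 2 * ∑' m : ℕ, eps (m + n) s)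
      + s * (((n : ℂ) ^ (-s)) ^ 2 / n) * (∑' m : ℕ, eps (m + n) (s - 1))
      + ((n : ℂ) ^ (-s)) ^ 3 * (∑ m ∈ Finset.Ico 1 n, hh s (m / n) + hh s 1 / 2
        - n * (∫ x in (0 : ℝ)..1, hh s x) - hh1 s 1 / 12 / n) := by
  obtain ⟨-, hs1, hs2⟩ := UU_facts hs
  have hn0 : (0 : ℝ) < n := by exact_mod_cast hn
  have hnc : (n : ℂ) ≠ 0 := by exact_mod_cast hn0.ne'
  have n1 : s ≠ 1 := by rintro rfl; simp at hs2; linarith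
  have n2 : s - 1 ≠ 1 := by
    intro h; have := congrArg Complex.re h; simp at this; linarith
  have p0 := sum_pow hn n1 (by linarith)
  have p1 := sum_pow hn n2 (by simp; linarith)
  have e1 : (n : ℂ) ^ (1 - s) = n * (n : ℂ) ^ (-s) := by
    have := cpow_one_sub_pos hn0 s
    simpa only [Complex.ofReal_natCast] using this
  have e2 : (n : ℂ) ^ (-s - 1) = (n : ℂ) ^ (-s) / n := by
    rw [Complex.cpow_sub _ _ hnc, Complex.cpow_one]
  have e3 : (n : ℂ) ^ (1 - (s - 1)) = n * (n * (n : ℂ) ^ (-s)) := by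
    rw [← e1, show 1 - (s - 1) = 1 + (1 - s) by ring, Complex.cpow_add _ _ hnc, Complex.cpow_one]
  have e4 : (n : ℂ) ^ (-(s - 1)) = n * (n : ℂ) ^ (-s) := by rw [← e1]; congr 1; ring
  have e5 : (n : ℂ) ^ (-(s - 1) - 1) = (n : ℂ) ^ (-s) := by congr 1; ring
  have hsum : ∑ m ∈ Finset.Ico 1 n, (m : ℂ) ^ (-s) * (n : ℂ) ^ (-s) * ((m : ℂ) + n) ^ (-s) =
      ((n : ℂ) ^ (-s)) ^ 2 * ∑ m ∈ Finset.Ico 1 n, (m : ℂ) ^ (-s)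
      - s * (((n : ℂ) ^ (-s)) ^ 2 / n) * ∑ m ∈ Finset.Ico 1 n, (m : ℂ) ^ (-(s - 1))
        + ((n : ℂ) ^ (-s)) ^ 3 * ∑ m ∈ Finset.Ico 1 n, hh s (m / n) := by
    rw [Finset.mul_sum, Finset.mul_sum, Finset.mul_sum, ← Finset.sum_sub_distrib,
      ← Finset.sum_add_distrib]
    refine Finset.sum_congr rfl fun m hm => term_eq (Finset.mem_Ico.1 hm).1 hn s
  have hd := term_eq hn hn s
  rw [div_self hn0.ne'] at hd
  rw [RR, hsum, hd, AA_eq (by linarith), dd_eq]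
  rw [e4] at hd p1
  rw [e1, e2] at p0
  rw [e3, e5] at p1
  rw [e4]
  have z1 : (1 - s) ≠ 0 := fun h => n1 (by linear_combination -h)
  have z2 : (1 - (s - 1)) ≠ 0 := fun h => n2 (by linear_combination -h)
  have z3 : (2 - s) = 1 - (s - 1) := by ring
  rw [z3]
  set X := (n : ℂ) ^ (-s)
  set N := (n : ℂ)
  have q1 : N / N = 1 := div_self hnc
  have q2 : N⁻¹ * N = 1 := inv_mul_cancel₀ hnc
  linear_combination X ^ 2 * p0 - s * (X ^ 2 / N) * p1 + (-X^3 * s * N / (1 - (s-1))) * q2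

noncomputable def KK : ℝ := ∑' m : ℕ, ((m + 1 : ℕ) : ℝ) ^ (-(9 / 8) : ℝ)

lemma KK_summable : Summable fun m : ℕ => ((m + 1 : ℕ) : ℝ) ^ (-(9 / 8) : ℝ) :=
  (summable_nat_add_iff (f := fun m : ℕ => (m : ℝ) ^ (-(9 / 8) : ℝ)) 1).2
    (Real.summable_nat_rpow.2 (by norm_num))

lemma KK_nonneg : 0 ≤ KK := tsum_nonneg fun m => by positivity

lemma tail_bd {n : ℕ} (hn : 1 ≤ n) {w : ℂ} (hw1 : w ≠ 1) {c : ℝ} (hw : -(9 / 8) + -c < w.re)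
    (hwc : -(9/8) < w.re)
    (hW : ‖w‖ * ‖w + 1‖ * ‖w + 2‖ ≤ 6) {B : ℝ}
    (hB : B + (-w.re - 15 / 8) ≤ -(3 / 2)) :
    (n : ℝ) ^ B * ‖∑' m : ℕ, eps (m + n) w‖ ≤ 6 * KK * (n : ℝ) ^ (-(3 / 2) : ℝ) := by
  have hn1 : (1 : ℝ) ≤ n := by exact_mod_cast hn
  have hn0 : (0 : ℝ) < n := by linarith
  have hb : ∀ m : ℕ, ‖eps (m + n) w‖ ≤
      6 * (n : ℝ) ^ (-w.re - 15 / 8) * ((m + 1 : ℕ) : ℝ) ^ (-(9 / 8) : ℝ) := by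
    intro m
    have hmn : (0 : ℝ) < ((m + n : ℕ) : ℝ) := by exact_mod_cast (by omega)
    refine (eps_bound (by omega) hw1 (by linarith)).trans ?_
    have e : -w.re - 3 = (-w.re - 15 / 8) + (-(9 / 8)) := by ring
    rw [e, Real.rpow_add hmn, mul_assoc 6]
    have c1 : ((m + n : ℕ) : ℝ) ^ (-w.re - 15 / 8) ≤ (n : ℝ) ^ (-w.re - 15 / 8) :=
      Real.rpow_le_rpow_of_nonpos hn0 (by push_cast; linarith [m.cast_nonneg (α := ℝ)]) (by linarith)
    have c2 : ((m + n : ℕ) : ℝ) ^ (-(9 / 8) : ℝ) ≤ ((m + 1 : ℕ) : ℝ) ^ (-(9 / 8) : ℝ) :=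
      Real.rpow_le_rpow_of_nonpos (by positivity) (by push_cast; linarith) (by norm_num)
    gcongr
  have := tsum_of_norm_bounded ((KK_summable.mul_left (6 * (n : ℝ) ^ (-w.re - 15 / 8))).hasSum) hb
  rw [tsum_mul_left] at this
  calc _ ≤ (n : ℝ) ^ B * (6 * (n : ℝ) ^ (-w.re - 15 / 8) * KK) := by gcongr; exact this
    _ = 6 * KK * (n : ℝ) ^ (B + (-w.re - 15 / 8)) := by rw [Real.rpow_add hn0]; ring
    _ ≤ _ := by
      have := KK_nonneg
      gcongr

lemma RR_bound {n : ℕ} (hn : 1 ≤ n) {s : ℂ} (hs : s ∈ UU) :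
    ‖RR n s‖ ≤ (36 + 48 * KK) * (n : ℝ) ^ (-(3 / 2) : ℝ) := by
  obtain ⟨hs0, hs1, hs2⟩ := UU_facts hs
  have hn1 : (1 : ℝ) ≤ n := by exact_mod_cast hn
  have hn0 : (0 : ℝ) < n := by linarith
  have n1 : s ≠ 1 := by rintro rfl; simp at hs2; linarith
  have n2 : s - 1 ≠ 1 := by
    intro h; have := congrArg Complex.re h; simp at this; linarith
  have hX : ‖(n : ℂ) ^ (-s)‖ = (n : ℝ) ^ (-s.re) := by
    have := norm_cpow hn0 (-s)
    simpa using this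
  have hX2 : ‖((n : ℂ) ^ (-s)) ^ 2‖ = (n : ℝ) ^ (-2 * s.re) := by
    rw [norm_pow, hX, ← Real.rpow_mul_natCast hn0.le]; congr 1; push_cast; ring
  have hX3 : ‖((n : ℂ) ^ (-s)) ^ 3‖ = (n : ℝ) ^ (-3 * s.re) := by
    rw [norm_pow, hX, ← Real.rpow_mul_natCast hn0.le]; congr 1; push_cast; ring
  have a1 : ‖s + 1‖ ≤ 2 := (norm_add_le _ _).trans (by rw [norm_one]; linarith)
  have a2 : ‖s + 2‖ ≤ 3 := (norm_add_le _ _).trans (by simp; linarith)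
  have a3 : ‖s - 1‖ ≤ 2 := (norm_sub_le _ _).trans (by rw [norm_one]; linarith)
  have t0 : ‖-(((n : ℂ) ^ (-s)) ^ 2 * ∑' m : ℕ, eps (m + n) s)‖ ≤
      6 * KK * (n : ℝ) ^ (-(3 / 2) : ℝ) := by
    rw [norm_neg, norm_mul, hX2]
    refine tail_bd (c := 0) hn n1 (by linarith) (by linarith) ?_ (by linarith)
    calc _ ≤ (1 : ℝ) * 2 * 3 := by gcongr
      _ = 6 := by norm_num
  have t1 : ‖s * (((n : ℂ) ^ (-s)) ^ 2 / n) * (∑' m : ℕ, eps (m + n) (s - 1))‖ ≤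
      6 * KK * (n : ℝ) ^ (-(3 / 2) : ℝ) := by
    rw [norm_mul, norm_mul, norm_div, hX2, Complex.norm_natCast]
    have : (n : ℝ) ^ (-2 * s.re) / n = (n : ℝ) ^ (-2 * s.re - 1) := (Real.rpow_sub_one hn0.ne' _).symm
    rw [this]
    have hb := tail_bd (c := 0) (B := -2 * s.re - 1) hn n2 (by simp; linarith) (by simp; linarith) (by
      rw [show s - 1 + 1 = s by ring, show s - 1 + 2 = s + 1 by ring]
      calc _ ≤ (2 : ℝ) * 1 * 2 := by gcongr
        _ ≤ 6 := by norm_num) (by simp; linarith)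
    refine le_trans ?_ hb
    gcongr
    calc _ ≤ 1 * (n : ℝ) ^ (-2 * s.re - 1) := by gcongr
      _ = _ := one_mul _
  have t2 := hh_sum hs0 (by linarith) (by linarith) hn
  have t3 : (n : ℝ) ^ (-3 * s.re) * (36 * ((n : ℝ) ^ (s.re - 2) *
        (1 + ∑ m ∈ Finset.Ico 1 n, (m : ℝ) ^ (-s.re - 1)))) ≤
      36 * (1 + KK) * (n : ℝ) ^ (-(3 / 2) : ℝ) := by
    have e : (n : ℝ) ^ (-3 * s.re) * (n : ℝ) ^ (s.re - 2) = (n : ℝ) ^ (-2 * s.re - 2) := by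
      rw [← Real.rpow_add hn0]; congr 1; ring
    have b1 : (n : ℝ) ^ (-2 * s.re - 2) ≤ (n : ℝ) ^ (-(3 / 2) : ℝ) :=
      Real.rpow_le_rpow_of_exponent_le hn1 (by linarith)
    have b2 : (n : ℝ) ^ (-2 * s.re - 2) * ∑ m ∈ Finset.Ico 1 n, (m : ℝ) ^ (-s.re - 1) ≤
        (n : ℝ) ^ (-(3 / 2) : ℝ) * KK := by
      have : ∑ m ∈ Finset.Ico 1 n, (m : ℝ) ^ (-(9 / 8) : ℝ) ≤ KK := by
        rw [Finset.sum_Ico_eq_sum_range]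
        refine le_trans (le_of_eq ?_) (KK_summable.sum_le_tsum (Finset.range (n - 1))
          fun m _ => by positivity)
        exact Finset.sum_congr rfl fun i _ => by rw [add_comm]
      refine le_trans ?_ (mul_le_mul_of_nonneg_left this (by positivity))
      rw [Finset.mul_sum, Finset.mul_sum]
      refine Finset.sum_le_sum fun m hm => ?_
      rw [Finset.mem_Ico] at hm
      have hm1 : (1 : ℝ) ≤ m := by exact_mod_cast hm.1
      have hmn : (m : ℝ) ≤ n := by exact_mod_cast hm.2.le
      have hm0 : (0 : ℝ) < m := by linarith
      have c1 : (m : ℝ) ^ (-s.re - 1) = (m : ℝ) ^ (1 / 8 - s.re) * (m : ℝ) ^ (-(9 / 8) : ℝ) := by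
        rw [← Real.rpow_add hm0]; congr 1; ring
      have c2 : (m : ℝ) ^ (1 / 8 - s.re) ≤ (n : ℝ) ^ (1 / 4 : ℝ) :=
        (Real.rpow_le_rpow_of_exponent_le hm1 (by linarith)).trans
          (Real.rpow_le_rpow hm0.le hmn (by norm_num))
      have c3 : (n : ℝ) ^ (-2 * s.re - 2) * (n : ℝ) ^ (1 / 4 : ℝ) ≤ (n : ℝ) ^ (-(3 / 2) : ℝ) := by
        rw [← Real.rpow_add hn0]
        exact Real.rpow_le_rpow_of_exponent_le hn1 (by linarith)
      rw [c1, ← mul_assoc]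
      gcongr
      refine le_trans ?_ c3
      gcongr
    calc _ = 36 * ((n : ℝ) ^ (-2 * s.re - 2) + (n : ℝ) ^ (-2 * s.re - 2) *
            ∑ m ∈ Finset.Ico 1 n, (m : ℝ) ^ (-s.re - 1)) := by rw [← e]; ring
      _ ≤ 36 * ((n : ℝ) ^ (-(3 / 2) : ℝ) + (n : ℝ) ^ (-(3 / 2) : ℝ) * KK) := by gcongr
      _ = _ := by ring
  rw [RR_eq hn hs]
  refine norm_add₃_le.trans ?_
  have t4 : ‖((n : ℂ) ^ (-s)) ^ 3 * (∑ m ∈ Finset.Ico 1 n, hh s (m / n) + hh s 1 / 2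
        - n * (∫ x in (0 : ℝ)..1, hh s x) - hh1 s 1 / 12 / n)‖ ≤
        36 * (1 + KK) * (n : ℝ) ^ (-(3 / 2) : ℝ) := by
    rw [norm_mul, hX3]
    refine le_trans ?_ t3
    gcongr
  linarith

end TornAux

namespace TornAux

lemma diff_cpow {a : ℂ} (ha : a ≠ 0) {g : ℂ → ℂ} {w : ℂ} (hg : DifferentiableAt ℂ g w) :
    DifferentiableAt ℂ (fun z => a ^ g z) w :=
  hg.const_cpow (Or.inl ha)

/-- domain for cst -/
def VV : Set ℂ := {w | ‖w‖ < 3 ∧ -(9 / 8) < w.re ∧ w.re < 7 / 8}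

lemma VV_open : IsOpen VV := by
  have h1 : IsOpen {w : ℂ | ‖w‖ < 3} := isOpen_lt continuous_norm continuous_const
  have h2 : IsOpen {w : ℂ | -(9 / 8) < w.re} := isOpen_lt continuous_const Complex.continuous_re
  have h3 : IsOpen {w : ℂ | w.re < 7 / 8} := isOpen_lt Complex.continuous_re continuous_const
  exact h1.inter (h2.inter h3)

lemma VV_ne {w : ℂ} (h : w ∈ VV) : w ≠ 1 := by
  rintro rfl
  have := h.2.2
  norm_num at this

lemma eps_diff {m : ℕ} (hm : 1 ≤ m) {w : ℂ} (hw : w ≠ 1) : DifferentiableAt ℂ (eps m) w := by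
  have h0 : (m : ℂ) ≠ 0 := by exact_mod_cast (by omega : m ≠ 0)
  have h1 : ((m + 1 : ℕ) : ℂ) ≠ 0 := by exact_mod_cast (by omega : m + 1 ≠ 0)
  have h2 : 1 - w ≠ 0 := sub_ne_zero.2 hw.symm
  have e1 : DifferentiableAt ℂ (fun z : ℂ => (m : ℂ) ^ (-z)) w := diff_cpow h0 (by fun_prop)
  have e2 : DifferentiableAt ℂ (fun z : ℂ => ((m + 1 : ℕ) : ℂ) ^ (-z)) w := diff_cpow h1 (by fun_prop)
  have e3 : DifferentiableAt ℂ (fun z : ℂ => (m : ℂ) ^ (1 - z)) w := diff_cpow h0 (by fun_prop)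
  have e4 : DifferentiableAt ℂ (fun z : ℂ => ((m + 1 : ℕ) : ℂ) ^ (1 - z)) w := diff_cpow h1 (by fun_prop)
  have e5 : DifferentiableAt ℂ (fun z : ℂ => (m : ℂ) ^ (-z - 1)) w := diff_cpow h0 (by fun_prop)
  have e6 : DifferentiableAt ℂ (fun z : ℂ => ((m + 1 : ℕ) : ℂ) ^ (-z - 1)) w := diff_cpow h1 (by fun_prop)
  unfold eps
  exact (((e1.add e2).div_const 2).sub ((e4.sub e3).div (by fun_prop) h2)).add
    ((differentiableAt_id.mul (e6.sub e5)).div_const 12)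

lemma cst_diff {w : ℂ} (hw : w ∈ VV) : DifferentiableAt ℂ cst w := by
  have h : DifferentiableOn ℂ (fun w : ℂ => ∑' m : ℕ, eps (m + 1) w) VV := by
    refine differentiableOn_tsum_of_summable_norm
      (u := fun m : ℕ => 60 * ((m + 1 : ℕ) : ℝ) ^ (-(9 / 8) : ℝ)) (KK_summable.mul_left 60) ?_ VV_open ?_
    · intro i w hw
      exact (eps_diff (by omega) (VV_ne hw)).differentiableWithinAt
    · intro i w hw
      refine (eps_bound (by omega) (VV_ne hw) (by have := hw.2.1; linarith)).trans ?_
      have a1 : ‖w‖ ≤ 3 := hw.1.le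
      have a2 : ‖w + 1‖ ≤ 4 := (norm_add_le _ _).trans (by norm_num; linarith)
      have a3 : ‖w + 2‖ ≤ 5 := (norm_add_le _ _).trans (by norm_num; linarith)
      have a4 : ‖w‖ * ‖w + 1‖ * ‖w + 2‖ ≤ 60 := by
        calc ‖w‖ * ‖w + 1‖ * ‖w + 2‖ ≤ 3 * 4 * 5 := by gcongr
          _ = 60 := by norm_num
      have a5 : ((i + 1 : ℕ) : ℝ) ^ (-w.re - 3) ≤ ((i + 1 : ℕ) : ℝ) ^ (-(9 / 8) : ℝ) :=
        Real.rpow_le_rpow_of_exponent_le (by exact_mod_cast (by omega : 1 ≤ i + 1))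
          (by have := hw.2.1; linarith)
      exact mul_le_mul a4 a5 (by positivity) (by norm_num)
  have h' := h.differentiableAt (VV_open.mem_nhds hw)
  have h2 : 1 - w ≠ 0 := sub_ne_zero.2 (VV_ne hw).symm
  unfold cst
  refine DifferentiableAt.add ?_ h'
  fun_prop (disch := assumption)

lemma UU_VV {s : ℂ} (hs : s ∈ UU) : s ∈ VV := by
  obtain ⟨h1, h2, h3⟩ := UU_facts hs
  exact ⟨by linarith, by linarith, h3⟩

lemma UU_VV' {s : ℂ} (hs : s ∈ UU) : s - 1 ∈ VV := by
  obtain ⟨h1, h2, h3⟩ := UU_facts hs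
  refine ⟨?_, ?_, ?_⟩
  · have : ‖s - 1‖ ≤ ‖s‖ + ‖(1 : ℂ)‖ := norm_sub_le _ _
    norm_num at this
    linarith
  · simp; linarith
  · simp; linarith

lemma UU_open : IsOpen UU := Metric.isOpen_ball

lemma dd_diff (s : ℂ) : DifferentiableAt ℂ dd s := by
  unfold dd
  have e1 : DifferentiableAt ℂ (fun z : ℂ => (2 : ℂ) ^ (-z)) s := diff_cpow (by norm_num) (by fun_prop)
  have e2 : DifferentiableAt ℂ (fun z : ℂ => (2 : ℂ) ^ (-z - 1)) s :=
    diff_cpow (by norm_num) (by fun_prop)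
  exact ((e1.add e2).neg).div_const 12

lemma AA_diff {s : ℂ} (hs : s ∈ UU) : DifferentiableAt ℂ AA s := by
  have base : ∀ t : ℝ, t ∈ Set.uIoc (0 : ℝ) 1 → ∀ z ∈ UU,
      ‖(t : ℂ) ^ (-z) * ((1 + t : ℝ) : ℂ) ^ (-z)‖ ≤ 2 * t ^ (-(7 / 8) : ℝ) := by
    intro t ht z hz
    rw [Set.uIoc_of_le zero_le_one] at ht
    obtain ⟨h1, h2, h3⟩ := UU_facts hz
    have h0 : 0 < t := ht.1
    rw [norm_mul, norm_cpow h0, norm_cpow (by linarith : 0 < 1 + t), mul_comm]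
    have b1 : t ^ (-z).re ≤ t ^ (-(7 / 8) : ℝ) :=
      Real.rpow_le_rpow_of_exponent_ge h0 ht.2 (by simp; linarith)
    have b2 : (1 + t) ^ (-z).re ≤ 2 := by
      calc (1 + t) ^ (-z).re ≤ (1 + t) ^ (1 : ℝ) :=
            Real.rpow_le_rpow_of_exponent_le (by linarith) (by simp; linarith)
        _ ≤ 2 := by rw [Real.rpow_one]; linarith [ht.2]
    exact mul_le_mul b2 b1 (by positivity) (by norm_num)
  have meas : ∀ z : ℂ, Measurable (fun t : ℝ => (t : ℂ) ^ (-z) * ((1 + t : ℝ) : ℂ) ^ (-z)) := by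
    intro z
    have m1 : Measurable (fun t : ℝ => (t : ℂ)) := Complex.measurable_ofReal
    have m2 : Measurable (fun t : ℝ => ((1 + t : ℝ) : ℂ)) :=
      Complex.measurable_ofReal.comp (measurable_const.add measurable_id)
    exact (m1.pow_const _).mul (m2.pow_const _)
  have key := intervalIntegral.hasDerivAt_integral_of_dominated_loc_of_deriv_le
    (μ := MeasureTheory.volume) (a := (0 : ℝ)) (b := 1) (x₀ := s) (s := UU)
    (F := fun z (t : ℝ) => (t : ℂ) ^ (-z) * ((1 + t : ℝ) : ℂ) ^ (-z))
    (F' := fun z (t : ℝ) => -((Real.log t + Real.log (1 + t) : ℝ) : ℂ) *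
      ((t : ℂ) ^ (-z) * ((1 + t : ℝ) : ℂ) ^ (-z)))
    (bound := fun t => 34 * t ^ (-(15 / 16) : ℝ)) (UU_open.mem_nhds hs)
    (Filter.Eventually.of_forall fun z => (meas z).aestronglyMeasurable) ?_ ?_ ?_ ?_ ?_
  · exact key.2.differentiableAt
  · have hi : IntervalIntegrable (fun t : ℝ => 2 * t ^ (-(7 / 8) : ℝ)) MeasureTheory.volume 0 1 :=
      (intervalIntegral.intervalIntegrable_rpow' (by norm_num)).const_mul 2
    refine hi.mono_fun' (meas s).aestronglyMeasurable ?_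
    filter_upwards [MeasureTheory.ae_restrict_mem measurableSet_uIoc] with t ht
    exact base t ht s hs
  · have m3 : Measurable (fun t : ℝ => -((Real.log t + Real.log (1 + t) : ℝ) : ℂ)) := by
      refine (Complex.measurable_ofReal.comp ?_).neg
      exact Real.measurable_log.add (Real.measurable_log.comp (measurable_const.add measurable_id))
    exact (m3.mul (meas s)).aestronglyMeasurable
  · refine Filter.Eventually.of_forall fun t ht z hz => ?_
    have b := base t ht z hz
    rw [Set.uIoc_of_le zero_le_one] at ht
    have h0 : 0 < t := ht.1
    rw [norm_mul, norm_neg, Complex.norm_real, Real.norm_eq_abs]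
    have l1 := (Real.abs_log_mul_self_rpow_lt t (1 / 16) h0 ht.2 (by norm_num)).le
    have l2 : |Real.log (1 + t)| ≤ 1 := by
      rw [abs_of_nonneg (Real.log_nonneg (by linarith))]
      have := Real.log_le_sub_one_of_pos (by linarith : 0 < 1 + t)
      linarith [ht.2]
    have l3 : t ^ (1 / 16 : ℝ) ≤ 1 := Real.rpow_le_one h0.le ht.2 (by norm_num)
    have l4 : t ^ (-(7 / 8) : ℝ) = t ^ (1 / 16 : ℝ) * t ^ (-(15 / 16) : ℝ) := by
      rw [← Real.rpow_add h0]; norm_num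
    have p0 : 0 ≤ t ^ (1 / 16 : ℝ) := by positivity
    rw [abs_mul, abs_of_nonneg p0] at l1
    calc |Real.log t + Real.log (1 + t)| * ‖(t : ℂ) ^ (-z) * ((1 + t : ℝ) : ℂ) ^ (-z)‖
        ≤ (|Real.log t| + |Real.log (1 + t)|) * (2 * t ^ (-(7 / 8) : ℝ)) := by
          gcongr
          exact abs_add_le _ _
      _ = 2 * (|Real.log t| * t ^ (1 / 16 : ℝ) + |Real.log (1 + t)| * t ^ (1 / 16 : ℝ))
            * t ^ (-(15 / 16) : ℝ) := by rw [l4]; ring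
      _ ≤ 2 * (1 / (1 / 16) + 1 * 1) * t ^ (-(15 / 16) : ℝ) := by gcongr
      _ = 34 * t ^ (-(15 / 16) : ℝ) := by norm_num
  · exact (intervalIntegral.intervalIntegrable_rpow' (by norm_num)).const_mul 34
  · refine Filter.Eventually.of_forall fun t ht z hz => ?_
    rw [Set.uIoc_of_le zero_le_one] at ht
    have h0 : 0 < t := ht.1
    have c1 : (t : ℂ) ≠ 0 := by exact_mod_cast h0.ne'
    have c2 : ((1 + t : ℝ) : ℂ) ≠ 0 := by exact_mod_cast (by linarith : 1 + t ≠ 0)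
    have d1 := (hasDerivAt_neg z).const_cpow (c := (t : ℂ)) (Or.inl c1)
    have d2 := (hasDerivAt_neg z).const_cpow (c := ((1 + t : ℝ) : ℂ)) (Or.inl c2)
    refine (d1.mul d2).congr_deriv ?_
    rw [← Complex.ofReal_log h0.le, ← Complex.ofReal_log (by linarith : 0 ≤ 1 + t)]
    push_cast
    ring

lemma RR_diff {n : ℕ} (hn : 1 ≤ n) {s : ℂ} (hs : s ∈ UU) : DifferentiableAt ℂ (RR n) s := by
  have h0 : (n : ℂ) ≠ 0 := by exact_mod_cast (by omega : n ≠ 0)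
  have hnn : (n : ℂ) + n ≠ 0 := by
    rw [← two_mul]; exact mul_ne_zero two_ne_zero h0
  have e1 : DifferentiableAt ℂ (fun z : ℂ => (n : ℂ) ^ (-z)) s := diff_cpow h0 (by fun_prop)
  have e2 : DifferentiableAt ℂ (fun z : ℂ => ((n : ℂ) + n) ^ (-z)) s := diff_cpow hnn (by fun_prop)
  have e3 : DifferentiableAt ℂ (fun z : ℂ => ∑ m ∈ Finset.Ico 1 n,
      (m : ℂ) ^ (-z) * (n : ℂ) ^ (-z) * ((m : ℂ) + n) ^ (-z)) s := by
    refine DifferentiableAt.fun_sum fun m hm => ?_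
    have hm1 : 1 ≤ m := (Finset.mem_Ico.1 hm).1
    have g0 : (m : ℂ) ≠ 0 := by exact_mod_cast (by omega : m ≠ 0)
    have g1 : (m : ℂ) + n ≠ 0 := by exact_mod_cast (by omega : m + n ≠ 0)
    exact ((diff_cpow g0 (by fun_prop)).mul e1).mul (diff_cpow g1 (by fun_prop))
  have c1 := cst_diff (UU_VV hs)
  have c2 : DifferentiableAt ℂ (fun z : ℂ => cst (z - 1)) s :=
    DifferentiableAt.comp (g := cst) (f := fun z : ℂ => z - 1) s (cst_diff (UU_VV' hs)) (by fun_prop)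
  have c3 := dd_diff s
  have c4 := AA_diff hs
  unfold RR
  fun_prop

lemma RRsum_diff : DifferentiableOn ℂ (fun s => ∑' n : ℕ, RR (n + 1) s) UU := by
  refine differentiableOn_tsum_of_summable_norm
    (u := fun n : ℕ => (36 + 48 * KK) * ((n + 1 : ℕ) : ℝ) ^ (-(3 / 2) : ℝ)) ?_ ?_ UU_open ?_
  · refine Summable.mul_left _ ?_
    exact (summable_nat_add_iff 1).2 (Real.summable_nat_rpow.2 (by norm_num))
  · intro i w hw
    exact (RR_diff (by omega) hw).differentiableWithinAt
  · intro i w hw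
    exact RR_bound (by omega) hw

lemma AA_zero : AA 0 = 1 := by simp [AA]
lemma dd_zero : dd 0 = -(1 / 8) := by
  have : (2 : ℂ) ^ (-1 : ℂ) = 1 / 2 := by
    rw [Complex.cpow_neg_one]; norm_num
  simp only [dd, neg_zero, zero_sub, this, Complex.cpow_zero]
  norm_num
lemma cst_zero : cst 0 = -(1 / 2) := by
  have : ∀ m : ℕ, eps (m + 1) 0 = 0 := by
    intro m
    simp [eps]
  simp only [cst, this, tsum_zero]
  norm_num
lemma cst_neg_one : cst (-1) = -(1 / 12) := by
  have : ∀ m : ℕ, eps (m + 1) (-1) = 0 := by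
    intro m
    simp only [eps, neg_neg, Complex.cpow_one]
    have : (1 : ℂ) - -1 = (2 : ℕ) := by norm_num
    rw [this, Complex.cpow_natCast, Complex.cpow_natCast]
    simp
    ring
  simp only [cst, this, tsum_zero]
  norm_num
lemma RR_zero {n : ℕ} (hn : 1 ≤ n) : RR n 0 = 0 := by
  simp [RR, AA_zero, cst_zero]
  push_cast [Nat.cast_sub hn]
  ring

end TornAux

namespace TornAux

/-- summand -/
noncomputable def GG (s : ℂ) (i j : ℕ) : ℂ :=
  ((i + 1 : ℕ) : ℂ) ^ (-s) * ((j + 1 : ℕ) : ℂ) ^ (-s) * (((i + 1 : ℕ) : ℂ) + ((j + 1 : ℕ) : ℂ)) ^ (-s)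

lemma GG_symm (s : ℂ) (i j : ℕ) : GG s i j = GG s j i := by
  unfold GG
  rw [add_comm ((i + 1 : ℕ) : ℂ)]
  ring

lemma torn_GG (s : ℂ) : tornheim s s s = ∑' p : ℕ × ℕ, GG s p.1 p.2 := by
  unfold tornheim
  rw [← (Equiv.pnatEquivNat.symm.prodCongr Equiv.pnatEquivNat.symm).tsum_eq]
  refine tsum_congr fun p => ?_
  simp only [GG, Complex.cpow_neg, Equiv.prodCongr_apply, Prod.map_fst, Prod.map_snd,
    Equiv.pnatEquivNat_symm_apply, one_div, mul_inv, Nat.succPNat_coe, Nat.succ_eq_add_one]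

lemma GG_summable {s : ℂ} (hs : 2 / 3 < s.re) : Summable fun p : ℕ × ℕ => GG s p.1 p.2 := by
  have ha : Summable fun i : ℕ => ((i + 1 : ℕ) : ℝ) ^ (-(3 / 2 * s.re)) :=
    (summable_nat_add_iff 1).2 (Real.summable_nat_rpow.2 (by linarith))
  have h := ha.mul_of_nonneg ha (fun i => by positivity) (fun i => by positivity)
  refine Summable.of_norm_bounded h ?_
  rintro ⟨i, j⟩
  have hx : (0 : ℝ) < ((i + 1 : ℕ) : ℝ) := by positivity
  have hy : (0 : ℝ) < ((j + 1 : ℕ) : ℝ) := by positivity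
  simp only [GG]
  generalize hX : ((i + 1 : ℕ) : ℝ) = x at *
  generalize hY : ((j + 1 : ℕ) : ℝ) = y at *
  have eX : ((i + 1 : ℕ) : ℂ) = (x : ℂ) := by rw [← hX]; push_cast; rfl
  have eY : ((j + 1 : ℕ) : ℂ) = (y : ℂ) := by rw [← hY]; push_cast; rfl
  rw [eX, eY, ← Complex.ofReal_add, norm_mul, norm_mul, norm_cpow hx, norm_cpow hy,
    norm_cpow (add_pos hx hy), Complex.neg_re]
  have e1 : (x + y) ^ (-s.re) ≤ x ^ (-(s.re / 2)) * y ^ (-(s.re / 2)) := by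
    have : (x + y) ^ (-s.re) = ((x + y) ^ (2 : ℝ)) ^ (-(s.re / 2)) := by
      rw [← Real.rpow_mul (by positivity)]; congr 1; ring
    rw [this, ← Real.mul_rpow hx.le hy.le]
    refine Real.rpow_le_rpow_of_nonpos (by positivity) ?_ (by linarith)
    rw [Real.rpow_two]
    nlinarith
  have e2 : x ^ (-(3 / 2 * s.re)) = x ^ (-s.re) * x ^ (-(s.re / 2)) := by
    rw [← Real.rpow_add hx]; congr 1; ring
  have e3 : y ^ (-(3 / 2 * s.re)) = y ^ (-s.re) * y ^ (-(s.re / 2)) := by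
    rw [← Real.rpow_add hy]; congr 1; ring
  rw [e2, e3]
  calc x ^ (-s.re) * y ^ (-s.re) * (x + y) ^ (-s.re)
      ≤ x ^ (-s.re) * y ^ (-s.re) * (x ^ (-(s.re / 2)) * y ^ (-(s.re / 2))) := by gcongr
    _ = _ := by ring

/-- half summand -/
noncomputable def HH (s : ℂ) (i j : ℕ) : ℂ :=
  if i < j then GG s i j else if i = j then GG s i j / 2 else 0

lemma HH_summable {s : ℂ} (hs : 2 / 3 < s.re) : Summable fun p : ℕ × ℕ => HH s p.1 p.2 := by
  refine Summable.of_norm_bounded (GG_summable hs).norm ?_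
  rintro ⟨i, j⟩
  simp only [HH]
  split_ifs
  · exact le_rfl
  · rw [norm_div]
    have := norm_nonneg (GG s i j)
    norm_num
  · simp

lemma torn_HH {s : ℂ} (hs : 2 / 3 < s.re) :
    tornheim s s s = 2 * ∑' j : ℕ, ∑ i ∈ Finset.range (j + 1), HH s i j := by
  have h1 := HH_summable hs
  have h2 : Summable fun p : ℕ × ℕ => HH s p.2 p.1 := h1.prod_symm
  have e : ∀ p : ℕ × ℕ, GG s p.1 p.2 = HH s p.1 p.2 + HH s p.2 p.1 := by
    rintro ⟨i, j⟩
    simp only [HH]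
    rcases lt_trichotomy i j with h | h | h
    · rw [if_pos h, if_neg (by omega), if_neg (by omega), add_zero]
    · subst h; simp
    · rw [if_neg (by omega), if_neg (by omega), if_pos h, zero_add, GG_symm]
  have e3 : ∑' p : ℕ × ℕ, HH s p.1 p.2 = ∑' p : ℕ × ℕ, HH s p.2 p.1 :=
    ((Equiv.prodComm ℕ ℕ).tsum_eq (fun p : ℕ × ℕ => HH s p.1 p.2)).symm
  rw [torn_GG, tsum_congr e, h1.tsum_add h2, e3, ← two_mul, h2.tsum_prod]
  congr 1
  refine tsum_congr fun j => ?_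
  refine tsum_eq_sum fun i hi => ?_
  have : j < i := by simpa using hi
  simp only [HH]
  rw [if_neg (by omega), if_neg (by omega)]

lemma HH_RR (s : ℂ) (j : ℕ) : ∑ i ∈ Finset.range (j + 1), HH s i j =
    AA s * (1 / ((j : ℂ) + 1) ^ (3 * s - 1)) + cst s * (1 / ((j : ℂ) + 1) ^ (2 * s))
      - s * cst (s - 1) * (1 / ((j : ℂ) + 1) ^ (2 * s + 1))
      + s * dd s * (1 / ((j : ℂ) + 1) ^ (3 * s + 1)) + RR (j + 1) s := by
  have h0 : ((j + 1 : ℕ) : ℂ) ≠ 0 := by exact_mod_cast (by omega : j + 1 ≠ 0)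
  rw [Finset.sum_range_succ]
  have e1 : ∑ i ∈ Finset.range j, HH s i j = ∑ m ∈ Finset.Ico 1 (j + 1),
      (m : ℂ) ^ (-s) * ((j + 1 : ℕ) : ℂ) ^ (-s) * ((m : ℂ) + ((j + 1 : ℕ) : ℂ)) ^ (-s) := by
    rw [Finset.sum_Ico_eq_sum_range]
    refine Finset.sum_congr (by simp) fun i hi => ?_
    have : i < j := by simpa using hi
    rw [HH, if_pos this, GG, add_comm 1 i]
  have e2 : HH s j j = ((j + 1 : ℕ) : ℂ) ^ (-s) * ((j + 1 : ℕ) : ℂ) ^ (-s) *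
      (((j + 1 : ℕ) : ℂ) + ((j + 1 : ℕ) : ℂ)) ^ (-s) / 2 := by
    simp [HH, GG]
  rw [e1, e2, RR]
  have ec : (j : ℂ) + 1 = ((j + 1 : ℕ) : ℂ) := by push_cast; rfl
  rw [ec]
  generalize ((j + 1 : ℕ) : ℂ) = x at *
  have p1 : 1 / x ^ (3 * s - 1) = x * (x ^ (-s)) ^ 3 := by
    rw [one_div, ← Complex.cpow_neg, ← Complex.cpow_nat_mul,
      show -(3 * s - 1) = 1 + ((3 : ℕ) : ℂ) * (-s) by push_cast; ring, Complex.cpow_add _ _ h0,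
      Complex.cpow_one]
  have p2 : 1 / x ^ (2 * s) = (x ^ (-s)) ^ 2 := by
    rw [one_div, ← Complex.cpow_neg, ← Complex.cpow_nat_mul]
    congr 1; push_cast; ring
  have p3 : 1 / x ^ (2 * s + 1) = (x ^ (-s)) ^ 2 / x := by
    rw [one_div, ← Complex.cpow_neg, ← Complex.cpow_nat_mul,
      show -(2 * s + 1) = ((2 : ℕ) : ℂ) * (-s) - 1 by push_cast; ring, Complex.cpow_sub _ _ h0,
      Complex.cpow_one]
  have p4 : 1 / x ^ (3 * s + 1) = (x ^ (-s)) ^ 3 / x := by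
    rw [one_div, ← Complex.cpow_neg, ← Complex.cpow_nat_mul,
      show -(3 * s + 1) = ((3 : ℕ) : ℂ) * (-s) - 1 by push_cast; ring, Complex.cpow_sub _ _ h0,
      Complex.cpow_one]
  rw [p1, p2, p3, p4]
  ring

lemma zeta_hasSum {w : ℂ} (hw : 1 < w.re) :
    HasSum (fun j : ℕ => 1 / ((j : ℂ) + 1) ^ w) (riemannZeta w) := by
  rw [zeta_eq_tsum_one_div_nat_add_one_cpow hw]
  refine Summable.hasSum ?_
  have := (summable_nat_add_iff 1).2 (Complex.summable_one_div_nat_cpow.2 hw)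
  simpa using this

/-- the continued function -/
noncomputable def FF (s : ℂ) : ℂ :=
  2 * (AA s * riemannZeta (3 * s - 1) + cst s * riemannZeta (2 * s)
    - s * cst (s - 1) * riemannZeta (2 * s + 1) + s * dd s * riemannZeta (3 * s + 1)
    + ∑' n : ℕ, RR (n + 1) s)

lemma torn_FF {s : ℂ} (hs : 2 / 3 < s.re) (hU : s ∈ UU) : tornheim s s s = FF s := by
  rw [torn_HH hs, FF]
  congr 1
  rw [tsum_congr (HH_RR s)]
  have hR : Summable fun n : ℕ => RR (n + 1) s := by
    refine Summable.of_norm_bounded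
      (g := fun n : ℕ => (36 + 48 * KK) * ((n + 1 : ℕ) : ℝ) ^ (-(3 / 2) : ℝ)) ?_
      (fun n => RR_bound (by omega) hU)
    exact ((summable_nat_add_iff 1).2 (Real.summable_nat_rpow.2 (by norm_num))).mul_left _
  have z1 := (zeta_hasSum (w := 3 * s - 1) (by simp; linarith)).mul_left (AA s)
  have z2 := (zeta_hasSum (w := 2 * s) (by simp; linarith)).mul_left (cst s)
  have z3 := (zeta_hasSum (w := 2 * s + 1) (by simp; linarith)).mul_left (s * cst (s - 1))
  have z4 := (zeta_hasSum (w := 3 * s + 1) (by simp; linarith)).mul_left (s * dd s)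
  exact ((((z1.add z2).sub z3).add z4).add hR.hasSum).tsum_eq

end TornAux

namespace TornAux

lemma zeta_mero (z : ℂ) : MeromorphicAt riemannZeta z := by
  have h0 : MeromorphicAt (fun s : ℂ => (s - 1)⁻¹ + riemannZeta₀ s) z := by
    have a1 : AnalyticAt ℂ riemannZeta₀ z := differentiable_riemannZeta₀.analyticAt z
    have a2 : AnalyticAt ℂ (fun s : ℂ => s - 1) z := by fun_prop
    exact a2.meromorphicAt.inv.add a1.meromorphicAt
  refine h0.congr ?_
  by_cases hz : z = 1
  · subst hz
    filter_upwards [self_mem_nhdsWithin] with s hs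
    exact (riemannZeta_eq_inv_sub_add hs).symm
  · have : ∀ᶠ s in nhds z, s ≠ 1 := isOpen_ne.mem_nhds hz
    filter_upwards [nhdsWithin_le_nhds this] with s hs
    exact (riemannZeta_eq_inv_sub_add hs).symm

lemma UU_diff_an {g : ℂ → ℂ} (hg : ∀ s ∈ UU, DifferentiableAt ℂ g s) {s : ℂ} (hs : s ∈ UU) :
    AnalyticAt ℂ g s :=
  DifferentiableOn.analyticAt (s := UU) (fun z hz => (hg z hz).differentiableWithinAt)
    (UU_open.mem_nhds hs)

lemma cst'_diff {s : ℂ} (hs : s ∈ UU) : DifferentiableAt ℂ (fun z : ℂ => cst (z - 1)) s :=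
  DifferentiableAt.comp (g := cst) (f := fun z : ℂ => z - 1) s (cst_diff (UU_VV' hs)) (by fun_prop)

lemma FF_mero {s : ℂ} (hs : s ∈ UU) : MeromorphicAt FF s := by
  have a1 := (UU_diff_an (fun z hz => AA_diff hz) hs).meromorphicAt
  have a2 := (UU_diff_an (fun z hz => cst_diff (UU_VV hz)) hs).meromorphicAt
  have a3 := (UU_diff_an (fun z hz => cst'_diff hz) hs).meromorphicAt
  have a4 := (UU_diff_an (fun z _ => dd_diff z) hs).meromorphicAt
  have a5 := (RRsum_diff.analyticAt (UU_open.mem_nhds hs)).meromorphicAt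
  have z1 := (zeta_mero (3 * s - 1)).comp_analyticAt (g := fun z : ℂ => 3 * z - 1) (x := s)
    (by fun_prop)
  have z2 := (zeta_mero (2 * s)).comp_analyticAt (g := fun z : ℂ => 2 * z) (x := s)
    (by fun_prop)
  have z3 := (zeta_mero (2 * s + 1)).comp_analyticAt (g := fun z : ℂ => 2 * z + 1) (x := s)
    (by fun_prop)
  have z4 := (zeta_mero (3 * s + 1)).comp_analyticAt (g := fun z : ℂ => 3 * z + 1) (x := s)
    (by fun_prop)
  have i := MeromorphicAt.id (𝕜 := ℂ) s
  exact (MeromorphicAt.const (2 : ℂ) s).mul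
    (((((a1.mul z1).add (a2.mul z2)).sub ((i.mul a3).mul z3)).add ((i.mul a4).mul z4)).add a5)

lemma zero_UU : (0 : ℂ) ∈ UU := by
  rw [UU, Metric.mem_ball, dist_eq_norm]
  norm_num

lemma zeta_lim {c : ℂ} (hc : c ≠ 0) : Filter.Tendsto (fun s : ℂ => s * riemannZeta (c * s + 1))
    (nhdsWithin 0 {(0 : ℂ)}ᶜ) (nhds (1 / c)) := by
  have h : Filter.Tendsto (fun s : ℂ => c * s + 1) (nhdsWithin 0 {(0 : ℂ)}ᶜ)
      (nhdsWithin 1 {(1 : ℂ)}ᶜ) := by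
    refine tendsto_nhdsWithin_iff.2 ⟨?_, ?_⟩
    · have : Filter.Tendsto (fun s : ℂ => c * s + 1) (nhds 0) (nhds (c * 0 + 1)) :=
        Continuous.tendsto (by fun_prop) 0
      rw [mul_zero, zero_add] at this
      exact this.mono_left nhdsWithin_le_nhds
    · filter_upwards [self_mem_nhdsWithin] with s hs
      have : s ≠ 0 := hs
      simp [hc, this]
  have h2 := (riemannZeta_residue_one.comp h).const_mul (1 / c)
  rw [mul_one] at h2
  refine h2.congr fun s => ?_
  simp only [Function.comp]
  field_simp
  ring

lemma FF_lim : Filter.Tendsto FF (nhdsWithin 0 {(0 : ℂ)}ᶜ) (nhds (1 / 3)) := by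
  have loc : ∀ {g : ℂ → ℂ}, DifferentiableAt ℂ g 0 →
      Filter.Tendsto g (nhdsWithin 0 {(0 : ℂ)}ᶜ) (nhds (g 0)) := fun hg =>
    hg.continuousAt.tendsto.mono_left nhdsWithin_le_nhds
  have a1 := loc (AA_diff zero_UU)
  have a2 := loc (cst_diff (UU_VV zero_UU))
  have a3 := loc (cst'_diff zero_UU)
  have a4 := loc (dd_diff 0)
  have a5 := loc (RRsum_diff.differentiableAt (UU_open.mem_nhds zero_UU))
  have z1 := loc (g := fun s : ℂ => riemannZeta (3 * s - 1))
    (DifferentiableAt.comp (g := riemannZeta) (f := fun s : ℂ => 3 * s - 1) 0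
      (differentiableAt_riemannZeta (by norm_num)) (by fun_prop))
  have z2 := loc (g := fun s : ℂ => riemannZeta (2 * s))
    (DifferentiableAt.comp (g := riemannZeta) (f := fun s : ℂ => 2 * s) 0
      (differentiableAt_riemannZeta (by norm_num)) (by fun_prop))
  have z3 := zeta_lim (c := 2) (by norm_num)
  have z4 := zeta_lim (c := 3) (by norm_num)
  have r0 : ∑' n : ℕ, RR (n + 1) 0 = 0 := by
    rw [tsum_congr (fun n => RR_zero (by omega : 1 ≤ n + 1)), tsum_zero]
  have zm : riemannZeta (-1) = -(1 / 12) := by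
    have := riemannZeta_neg_nat_eq_bernoulli' 1
    rw [show (1 : ℕ) + 1 = 2 from rfl, bernoulli'_two] at this
    norm_num at this
    rw [this]
  simp only [AA_zero, cst_zero, dd_zero, r0, mul_zero, zero_sub, zm, cst_neg_one,
    riemannZeta_zero] at a1 a2 a3 a4 a5 z1 z2
  have := ((((((a1.mul z1).add (a2.mul z2)).sub (a3.mul z3)).add (a4.mul z4)).add a5)).const_mul 2
  refine Filter.Tendsto.congr (fun s => ?_) (this.trans_eq ?_)
  · simp only [FF]
    ring
  · norm_num

end TornAux

open TornAux
theorem tornheim_diag_value_at_zero (f : ℂ → ℂ) (hf : ∀ z : ℂ, MeromorphicAt f z)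
    (heq : ∀ s : ℂ, 2 / 3 < s.re → f s = tornheim s s s) :
    Filter.Tendsto f (nhdsWithin 0 {(0 : ℂ)}ᶜ) (nhds (1 / 3)) := by
  have hm : MeromorphicOn (f - FF) UU := fun s hs => (hf s).sub (FF_mero hs)
  have hq : (3 / 4 : ℂ) ∈ UU := by
    rw [UU, Metric.mem_ball, dist_eq_norm]
    norm_num
  have htop : meromorphicOrderAt (f - FF) (3 / 4) = ⊤ := by
    rw [meromorphicOrderAt_eq_top_iff]
    have h1 : ∀ᶠ s in nhds (3 / 4 : ℂ), s ∈ UU := UU_open.mem_nhds hq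
    have h2 : ∀ᶠ s : ℂ in nhds (3 / 4 : ℂ), 2 / 3 < s.re :=
      (isOpen_lt continuous_const Complex.continuous_re).mem_nhds (by
        show (2 / 3 : ℝ) < (3 / 4 : ℂ).re
        norm_num)
    filter_upwards [nhdsWithin_le_nhds h1, nhdsWithin_le_nhds h2] with s hs1 hs2
    rw [Pi.sub_apply, heq s hs2, torn_FF hs2 hs1, sub_self]
  have h0 : meromorphicOrderAt (f - FF) 0 = ⊤ := by
    by_contra h
    exact hm.meromorphicOrderAt_ne_top_of_isPreconnected
      (convex_ball _ _).isPreconnected zero_UU hq h htop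
  rw [meromorphicOrderAt_eq_top_iff] at h0
  refine FF_lim.congr' ?_
  filter_upwards [h0] with s hs
  rw [Pi.sub_apply, sub_eq_zero] at hs
  exact hs.symm
end

section
/- Let f : ℂ → ℂ be meromorphic on all of ℂ and suppose f(s) = T(s,s,s) for every complex s with Re s > 2/3. Then for every negative integer k, f(s) tends to 0 as s tends to k through values s ≠ k. -/
open Real Complex

open MeasureTheory Filter Topology Set in
lemma tz_differentiableAt_integral {α : Type*} [MeasurableSpace α] {μ : Measure α}
    {F : ℂ → α → ℂ} {s₀ : ℂ} {b : α → ℝ}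
    (hmeas : ∀ᶠ s in 𝓝 s₀, AEStronglyMeasurable (F s) μ)
    (h : ∃ U ∈ 𝓝 s₀, ∀ᵐ a ∂μ, ∀ s ∈ U, DifferentiableAt ℂ (fun s => F s a) s ∧ ‖F s a‖ ≤ b a)
    (hb : Integrable b μ) :
    DifferentiableAt ℂ (fun s => ∫ a, F s a ∂μ) s₀ := by
  obtain ⟨U, hU, h⟩ := h
  obtain ⟨ε, hε, hεU⟩ := Metric.mem_nhds_iff.1 hU
  have hs0 := mem_of_mem_nhds hU
  have key := hasDerivAt_integral_of_dominated_loc_of_deriv_le (μ := μ) (F := F) (x₀ := s₀)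
    (s := Metric.ball s₀ (ε/2)) (Metric.ball_mem_nhds _ (by positivity)) hmeas
    (F' := fun s a => deriv (fun s => F s a) s) (bound := fun a => b a / (ε/2))
    ?_ ?_ ?_ ?_ ?_
  · exact key.2.differentiableAt
  · refine hb.mono' hmeas.self_of_nhds ?_
    filter_upwards [h] with a ha using (ha s₀ hs0).2
  · have hseq : Tendsto (fun k : ℕ => (((1:ℝ) / ((k:ℝ)+1) : ℝ) : ℂ)) atTop (𝓝 0) := by
      have := (Complex.continuous_ofReal.tendsto 0).comp (tendsto_one_div_add_atTop_nhds_zero_nat (𝕜 := ℝ))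
      simpa [Function.comp_def] using this
    have hadd : Tendsto (fun k : ℕ => s₀ + (((1:ℝ) / ((k:ℝ)+1) : ℝ) : ℂ)) atTop (𝓝 s₀) := by
      simpa using hseq.const_add s₀
    obtain ⟨k0, hk0⟩ := eventually_atTop.1 (hadd.eventually hmeas)
    refine aestronglyMeasurable_of_tendsto_ae (u := atTop)
      (f := fun (k : ℕ) a => (((1:ℝ) / (((k+k0:ℕ):ℝ)+1) : ℝ) : ℂ)⁻¹ •
        (F (s₀ + (((1:ℝ) / (((k+k0:ℕ):ℝ)+1) : ℝ) : ℂ)) a - F s₀ a)) ?_ ?_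
    · intro k
      exact AEStronglyMeasurable.const_smul (𝕜 := ℂ) ((hk0 (k+k0) (by omega)).sub hmeas.self_of_nhds) _
    · filter_upwards [h] with a ha
      have h1 := (ha s₀ hs0).1.hasDerivAt
      rw [hasDerivAt_iff_tendsto_slope_zero] at h1
      refine h1.comp (tendsto_nhdsWithin_iff.2 ⟨?_, ?_⟩)
      · exact hseq.comp (tendsto_add_atTop_nat k0)
      · filter_upwards with k
        simp only [mem_compl_iff, mem_singleton_iff, Complex.ofReal_eq_zero]
        positivity
  · filter_upwards [h] with a ha s hs
    refine Complex.norm_deriv_le_of_forall_mem_sphere_norm_le (by positivity) ?_ ?_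
    · refine DifferentiableOn.diffContOnCl fun z hz => (ha z (hεU ?_)).1.differentiableWithinAt
      have : z ∈ Metric.closedBall s (ε/2) := Metric.closure_ball_subset_closedBall hz
      rw [Metric.mem_closedBall] at this; rw [Metric.mem_ball] at hs ⊢
      linarith [dist_triangle z s s₀]
    · intro z hz
      refine (ha z (hεU ?_)).2
      rw [Metric.mem_sphere] at hz; rw [Metric.mem_ball] at hs ⊢
      linarith [dist_triangle z s s₀]
  · exact hb.div_const _
  · filter_upwards [h] with a ha s hs
    exact (ha s (hεU (Metric.ball_subset_ball (by linarith) hs))).1.hasDerivAt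

/-- polylogarithm-type series -/
noncomputable def tzL (s : ℂ) (x : ℝ) : ℂ := ∑' a : ℕ+, (a : ℂ) ^ (-s) * Complex.exp (-((a : ℂ) * x))

lemma tz_norm_term (s : ℂ) (x : ℝ) (a : ℕ+) :
    ‖(a : ℂ) ^ (-s) * Complex.exp (-((a : ℂ) * x))‖ = (a : ℝ) ^ (-s.re) * Real.exp (-((a:ℝ) * x)) := by
  rw [norm_mul, Complex.norm_exp]
  congr 1
  · rw [← Complex.ofReal_natCast, Complex.norm_cpow_eq_rpow_re_of_pos (by exact_mod_cast a.pos)]; simp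
  · simp

lemma tz_summable_real (σ : ℝ) {x : ℝ} (hx : 0 < x) :
    Summable fun a : ℕ+ => (a : ℝ) ^ (-σ) * Real.exp (-((a:ℝ) * x)) := by
  obtain ⟨k, hk⟩ := exists_nat_ge (-σ)
  have h1 := (Real.summable_pow_mul_exp_neg_nat_mul k hx).comp_injective PNat.coe_injective
  refine Summable.of_nonneg_of_le (fun a => by positivity) (fun a => ?_) h1
  have ha : (1:ℝ) ≤ (a:ℝ) := Nat.one_le_cast.2 a.pos
  simp only [Function.comp]
  rw [← Real.rpow_natCast, show -x * ((a:ℕ):ℝ) = -((a:ℝ)*x) by ring]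
  gcongr

lemma tz_summable (s : ℂ) {x : ℝ} (hx : 0 < x) :
    Summable fun a : ℕ+ => ‖(a : ℂ) ^ (-s) * Complex.exp (-((a : ℂ) * x))‖ := by
  simp_rw [tz_norm_term]; exact tz_summable_real _ hx

lemma tzL_norm_le (s : ℂ) {σ x : ℝ} (hσ : σ ≤ s.re) {x₀ : ℝ} (hx0 : 0 < x₀) (hx : x₀ ≤ x) :
    ‖tzL s x‖ ≤ (∑' a : ℕ+, (a : ℝ) ^ (-σ) * Real.exp (-((a:ℝ) * x₀))) * Real.exp (-(x - x₀)) := by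
  rw [← tsum_mul_right]
  refine tsum_of_norm_bounded ((tz_summable_real σ hx0).mul_right _).hasSum fun a => ?_
  have ha : (1:ℝ) ≤ (a:ℝ) := Nat.one_le_cast.2 a.pos
  rw [tz_norm_term, mul_assoc, ← Real.exp_add]
  gcongr
  nlinarith

lemma tzL_differentiable {x : ℝ} (hx : 0 < x) (s : ℂ) :
    DifferentiableAt ℂ (fun s => tzL s x) s := by
  have : DifferentiableOn ℂ (fun s => tzL s x) {z | s.re - 1 < z.re} := by
    refine differentiableOn_tsum_of_summable_norm (tz_summable_real (s.re-1) hx) ?_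
      (isOpen_lt continuous_const Complex.continuous_re) ?_
    · intro a
      refine DifferentiableOn.mul ?_ (differentiableOn_const _)
      intro z _
      refine DifferentiableAt.differentiableWithinAt ?_
      refine DifferentiableAt.const_cpow (by fun_prop) (Or.inl (by simp))
    · intro a w hw
      have ha : (1:ℝ) ≤ (a:ℝ) := Nat.one_le_cast.2 a.pos
      rw [tz_norm_term]
      have : s.re - 1 < w.re := hw
      gcongr
  exact this.differentiableAt ((isOpen_lt continuous_const Complex.continuous_re).mem_nhds (by simp))

lemma tzL_hasDerivAt (s : ℂ) {x : ℝ} (hx : 0 < x) :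
    HasDerivAt (tzL s) (-tzL (s-1) x) x := by
  have key := hasDerivAt_tsum_of_isPreconnected (𝕜 := ℝ) (F := ℂ)
    (g := fun (a:ℕ+) (x:ℝ) => (a : ℂ) ^ (-s) * Complex.exp (-((a : ℂ) * x)))
    (g' := fun (a:ℕ+) (x:ℝ) => -((a : ℂ) ^ (-(s-1)) * Complex.exp (-((a : ℂ) * x))))
    (t := Set.Ioi (x/2)) (y₀ := x) (y := x)
    (tz_summable_real (s.re-1) (half_pos hx)) isOpen_Ioi isPreconnected_Ioi ?_ ?_
    (by simp [hx]) (tz_summable s hx).of_norm (by simp [hx])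
  · rw [tsum_neg] at key
    exact key
  · intro a y hy
    have h0 : HasDerivAt (fun y : ℝ => (y:ℂ)) 1 y := HasDerivAt.ofReal_comp (hasDerivAt_id y)
    have h1 := ((h0.const_mul (a:ℂ)).neg.cexp).const_mul ((a:ℂ)^(-s))
    refine h1.congr_deriv ?_
    have ha : (a:ℂ) ≠ 0 := by simp
    rw [show -(s-1) = -s + 1 by ring, Complex.cpow_add _ _ ha, Complex.cpow_one]
    simp only [Pi.neg_apply]
    ring
  · intro a y hy
    have hy' : x/2 < y := hy
    rw [norm_neg, tz_norm_term]
    simp only [Complex.sub_re, Complex.one_re]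
    gcongr

lemma tz_summable_tornheim {σ : ℝ} (hσ : 2/3 < σ) : Summable fun p : ℕ+ × ℕ+ =>
    (p.1 : ℝ) ^ (-σ) * (p.2 : ℝ) ^ (-σ) * ((p.1 : ℝ) + (p.2 : ℝ)) ^ (-σ) := by
  have h1 : Summable fun a : ℕ+ => (a:ℝ) ^ (-(3/2*σ)) :=
    (Real.summable_nat_rpow.2 (show -(3/2*σ) < -1 by linarith)).comp_injective PNat.coe_injective
  have h2 := h1.mul_of_nonneg h1 (fun a => by positivity) (fun a => by positivity)
  refine Summable.of_nonneg_of_le (fun p => by positivity) (fun p => ?_) h2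
  have ha : (1:ℝ) ≤ (p.1:ℝ) := Nat.one_le_cast.2 p.1.pos
  have hb : (1:ℝ) ≤ (p.2:ℝ) := Nat.one_le_cast.2 p.2.pos
  generalize (p.1:ℝ) = a at *
  generalize (p.2:ℝ) = b at *
  have ha0 : 0 < a := by linarith
  have hb0 : 0 < b := by linarith
  have h3 : (a+b)^(-σ) ≤ (a*b)^(-(1/2*σ)) := by
    rw [show -σ = 2 * (-(1/2*σ)) by ring, Real.rpow_mul (by positivity)]
    refine Real.rpow_le_rpow_of_nonpos (by positivity) ?_ (by linarith)
    norm_num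
    nlinarith
  rw [Real.mul_rpow ha0.le hb0.le] at h3
  calc _ ≤ a ^ (-σ) * b^(-σ) * (a ^ (-(1/2*σ)) * b ^ (-(1/2*σ))) := by gcongr
    _ = (a ^ (-σ) * a ^ (-(1/2*σ))) * (b ^ (-σ) * b ^ (-(1/2*σ))) := by ring
    _ = _ := by
      rw [← Real.rpow_add ha0, ← Real.rpow_add hb0]
      ring_nf

open MeasureTheory Set in
lemma tz_mellin {s : ℂ} (hs : 2/3 < s.re) :
    Complex.Gamma s * tornheim s s s = ∫ x in Ioi (0:ℝ), (x:ℂ)^(s-1) * tzL s x ^ 2 := by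
  have hs0 : 0 < s.re := by linarith
  let F : ℕ+ × ℕ+ → ℝ → ℂ := fun p x => ((p.1:ℂ)^(-s) * (p.2:ℂ)^(-s)) *
    ((x:ℂ)^(s-1) * Complex.exp (-((((p.1:ℝ) + (p.2:ℝ) : ℝ) : ℂ) * x)))
  have hpos : ∀ p : ℕ+ × ℕ+, 0 < ((p.1:ℝ) + (p.2:ℝ)) := fun p => by positivity
  have hnorm : ∀ p, ∀ x ∈ Ioi (0:ℝ), ‖F p x‖ = ((p.1 : ℝ) ^ (-s.re) * (p.2 : ℝ) ^ (-s.re)) *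
      (x^(s.re-1) * Real.exp (-(((p.1:ℝ) + (p.2:ℝ)) * x))) := by
    intro p x hx
    have hx : 0 < x := hx
    simp only [F]
    rw [norm_mul, norm_mul, norm_mul, Complex.norm_exp, Complex.norm_cpow_eq_rpow_re_of_pos hx,
      ← Complex.ofReal_natCast, Complex.norm_cpow_eq_rpow_re_of_pos (by exact_mod_cast p.1.pos),
      ← Complex.ofReal_natCast, Complex.norm_cpow_eq_rpow_re_of_pos (by exact_mod_cast p.2.pos)]
    simp
  have hint : ∀ p, Integrable (F p) (volume.restrict (Ioi 0)) := by
    intro p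
    refine Integrable.const_mul ?_ _
    have h1 := Complex.GammaIntegral_convergent hs0
    have h2 : IntegrableOn (fun x:ℝ => x^(s.re-1) * Real.exp (-(((p.1:ℝ) + (p.2:ℝ)) * x))) (Ioi 0) := by
      have := integrableOn_rpow_mul_exp_neg_mul_rpow (s := s.re-1) (p := 1) (by linarith) one_pos (hpos p)
      simpa only [Real.rpow_one, neg_mul] using this
    refine Integrable.mono' h2 ?_ ?_
    · refine ContinuousOn.aestronglyMeasurable (fun x hx => ContinuousAt.continuousWithinAt ?_) measurableSet_Ioi
      have hx : (0:ℝ) < x := hx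
      refine ContinuousAt.mul ?_ (by fun_prop)
      exact (Complex.continuousAt_ofReal_cpow_const _ _ (Or.inr hx.ne'))
    · refine (ae_restrict_iff' measurableSet_Ioi).2 (ae_of_all _ fun x hx => ?_)
      have hx : 0 < x := hx
      rw [norm_mul, Complex.norm_exp, Complex.norm_cpow_eq_rpow_re_of_pos hx]
      simp
  have hval : ∀ p, ∫ x in Ioi (0:ℝ), F p x = Complex.Gamma s *
      (1 / ((p.1 : ℂ) ^ s * (p.2 : ℂ) ^ s * ((p.1 : ℂ) + (p.2 : ℂ)) ^ s)) := by
    intro p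
    simp only [F]
    rw [integral_const_mul]
    rw [Complex.integral_cpow_mul_exp_neg_mul_Ioi hs0 (hpos p)]
    have h1 : (1 / (((p.1:ℝ) + (p.2:ℝ) : ℝ) : ℂ)) ^ s = (((p.1 : ℂ) + (p.2 : ℂ)) ^ s)⁻¹ := by
      rw [one_div, Complex.inv_cpow]
      · push_cast; rfl
      · rw [Complex.arg_ofReal_of_nonneg (hpos p).le]; exact Real.pi_pos.ne
    rw [h1, Complex.cpow_neg, Complex.cpow_neg]
    ring
  have hvalnorm : ∀ p, ∫ x in Ioi (0:ℝ), ‖F p x‖ = ((p.1 : ℝ) ^ (-s.re) * (p.2 : ℝ) ^ (-s.re) * ((p.1 : ℝ) + (p.2 : ℝ)) ^ (-s.re)) * Real.Gamma s.re := by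
    intro p
    rw [setIntegral_congr_fun measurableSet_Ioi (hnorm p), integral_const_mul,
      Real.integral_rpow_mul_exp_neg_mul_Ioi hs0 (hpos p), one_div, Real.inv_rpow (hpos p).le,
      ← Real.rpow_neg (hpos p).le]
    ring
  have hsum : ∀ x ∈ Ioi (0:ℝ), ∑' p, F p x = (x:ℂ)^(s-1) * tzL s x ^ 2 := by
    intro x hx
    have hx : 0 < x := hx
    rw [sq, tzL, tsum_mul_tsum_of_summable_norm (tz_summable s hx) (tz_summable s hx), ← tsum_mul_left]
    refine tsum_congr fun p => ?_
    simp only [F]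
    rw [show (-((((p.1:ℝ) + (p.2:ℝ) : ℝ) : ℂ) * x)) = -((p.1:ℂ)*x) + -((p.2:ℂ)*x) by push_cast; ring, Complex.exp_add]
    ring
  have hsn : Summable fun p => ∫ x in Ioi (0:ℝ), ‖F p x‖ := by
    simp_rw [hvalnorm]
    exact (tz_summable_tornheim hs).mul_right _
  have key := hasSum_integral_of_summable_integral_norm hint hsn
  have hcongr := setIntegral_congr_fun (μ := volume) measurableSet_Ioi hsum
  rw [← hcongr, ← key.tsum_eq, tornheim, ← tsum_mul_left]
  exact tsum_congr fun p => (hval p).symm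

noncomputable def tzE (s : ℂ) (x : ℝ) : ℂ := tzL s x - Complex.Gamma (1 - s) * (x:ℂ) ^ (s - 1)

lemma tzE_hasDerivAt {s : ℂ} (hs : s.re < 1) {x : ℝ} (hx : 0 < x) :
    HasDerivAt (tzE s) (-tzE (s-1) x) x := by
  have h1 := tzL_hasDerivAt s hx
  have hs1 : s - 1 ≠ 0 := by
    intro h
    rw [sub_eq_zero] at h; rw [h] at hs; simp at hs
  have h2 : HasDerivAt (fun x : ℝ => (x:ℂ)^(s-1)) ((s-1) * (x:ℂ)^(s-1-1)) x := by
    have := (hasDerivAt_id (x:ℂ)).cpow_const (c := s-1) (Or.inl (by simpa using hx))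
    have := this.comp_ofReal
    simpa using this
  refine (h1.sub (h2.const_mul (Complex.Gamma (1-s)))).congr_deriv ?_
  rw [tzE, show 1 - (s-1) = (1 - s) + 1 by ring,
    Complex.Gamma_add_one _ (by intro h; apply hs1; rw [← neg_sub, h, neg_zero])]
  ring

noncomputable def tzw (z : ℂ) : ℂ := dslope Complex.exp 0 z
noncomputable def tzy (z : ℂ) : ℂ := (tzw z)⁻¹
noncomputable def tzH (z : ℂ) : ℂ := dslope tzy 0 z
def tzU : Set ℂ := {z | tzw z ≠ 0}

lemma tzw_differentiable : Differentiable ℂ tzw := by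
  have := (Complex.differentiableOn_dslope (f := Complex.exp) (s := Set.univ) (c := 0) Filter.univ_mem).2
    Complex.differentiable_exp.differentiableOn
  exact differentiableOn_univ.1 this

lemma tzw_zero : tzw 0 = 1 := by simp [tzw, dslope_same]

lemma tzw_of_ne {z : ℂ} (hz : z ≠ 0) : tzw z = (Complex.exp z - 1) / z := by
  rw [tzw, dslope_of_ne _ hz, slope_def_field]; simp

lemma tzU_open : IsOpen tzU := isOpen_ne_fun tzw_differentiable.continuous continuous_const

lemma tzU_real (x : ℝ) : (x:ℂ) ∈ tzU := by
  show tzw x ≠ 0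
  by_cases hx : x = 0
  · simp [hx, tzw_zero]
  · rw [tzw_of_ne (by exact_mod_cast hx)]
    refine div_ne_zero ?_ (by exact_mod_cast hx)
    rw [← Complex.ofReal_exp, sub_ne_zero]
    intro h
    exact hx (Real.exp_eq_one_iff x |>.1 (by exact_mod_cast h))

lemma tzU_zero : (0:ℂ) ∈ tzU := by simpa using tzU_real 0

lemma tzy_diffOn : DifferentiableOn ℂ tzy tzU :=
  fun z hz => ((tzw_differentiable z).inv hz).differentiableWithinAt

lemma tzy_zero : tzy 0 = 1 := by simp [tzy, tzw_zero]

lemma tzH_diffOn : DifferentiableOn ℂ tzH tzU :=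
  (Complex.differentiableOn_dslope (tzU_open.mem_nhds tzU_zero)).2 tzy_diffOn

lemma tzy_eq (z : ℂ) : tzy z = 1 + z * tzH z := by
  have := sub_smul_dslope tzy 0 z
  rw [tzy_zero] at this
  simp only [sub_zero, smul_eq_mul] at this
  rw [tzH, this]; ring

lemma tzy_mul {z : ℂ} (hz : z ∈ tzU) : tzy z * (Complex.exp z - 1) = z := by
  have hw : tzw z ≠ 0 := hz
  have := sub_smul_dslope Complex.exp 0 z
  simp only [sub_zero, smul_eq_mul, Complex.exp_zero] at this
  rw [← this, tzy]
  change _ * (z * tzw z) = z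
  field_simp

lemma tzH_iter_diffOn (m : ℕ) : DifferentiableOn ℂ (iteratedDeriv m tzH) tzU := by
  induction m with
  | zero => simpa using tzH_diffOn
  | succ m ih =>
    rw [iteratedDeriv_succ]
    exact ih.deriv tzU_open

lemma tzL_zero {x : ℝ} (hx : 0 < x) : tzL 0 x * (Complex.exp x - 1) = 1 := by
  have h1 : tzL 0 x = ∑' n : ℕ, Complex.exp (-x) * Complex.exp (-x) ^ n := by
    rw [tzL, ← Equiv.tsum_eq Equiv.pnatEquivNat.symm]
    refine tsum_congr fun n => ?_
    simp
    rw [← Complex.exp_nat_mul, ← Complex.exp_add]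
    congr 1
    ring
  have h2 : ‖Complex.exp (-(x:ℂ))‖ < 1 := by
    rw [Complex.norm_exp]; simpa using hx
  rw [h1, tsum_mul_left, tsum_geometric_of_norm_lt_one h2, Complex.exp_neg]
  have h3 : Complex.exp x ≠ 0 := Complex.exp_ne_zero _
  have h4 : Complex.exp x - 1 ≠ 0 := by
    rw [← Complex.ofReal_exp, sub_ne_zero]
    intro h
    exact hx.ne' (Real.exp_eq_one_iff x |>.1 (by exact_mod_cast h))
  field_simp

lemma tzE_neg_nat (m : ℕ) : ∀ {x : ℝ}, 0 < x → tzE (-(m:ℂ)) x = (-1)^m * iteratedDeriv m tzH x := by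
  induction m with
  | zero =>
    intro x hx
    have hx' : (x:ℂ) ≠ 0 := by exact_mod_cast hx.ne'
    have h1 := tzL_zero hx
    have h2 := tzy_mul (tzU_real x)
    have h4 : Complex.exp x - 1 ≠ 0 := fun h => by simp [h] at h1
    rw [tzy_eq] at h2
    simp [tzE]
    rw [Complex.cpow_neg_one]
    field_simp
    refine mul_left_cancel₀ h4 ?_
    linear_combination x * h1 - h2
  | succ m ih =>
    intro x hx
    have h1 := tzE_hasDerivAt (s := -(m:ℂ)) (by simp; linarith [(Nat.cast_nonneg m : (0:ℝ) ≤ m)]) hx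
    have h2 : HasDerivAt (fun t : ℝ => (-1)^m * iteratedDeriv m tzH t) ((-1)^m * iteratedDeriv (m+1) tzH x) x := by
      rw [iteratedDeriv_succ]
      exact (((tzH_iter_diffOn m).differentiableAt (tzU_open.mem_nhds (tzU_real x))).hasDerivAt.comp_ofReal).const_mul _
    have h3 : tzE (-(m:ℂ)) =ᶠ[nhds x] (fun t : ℝ => (-1)^m * iteratedDeriv m tzH t) := by
      filter_upwards [lt_mem_nhds hx] with t ht using ih ht
    have h4 := h1.unique (h2.congr_of_eventuallyEq h3)
    push_cast
    rw [show -((m:ℂ)+1) = -(m:ℂ) - 1 by ring, pow_succ]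
    linear_combination -h4

open MeasureTheory Set in
lemma tz_fubini {α : Type*} [MeasurableSpace α] (μ : Measure α) [SFinite μ] (u : α → ℝ)
    (hu : Measurable u) (hpos : ∀ᵐ a ∂μ, 0 < u a) (s : ℂ) (N : ℕ) (hs : 0 < (s + N).re) (x : ℝ)
    (hint : Integrable (fun a => u a ^ (-s.re) * Real.exp (-(u a * x))) μ) :
    IntegrableOn (fun t : ℝ => (t:ℂ) ^ (s + N - 1) *
      ∫ a, (u a : ℂ) ^ (-(-(N:ℂ))) * Complex.exp (-((u a : ℂ) * ((t + x : ℝ) : ℂ))) ∂μ) (Ioi 0) ∧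
    Complex.Gamma (s + N) * ∫ a, (u a : ℂ) ^ (-s) * Complex.exp (-((u a : ℂ) * x)) ∂μ =
    ∫ t in Ioi (0:ℝ), (t:ℂ) ^ (s + N - 1) *
      ∫ a, (u a : ℂ) ^ (-(-(N:ℂ))) * Complex.exp (-((u a : ℂ) * ((t + x : ℝ) : ℂ))) ∂μ := by
  let F : α → ℝ → ℂ := fun a t => ((u a : ℂ) ^ N * Complex.exp (-((u a : ℂ) * x))) *
    ((t:ℂ) ^ (s + N - 1) * Complex.exp (-((u a : ℂ) * t)))
  have hmeas : AEStronglyMeasurable (Function.uncurry F) (μ.prod (volume.restrict (Ioi 0))) := by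
    apply Measurable.aestronglyMeasurable
    simp only [F, Function.uncurry_def]
    fun_prop
  have hF1 : ∀ᵐ a ∂μ, Integrable (F a) (volume.restrict (Ioi 0)) := by
    filter_upwards [hpos] with a ha
    refine Integrable.const_mul ?_ _
    have h2 : IntegrableOn (fun t:ℝ => t^((s+N).re-1) * Real.exp (-(u a * t))) (Ioi 0) := by
      have := integrableOn_rpow_mul_exp_neg_mul_rpow (s := (s+N).re-1) (p := 1) (by linarith) one_pos ha
      simpa only [Real.rpow_one, neg_mul] using this
    refine Integrable.mono' h2 (by fun_prop) ?_
    refine (ae_restrict_iff' measurableSet_Ioi).2 (ae_of_all _ fun x hx => ?_)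
    have hx : 0 < x := hx
    rw [norm_mul, Complex.norm_exp, Complex.norm_cpow_eq_rpow_re_of_pos hx]
    simp
  have hF2 : ∀ᵐ a ∂μ, ∫ t in Ioi (0:ℝ), ‖F a t‖ = Real.Gamma (s+N).re * (u a ^ (-s.re) * Real.exp (-(u a * x))) := by
    filter_upwards [hpos] with a ha
    have h1 : ∀ t ∈ Ioi (0:ℝ), ‖F a t‖ = (u a ^ N * Real.exp (-(u a * x))) * (t ^ ((s+N).re - 1) * Real.exp (-(u a * t))) := by
      intro t ht
      have ht : 0 < t := ht
      simp only [F]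
      rw [norm_mul, norm_mul, norm_mul, Complex.norm_exp, Complex.norm_exp, Complex.norm_cpow_eq_rpow_re_of_pos ht, norm_pow]
      simp [abs_of_pos ha]
    rw [setIntegral_congr_fun measurableSet_Ioi h1, integral_const_mul,
      Real.integral_rpow_mul_exp_neg_mul_Ioi hs ha, one_div, Real.inv_rpow ha.le, ← Real.rpow_neg ha.le]
    rw [show -(s+N).re = -s.re - N by simp; ring, Real.rpow_sub ha, Real.rpow_natCast]
    have : u a ^ N ≠ 0 := by positivity
    field_simp
  have hI : Integrable (Function.uncurry F) (μ.prod (volume.restrict (Ioi 0))) := by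
    rw [integrable_prod_iff hmeas]
    exact ⟨hF1, (hint.const_mul _).congr (hF2.mono fun a ha => ha.symm)⟩
  have hswap := integral_integral_swap hI
  have hin : ∀ t : ℝ, ∫ a, F a t ∂μ = (t:ℂ) ^ (s + N - 1) *
      ∫ a, (u a : ℂ) ^ (-(-(N:ℂ))) * Complex.exp (-((u a : ℂ) * ((t + x : ℝ) : ℂ))) ∂μ := by
    intro t
    rw [← integral_const_mul]
    congr 1; ext a
    simp only [F]
    rw [neg_neg, Complex.cpow_natCast, show (-((u a : ℂ) * ((t + x : ℝ) : ℂ))) = -((u a : ℂ) * x) + -((u a : ℂ) * t) by push_cast; ring,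
      Complex.exp_add]
    ring
  have hout : ∀ᵐ a ∂μ, ∫ t in Ioi (0:ℝ), F a t = Complex.Gamma (s+N) * ((u a : ℂ) ^ (-s) * Complex.exp (-((u a : ℂ) * x))) := by
    filter_upwards [hpos] with a ha
    simp only [F]
    have ha' : (u a : ℂ) ≠ 0 := by exact_mod_cast ha.ne'
    rw [integral_const_mul, Complex.integral_cpow_mul_exp_neg_mul_Ioi hs ha, one_div, Complex.inv_cpow]
    · rw [Complex.cpow_add _ _ ha', Complex.cpow_natCast, Complex.cpow_neg]
      have : (u a : ℂ) ^ s ≠ 0 := by simp [Complex.cpow_eq_zero_iff, ha']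
      field_simp
    · rw [Complex.arg_ofReal_of_nonneg ha.le]; exact Real.pi_pos.ne
  simp_rw [hin] at hswap
  constructor
  · have := hI.integral_prod_right
    simp only [Function.uncurry, hin] at this
    exact this
  · rw [← hswap, integral_congr_ae hout, integral_const_mul]

open MeasureTheory Set in
lemma tz_fubini_L (s : ℂ) (N : ℕ) (hs : 0 < (s + N).re) {x : ℝ} (hx : 0 < x) :
    IntegrableOn (fun t : ℝ => (t:ℂ) ^ (s + N - 1) * tzL (-(N:ℂ)) (t+x)) (Ioi 0) ∧
    Complex.Gamma (s + N) * tzL s x = ∫ t in Ioi (0:ℝ), (t:ℂ) ^ (s + N - 1) * tzL (-(N:ℂ)) (t+x) := by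
  let _ : MeasurableSpace ℕ+ := ⊤
  have _ : MeasurableSingletonClass ℕ+ := ⟨fun _ => trivial⟩
  have key : ∀ (s : ℂ) {x : ℝ}, 0 < x → ∫ a : ℕ+, ((((a:ℕ):ℝ)) : ℂ) ^ (-s) * Complex.exp (-((((a:ℕ):ℝ) : ℂ) * x)) ∂Measure.count = tzL s x := by
    intro s x hx
    rw [integral_countable]
    · simp [tzL]
    · rw [integrable_count_iff]
      simpa using tz_summable s hx
  have h := tz_fubini (Measure.count : Measure ℕ+) (fun a => ((a:ℕ):ℝ)) (measurable_of_countable _)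
    (ae_of_all _ fun a => Nat.cast_pos.2 a.pos) s N hs x
    (by
      rw [integrable_count_iff]
      refine (tz_summable_real s.re hx).congr fun a => ?_
      rw [Real.norm_of_nonneg (by positivity)])
  rw [key s hx] at h
  have h2 : ∀ t ∈ Ioi (0:ℝ), (t:ℂ) ^ (s + N - 1) *
      ∫ a : ℕ+, ((((a:ℕ):ℝ)) : ℂ) ^ (-(-(N:ℂ))) * Complex.exp (-((((a:ℕ):ℝ) : ℂ) * ((t + x : ℝ) : ℂ))) ∂Measure.count = (t:ℂ) ^ (s + N - 1) * tzL (-(N:ℂ)) (t+x) := by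
    intro t ht
    have ht : 0 < t := ht
    rw [key _ (by positivity : 0 < t + x)]
  rw [integrableOn_congr_fun h2 measurableSet_Ioi, setIntegral_congr_fun measurableSet_Ioi h2] at h
  exact h

open MeasureTheory Set in
lemma tz_fubini_G (s : ℂ) (N : ℕ) (hs : 0 < (s + N).re) (hs1 : s.re < 1) {x : ℝ} (hx : 0 < x) :
    IntegrableOn (fun t : ℝ => (t:ℂ) ^ (s + N - 1) * (Complex.Gamma (1 - (-(N:ℂ))) * ((t+x:ℝ):ℂ)^(-(N:ℂ)-1))) (Ioi 0) ∧
    Complex.Gamma (s + N) * (Complex.Gamma (1-s) * (x:ℂ)^(s-1)) =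
      ∫ t in Ioi (0:ℝ), (t:ℂ) ^ (s + N - 1) * (Complex.Gamma (1 - (-(N:ℂ))) * ((t+x:ℝ):ℂ)^(-(N:ℂ)-1)) := by
  have key : ∀ {s : ℂ} {x : ℝ}, s.re < 1 → 0 < x → ∫ a in Ioi (0:ℝ), (a : ℂ) ^ (-s) * Complex.exp (-((a : ℂ) * x)) = Complex.Gamma (1-s) * (x:ℂ)^(s-1) := by
    intro s x hs hx
    have := Complex.integral_cpow_mul_exp_neg_mul_Ioi (a := 1 - s) (r := x) (by simpa using hs) hx
    rw [one_div, Complex.inv_cpow _ _ (by rw [Complex.arg_ofReal_of_nonneg hx.le]; exact Real.pi_pos.ne), ← Complex.cpow_neg] at this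
    rw [mul_comm, ← neg_sub 1 s, ← this]
    congr 1; ext a
    rw [show 1 - s - 1 = -s by ring, mul_comm (x:ℂ)]
  have h := tz_fubini (volume.restrict (Ioi (0:ℝ))) (fun a => a) measurable_id
    ((ae_restrict_iff' measurableSet_Ioi).2 (ae_of_all _ fun a ha => ha)) s N hs x
    (by
      have := integrableOn_rpow_mul_exp_neg_mul_rpow (s := -s.re) (p := 1) (by linarith) one_pos hx
      simp only [Real.rpow_one, neg_mul, mul_comm x] at this
      exact this)
  rw [key hs1 hx] at h
  have h2 : ∀ t ∈ Ioi (0:ℝ), (t:ℂ) ^ (s + N - 1) *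
      ∫ a in Ioi (0:ℝ), (a : ℂ) ^ (-(-(N:ℂ))) * Complex.exp (-((a : ℂ) * ((t + x : ℝ) : ℂ))) = (t:ℂ) ^ (s + N - 1) * (Complex.Gamma (1 - (-(N:ℂ))) * ((t+x:ℝ):ℂ)^(-(N:ℂ)-1)) := by
    intro t ht
    have ht : 0 < t := ht
    rw [key (by simp; linarith [(Nat.cast_nonneg N : (0:ℝ) ≤ N)]) (by positivity : 0 < t + x)]
  rw [integrableOn_congr_fun h2 measurableSet_Ioi, setIntegral_congr_fun measurableSet_Ioi h2] at h
  exact h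

open MeasureTheory Set in
lemma tz_fubini_E (s : ℂ) (N : ℕ) (hs : 0 < (s + N).re) (hs1 : s.re < 1) {x : ℝ} (hx : 0 < x) :
    Complex.Gamma (s + N) * tzE s x = ∫ t in Ioi (0:ℝ), (t:ℂ) ^ (s + N - 1) * tzE (-(N:ℂ)) (t+x) := by
  obtain ⟨h1, h2⟩ := tz_fubini_L s N hs hx
  obtain ⟨h3, h4⟩ := tz_fubini_G s N hs hs1 hx
  rw [tzE, mul_sub, h2, h4, ← integral_sub h1 h3]
  congr 1; ext t
  rw [tzE]; ring

open Set in
lemma tzE_neg_bound (N : ℕ) : ∃ C : ℝ, 0 ≤ C ∧ ∀ y : ℝ, 0 < y → ‖tzE (-(N:ℂ)) y‖ ≤ C ∧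
    ‖tzE (-(N:ℂ)) y‖ ≤ C * y ^ (-((N:ℝ)+1)) := by
  have hcont : ContinuousOn (fun t : ℝ => iteratedDeriv N tzH t) (Icc 0 1) :=
    (tzH_iter_diffOn N).continuousOn.comp Complex.continuous_ofReal.continuousOn (fun x _ => tzU_real x)
  obtain ⟨C1, hC1⟩ := isCompact_Icc.exists_bound_of_continuousOn hcont
  set S := ∑' a : ℕ+, (a : ℝ) ^ (-(-(N:ℝ))) * Real.exp (-((a:ℝ) * 1)) with hS
  have hS0 : 0 ≤ S := tsum_nonneg fun a => by positivity
  set G := ‖Complex.Gamma (1 - (-(N:ℂ)))‖ with hG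
  set C2 := S * (Real.exp 1 * (N+1).factorial) + G with hC2
  have hC1' : 0 ≤ C1 := (norm_nonneg _).trans (hC1 0 (by simp))
  have hC20 : 0 ≤ C2 := by positivity
  refine ⟨C1 + C2, by positivity, fun y hy => ?_⟩
  by_cases hy1 : y ≤ 1
  · have h1 : ‖tzE (-(N:ℂ)) y‖ ≤ C1 := by
      rw [tzE_neg_nat N hy, norm_mul, norm_pow, norm_neg, norm_one, one_pow, one_mul]
      exact hC1 y ⟨hy.le, hy1⟩
    have h2 : 1 ≤ y ^ (-((N:ℝ)+1)) := Real.one_le_rpow_of_pos_of_le_one_of_nonpos hy hy1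
      (by linarith [(Nat.cast_nonneg N : (0:ℝ) ≤ N)])
    exact ⟨by linarith, by nlinarith⟩
  · push Not at hy1
    have hp : 0 < y ^ (-((N:ℝ)+1)) := by positivity
    have h2 : y ^ (-((N:ℝ)+1)) ≤ 1 := Real.rpow_le_one_of_one_le_of_nonpos hy1.le
      (by linarith [(Nat.cast_nonneg N : (0:ℝ) ≤ N)])
    have h3 : ‖tzE (-(N:ℂ)) y‖ ≤ C2 * y ^ (-((N:ℝ)+1)) := by
      rw [tzE, hC2, add_mul]
      refine (norm_sub_le _ _).trans (add_le_add ?_ ?_)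
      · refine (tzL_norm_le (-(N:ℂ)) (σ := -(N:ℝ)) (by simp) one_pos hy1.le).trans ?_
        rw [mul_assoc]
        refine mul_le_mul_of_nonneg_left ?_ hS0
        have h4 := Real.pow_div_factorial_le_exp y hy.le (N+1)
        have h5 : y ^ (-((N:ℝ)+1)) = (y^(N+1))⁻¹ := by
          rw [Real.rpow_neg hy.le]; norm_cast
        rw [h5, show -(y-1) = 1 - y by ring, Real.exp_sub, mul_assoc, div_eq_mul_inv]
        refine mul_le_mul_of_nonneg_left ?_ (Real.exp_pos _).le
        have hf : (0:ℝ) < (N+1).factorial := by positivity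
        have hyp : 0 < y^(N+1) := by positivity
        rw [div_le_iff₀ hf] at h4
        rw [← div_eq_mul_inv, inv_eq_one_div, div_le_div_iff₀ (Real.exp_pos _) hyp]
        linarith
      · rw [norm_mul, Complex.norm_cpow_eq_rpow_re_of_pos hy]
        apply le_of_eq; congr 2; simp; ring
    exact ⟨by nlinarith, by nlinarith⟩

open MeasureTheory Set Filter Topology in
lemma tzE_bdd {s₀ : ℂ} (hs0 : s₀.re < 1) :
    ∃ C : ℝ, ∃ U ∈ 𝓝 s₀, ∀ s ∈ U, ∀ x : ℝ, 0 < x → ‖tzE s x‖ ≤ C := by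
  obtain ⟨b, hb0, hb1⟩ := exists_between hs0
  set a := s₀.re - 1 with ha
  obtain ⟨N, hN⟩ := exists_nat_gt (-a)
  obtain ⟨C, hC0, hC⟩ := tzE_neg_bound N
  have hcont : ContinuousAt (fun s : ℂ => ‖(Complex.Gamma (s+N))⁻¹‖) s₀ :=
    ((Complex.differentiable_one_div_Gamma.continuous.comp (continuous_id.add continuous_const)).norm).continuousAt
  set M := ‖(Complex.Gamma (s₀+N))⁻¹‖ + 1 with hM
  have hM0 : 0 ≤ M := by positivity
  let g : ℝ → ℝ := fun t => if t ≤ 1 then C * t^(a+N-1) else C * t^(b-2)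
  have hg : IntegrableOn g (Ioi 0) := by
    rw [← Ioc_union_Ioi_eq_Ioi (zero_le_one' ℝ)]
    refine IntegrableOn.union ?_ ?_
    · have : IntegrableOn (fun t:ℝ => C * t^(a+N-1)) (Ioc 0 1) := by
        refine Integrable.const_mul ?_ _
        have := (intervalIntegral.intervalIntegrable_rpow' (a := 0) (b := 1) (r := a+N-1) (by linarith))
        rwa [intervalIntegrable_iff_integrableOn_Ioc_of_le zero_le_one] at this
      refine this.congr_fun (fun t ht => ?_) measurableSet_Ioc
      simp [g, ht.2]
    · have : IntegrableOn (fun t:ℝ => C * t^(b-2)) (Ioi 1) :=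
        Integrable.const_mul (integrableOn_Ioi_rpow_of_lt (by linarith) one_pos) _
      refine this.congr_fun (fun t ht => ?_) measurableSet_Ioi
      have : ¬ t ≤ 1 := not_le.2 ht
      simp [g, this]
  refine ⟨M * ∫ t in Ioi (0:ℝ), g t, {s | a < s.re} ∩ {s | s.re < b} ∩ {s : ℂ | ‖(Complex.Gamma (s+N))⁻¹‖ < M}, ?_, ?_⟩
  · refine inter_mem (inter_mem ?_ ?_) ?_
    · exact (isOpen_lt continuous_const Complex.continuous_re).mem_nhds (by simp [ha])
    · exact (isOpen_lt Complex.continuous_re continuous_const).mem_nhds hb0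
    · exact hcont.eventually_lt continuousAt_const (by simp [hM])
  · rintro s ⟨⟨hsa, hsb⟩, hsM⟩ x hx
    simp only [mem_ofPred_eq] at hsa hsb hsM
    have hsN : 0 < (s+N).re := by simp; linarith
    have h1 := tz_fubini_E s N hsN (by linarith) hx
    have hG : Complex.Gamma (s+N) ≠ 0 := Complex.Gamma_ne_zero_of_re_pos hsN
    have h2 : tzE s x = (Complex.Gamma (s+N))⁻¹ * ∫ t in Ioi (0:ℝ), (t:ℂ) ^ (s + N - 1) * tzE (-(N:ℂ)) (t+x) := by
      rw [← h1]; field_simp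
    rw [h2, norm_mul]
    refine mul_le_mul hsM.le ?_ (norm_nonneg _) hM0
    refine norm_integral_le_of_norm_le hg ((ae_restrict_iff' measurableSet_Ioi).2 (ae_of_all _ fun t ht => ?_))
    have ht : 0 < t := ht
    obtain ⟨hC1, hC2⟩ := hC (t+x) (by positivity)
    rw [norm_mul, Complex.norm_cpow_eq_rpow_re_of_pos ht]
    simp only [g]
    split_ifs with h
    · rw [mul_comm]
      refine mul_le_mul hC1 ?_ (by positivity) hC0
      refine Real.rpow_le_rpow_of_exponent_ge ht h ?_
      simp; linarith
    · push Not at h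
      have h3 : (t+x) ^ (-((N:ℝ)+1)) ≤ t ^ (-((N:ℝ)+1)) :=
        Real.rpow_le_rpow_of_nonpos ht (by linarith) (by linarith [(Nat.cast_nonneg N : (0:ℝ) ≤ N)])
      calc _ ≤ t ^ (s+N-1).re * (C * t ^ (-((N:ℝ)+1))) := by
            gcongr; exact hC2.trans (by gcongr)
        _ = C * t ^ ((s+N-1).re + (-((N:ℝ)+1))) := by rw [Real.rpow_add ht]; ring
        _ ≤ C * t ^ (b-2) := by
            gcongr
            · exact h.le
            · simp; linarith

noncomputable def tzc (s : ℂ) : ℂ := tzE s 1 + ∫ x in (0:ℝ)..1, tzE (s-1) x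

lemma tz_sub_re {s : ℂ} (hs : s.re < 1) (k : ℕ) : (s - k).re < 1 := by
  simp; linarith [(Nat.cast_nonneg k : (0:ℝ) ≤ k)]

lemma tz_sub_one_re {s : ℂ} (hs : s.re < 1) : (s - 1).re < 1 := by
  simp; linarith

lemma tzE_cont {s : ℂ} (hs : s.re < 1) : ContinuousOn (tzE s) (Set.Ioi 0) :=
  fun _ hx => (tzE_hasDerivAt hs hx).continuousAt.continuousWithinAt

lemma tzE_bdd' {s : ℂ} (hs : s.re < 1) : ∃ C : ℝ, ∀ x : ℝ, 0 < x → ‖tzE s x‖ ≤ C := by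
  obtain ⟨C, U, hU, h⟩ := tzE_bdd hs
  exact ⟨C, h s (mem_of_mem_nhds hU)⟩

open MeasureTheory Set in
lemma tzE_intervalIntegrable {s : ℂ} (hs : s.re < 1) {x : ℝ} (hx : 0 < x) :
    IntervalIntegrable (tzE s) volume 0 x := by
  rw [intervalIntegrable_iff_integrableOn_Ioc_of_le hx.le]
  obtain ⟨C, hC⟩ := tzE_bdd' hs
  refine Integrable.mono' (g := fun _ => C) (integrableOn_const (by simp)) ?_ ?_
  · exact ((tzE_cont hs).mono Ioc_subset_Ioi_self).aestronglyMeasurable measurableSet_Ioc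
  · exact (ae_restrict_iff' measurableSet_Ioc).2 (ae_of_all _ fun t ht => hC t ht.1)

open MeasureTheory Set in
lemma tzE_sub {s : ℂ} (hs : s.re < 1) {x : ℝ} (hx : 0 < x) :
    tzE s x = tzc s - ∫ t in (0:ℝ)..x, tzE (s-1) t := by
  have hs' := tz_sub_one_re hs
  have h1 : IntervalIntegrable (tzE (s-1)) volume x 1 :=
    (tzE_intervalIntegrable hs' hx).symm.trans (tzE_intervalIntegrable hs' one_pos)
  have h2 : ∫ t in x..1, -tzE (s-1) t = tzE s 1 - tzE s x := by
    refine intervalIntegral.integral_eq_sub_of_hasDerivAt (fun t ht => tzE_hasDerivAt hs ?_) h1.neg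
    rcases le_total x 1 with h | h
    · rw [uIcc_of_le h] at ht; linarith [ht.1]
    · rw [uIcc_of_ge h] at ht; linarith [ht.1]
  have h3 := intervalIntegral.integral_add_adjacent_intervals (tzE_intervalIntegrable hs' hx) h1
  rw [intervalIntegral.integral_neg] at h2
  rw [tzc, ← h3]
  linear_combination h2

lemma tzE_differentiableAt {s : ℂ} (hs : s.re < 1) {x : ℝ} (hx : 0 < x) :
    DifferentiableAt ℂ (fun s => tzE s x) s := by
  unfold tzE
  refine (tzL_differentiable hx s).sub (DifferentiableAt.mul ?_ ?_)
  · refine DifferentiableAt.comp (g := Complex.Gamma) s (Complex.differentiableAt_Gamma _ fun m h => ?_) (by fun_prop)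
    have := congrArg Complex.re h
    simp at this
    linarith [(Nat.cast_nonneg m : (0:ℝ) ≤ m)]
  · exact DifferentiableAt.const_cpow (by fun_prop) (Or.inl (by exact_mod_cast hx.ne'))

/-- Taylor coefficients -/
noncomputable def tze (k : ℕ) (s : ℂ) : ℂ := (-1)^k / (k.factorial : ℂ) * tzc (s - k)

noncomputable def tzP (K : ℕ) (s : ℂ) (x : ℝ) : ℂ := ∑ k ∈ Finset.range K, tze k s * (x:ℂ)^k

lemma tze_succ (k : ℕ) (s : ℂ) : tze (k+1) s = - (tze k (s-1) / (k+1)) := by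
  unfold tze
  rw [Nat.factorial_succ]
  have : ((k:ℂ)+1) ≠ 0 := by exact_mod_cast Nat.succ_ne_zero k
  have : (k.factorial : ℂ) ≠ 0 := by exact_mod_cast k.factorial_ne_zero
  push_cast
  rw [show s - (k+1) = s - 1 - (k:ℂ) by ring, pow_succ]
  field_simp

lemma tzP_succ (K : ℕ) (s : ℂ) (x : ℝ) :
    tzP (K+1) s x = tzc s - ∫ t in (0:ℝ)..x, tzP K (s-1) t := by
  unfold tzP
  rw [Finset.sum_range_succ', intervalIntegral.integral_finsetSum]
  · have : ∀ k ∈ Finset.range K, ∫ t in (0:ℝ)..x, tze k (s-1) * (t:ℂ)^k = - (tze (k+1) s * (x:ℂ)^(k+1)) := by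
      intro k _
      rw [intervalIntegral.integral_const_mul, tze_succ]
      have h1 : ∫ t in (0:ℝ)..x, (t:ℂ)^k = (x:ℂ)^(k+1) / (k+1) := by
        have := integral_pow (a := 0) (b := x) k
        simp_rw [← Complex.ofReal_pow]
        rw [intervalIntegral.integral_ofReal, this]
        simp
      rw [h1]; ring
    rw [Finset.sum_congr rfl this, Finset.sum_neg_distrib]
    simp [tze]
    ring
  · intro k _
    exact Continuous.intervalIntegrable (by fun_prop) _ _

open Filter Topology Set in
lemma tz_taylor (K : ℕ) : ∀ {s₀ : ℂ}, s₀.re < 1 → ∃ C : ℝ, ∃ U ∈ 𝓝 s₀, ∀ s ∈ U, ∀ x : ℝ, 0 < x →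
    ‖tzE s x - tzP K s x‖ ≤ C * x ^ K := by
  induction K with
  | zero =>
    intro s₀ hs0
    simpa [tzP] using tzE_bdd hs0
  | succ K ih =>
    intro s₀ hs0
    obtain ⟨C, U, hU, h⟩ := ih (tz_sub_one_re hs0)
    have hcont : ContinuousAt (fun s : ℂ => s - 1) s₀ := by fun_prop
    refine ⟨C, (fun s : ℂ => s - 1) ⁻¹' U ∩ {s | s.re < 1}, inter_mem (hcont hU)
      ((isOpen_lt Complex.continuous_re continuous_const).mem_nhds hs0), ?_⟩
    rintro s ⟨hsU, hs1⟩ x hx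
    have hs1 : s.re < 1 := hs1
    have hPc : Continuous (fun t : ℝ => tzP K (s-1) t) := by unfold tzP; fun_prop
    rw [tzE_sub hs1 hx, tzP_succ, sub_sub_sub_cancel_left, ← intervalIntegral.integral_sub
      (hPc.intervalIntegrable _ _) (tzE_intervalIntegrable (tz_sub_one_re hs1) hx)]
    have hC0 : 0 ≤ C := by
      have := (norm_nonneg _).trans (h _ hsU 1 one_pos); simpa using this
    have := intervalIntegral.norm_integral_le_of_norm_le_const (a := 0) (b := x) (C := C * x^K)
      (f := fun t => tzP K (s-1) t - tzE (s-1) t) ?_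
    · refine this.trans (le_of_eq ?_)
      rw [sub_zero, abs_of_pos hx]; ring
    · intro t ht
      rw [uIoc_of_le hx.le] at ht
      rw [norm_sub_rev]
      refine (h _ hsU t ht.1).trans ?_
      gcongr
      · exact ht.1.le
      · exact ht.2

open Filter Topology Set in
lemma tzc_differentiableAt {s : ℂ} (hs : s.re < 1) : DifferentiableAt ℂ tzc s := by
  have hopen : IsOpen {s : ℂ | s.re < 1} := isOpen_lt Complex.continuous_re continuous_const
  have hlim : TendstoLocallyUniformlyOn (fun (n : ℕ) (s : ℂ) => tzE s (1/((n:ℝ)+1))) tzc atTop {s : ℂ | s.re < 1} := by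
    rw [Metric.tendstoLocallyUniformlyOn_iff]
    intro ε hε s hs
    obtain ⟨C, U, hU, h⟩ := tz_taylor 1 (s₀ := s) hs
    refine ⟨U, mem_nhdsWithin_of_mem_nhds hU, ?_⟩
    have h1 : Tendsto (fun n : ℕ => C * (1/((n:ℝ)+1))) atTop (𝓝 0) := by
      simpa using (tendsto_one_div_add_atTop_nhds_zero_nat (𝕜 := ℝ)).const_mul C
    filter_upwards [h1.eventually (gt_mem_nhds hε)] with n hn z hz
    have := h z hz (1/((n:ℝ)+1)) (by positivity)
    rw [dist_comm, dist_eq_norm]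
    simp [tzP, tze] at this hn ⊢
    linarith
  have := hlim.differentiableOn (Eventually.of_forall fun n z hz =>
    (tzE_differentiableAt hz (by positivity)).differentiableWithinAt) hopen
  exact this.differentiableAt (hopen.mem_nhds hs)

lemma tze_differentiableAt (k : ℕ) {s : ℂ} (hs : s.re < 1) : DifferentiableAt ℂ (tze k) s := by
  unfold tze
  refine (DifferentiableAt.comp (g := tzc) s (tzc_differentiableAt (tz_sub_re hs k)) (by fun_prop)).const_mul _

open Filter Topology Set in
lemma tzc_neg_nat (m : ℕ) : tzc (-(m:ℂ)) = (-1)^m * iteratedDeriv m tzH 0 := by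
  obtain ⟨C, U, hU, h⟩ := tz_taylor 1 (s₀ := -(m:ℂ)) (by simp; linarith [(Nat.cast_nonneg m : (0:ℝ) ≤ m)])
  have h1 := h _ (mem_of_mem_nhds hU)
  have h2 : Tendsto (fun x : ℝ => tzE (-(m:ℂ)) x) (𝓝[>] 0) (𝓝 (tzc (-(m:ℂ)))) := by
    rw [tendsto_iff_norm_sub_tendsto_zero]
    refine squeeze_zero' (Eventually.of_forall fun _ => norm_nonneg _) (g := fun x => C * x) ?_ ?_
    · filter_upwards [self_mem_nhdsWithin] with x hx
      simpa [tzP, tze] using h1 x hx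
    · have : Tendsto (fun x : ℝ => C * x) (𝓝 0) (𝓝 (C * 0)) := tendsto_id.const_mul C
      rw [mul_zero] at this
      exact this.mono_left nhdsWithin_le_nhds
  have h3 : Tendsto (fun x : ℝ => (-1)^m * iteratedDeriv m tzH x) (𝓝[>] 0) (𝓝 ((-1)^m * iteratedDeriv m tzH ((0:ℝ):ℂ))) := by
    have : ContinuousAt (fun x : ℝ => (-1)^m * iteratedDeriv m tzH x) 0 := by
      refine ContinuousAt.mul continuousAt_const ?_
      exact ContinuousAt.comp (f := fun x : ℝ => (x:ℂ)) (((tzH_iter_diffOn m).differentiableAt (tzU_open.mem_nhds (tzU_real 0))).continuousAt)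
        Complex.continuous_ofReal.continuousAt
    exact this.tendsto.mono_left nhdsWithin_le_nhds
  have h4 := tendsto_nhds_unique (h2.congr' (by filter_upwards [self_mem_nhdsWithin] with x hx using tzE_neg_nat m hx)) h3
  simpa using h4

/-- formal Taylor series at zero -/
noncomputable def tzT (f : ℂ → ℂ) : PowerSeries ℂ :=
  PowerSeries.mk fun k => iteratedDeriv k f 0 / (k.factorial : ℂ)

lemma tzT_mul {f g : ℂ → ℂ} (hf : AnalyticAt ℂ f 0) (hg : AnalyticAt ℂ g 0) :
    tzT (fun z => f z * g z) = tzT f * tzT g := by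
  ext n
  rw [PowerSeries.coeff_mul, Finset.Nat.sum_antidiagonal_eq_sum_range_succ_mk]
  simp only [tzT, PowerSeries.coeff_mk]
  rw [iteratedDeriv_fun_mul hf.contDiffAt hg.contDiffAt, Finset.sum_div]
  refine Finset.sum_congr rfl fun i hi => ?_
  have hi' : i ≤ n := by simpa [Nat.lt_succ_iff] using hi
  have h1 : (n.choose i : ℂ) * (i.factorial : ℂ) * ((n-i).factorial : ℂ) = (n.factorial : ℂ) := by
    exact_mod_cast Nat.choose_mul_factorial_mul_factorial hi'
  have h2 : (i.factorial : ℂ) ≠ 0 := by exact_mod_cast i.factorial_ne_zero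
  have h3 : ((n-i).factorial : ℂ) ≠ 0 := by exact_mod_cast (n-i).factorial_ne_zero
  have h4 : (n.factorial : ℂ) ≠ 0 := by exact_mod_cast n.factorial_ne_zero
  rw [div_mul_div_comm, div_eq_div_iff h4 (mul_ne_zero h2 h3), ← h1]
  ring

lemma tzT_congr {f g : ℂ → ℂ} (h : f =ᶠ[nhds 0] g) : tzT f = tzT g := by
  ext n
  simp only [tzT, PowerSeries.coeff_mk, h.iteratedDeriv_eq n]

lemma tzT_id : tzT (fun z => z) = PowerSeries.X := by
  ext n
  simp only [tzT, PowerSeries.coeff_mk, PowerSeries.coeff_X, iteratedDeriv_fun_id_zero]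
  split_ifs with h
  · simp [h]
  · simp

lemma tzT_exp : tzT (fun z => Complex.exp z - 1) = PowerSeries.exp ℂ - 1 := by
  ext n
  have h : iteratedDeriv n Complex.exp 0 = 1 := by
    have := congrFun (iteratedDeriv_cexp_const_mul n 1) 0
    simpa using this
  rw [map_sub, PowerSeries.coeff_exp, PowerSeries.coeff_one]
  simp only [tzT, PowerSeries.coeff_mk]
  rcases n with _ | n
  · simp
  · have : (fun z => Complex.exp z - 1) = fun z => (-1) + Complex.exp z := by ext; ring
    rw [this, iteratedDeriv_const_add (Nat.succ_pos n), h]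
    simp

lemma tzT_const_add {f : ℂ → ℂ} (c : ℂ) : tzT (fun z => c + f z) = PowerSeries.C c + tzT f := by
  ext n
  rw [map_add, PowerSeries.coeff_C]
  simp only [tzT, PowerSeries.coeff_mk]
  rcases n with _ | n
  · simp
  · rw [iteratedDeriv_const_add (Nat.succ_pos n)]
    simp

lemma tzH_analytic : AnalyticAt ℂ tzH 0 := tzH_diffOn.analyticAt (tzU_open.mem_nhds tzU_zero)
lemma tzy_analytic : AnalyticAt ℂ tzy 0 := tzy_diffOn.analyticAt (tzU_open.mem_nhds tzU_zero)

lemma tzT_y : tzT tzy = 1 + PowerSeries.X * tzT tzH := by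
  have : tzy = fun z => 1 + z * tzH z := by ext z; exact tzy_eq z
  rw [this, tzT_const_add, tzT_mul (f := fun z => z) analyticAt_id tzH_analytic, tzT_id]
  simp

lemma tzT_y_mul : tzT tzy * (PowerSeries.exp ℂ - 1) = PowerSeries.X := by
  rw [← tzT_exp, ← tzT_mul tzy_analytic (by fun_prop), ← tzT_id]
  refine tzT_congr ?_
  filter_upwards [tzU_open.mem_nhds tzU_zero] with z hz using tzy_mul hz

noncomputable def tzG (m : ℕ) : PowerSeries ℂ :=
  PowerSeries.mk fun k => iteratedDeriv (m+k) tzH 0 / (k.factorial : ℂ)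

lemma tzG_deriv (m : ℕ) : PowerSeries.derivative ℂ (tzG m) = tzG (m+1) := by
  ext n
  rw [PowerSeries.coeff_derivative]
  simp only [tzG, PowerSeries.coeff_mk]
  rw [Nat.factorial_succ, show m + 1 + n = m + (n+1) by ring]
  have : ((n:ℂ)+1) ≠ 0 := by exact_mod_cast Nat.succ_ne_zero n
  have : (n.factorial : ℂ) ≠ 0 := by exact_mod_cast n.factorial_ne_zero
  push_cast
  field_simp

/-- theta -/
noncomputable def tzTh : PowerSeries ℂ :=
  PowerSeries.X * PowerSeries.derivative ℂ (tzT tzy) - tzT tzy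

lemma tzTh_eq : tzTh = - (PowerSeries.X * tzT tzy) - tzT tzy ^ 2 := by
  have h := tzT_y_mul
  have h1 := congrArg (PowerSeries.derivative ℂ) h
  rw [Derivation.leibniz, map_sub, PowerSeries.derivative_exp, PowerSeries.derivative_one,
    PowerSeries.derivative_X] at h1
  simp only [smul_eq_mul, sub_zero] at h1
  unfold tzTh
  linear_combination tzT tzy * h1 - (PowerSeries.derivative ℂ (tzT tzy) + tzT tzy) * h

noncomputable def tzW (d : ℕ) : Submodule ℂ (PowerSeries ℂ) :=
  Submodule.span ℂ {F | ∃ i j : ℕ, i + j = d ∧ F = tzT tzy ^ i * PowerSeries.X ^ j}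

lemma tzW_mem (i j d : ℕ) (h : i + j = d) : tzT tzy ^ i * PowerSeries.X ^ j ∈ tzW d :=
  Submodule.subset_span ⟨i, j, h, rfl⟩

lemma tzW_mul {a b d : ℕ} (h : a + b = d) {F G : PowerSeries ℂ} (hF : F ∈ tzW a) (hG : G ∈ tzW b) :
    F * G ∈ tzW d := by
  have h1 := Submodule.mul_mem_mul hF hG
  rw [tzW, tzW, Submodule.span_mul_span] at h1
  refine Submodule.span_mono ?_ h1
  rintro _ ⟨_, ⟨i, j, hij, rfl⟩, _, ⟨i', j', hij', rfl⟩, rfl⟩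
  exact ⟨i + i', j + j', by omega, by ring⟩

lemma tzTh_mem : tzTh ∈ tzW 2 := by
  rw [tzTh_eq]
  refine (tzW 2).sub_mem ((tzW 2).neg_mem ?_) ?_
  · simpa [mul_comm] using tzW_mem 1 1 2 rfl
  · simpa using tzW_mem 2 0 2 rfl

lemma tz_L (d : ℕ) {F : PowerSeries ℂ} (hF : F ∈ tzW (d+1)) : ∃ G ∈ tzW d,
    PowerSeries.X * PowerSeries.derivative ℂ F - ((d:PowerSeries ℂ)+1) * F = tzTh * G := by
  induction hF using Submodule.span_induction with
  | mem F h =>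
    obtain ⟨i, j, hij, rfl⟩ := h
    rcases i with _ | i
    · refine ⟨0, Submodule.zero_mem _, ?_⟩
      obtain rfl : j = d + 1 := by omega
      rw [pow_zero, one_mul, PowerSeries.derivative_pow]
      simp
      ring
    · refine ⟨((i:ℂ)+1) • (tzT tzy ^ i * PowerSeries.X ^ j), Submodule.smul_mem _ _ (tzW_mem _ _ _ (by omega)), ?_⟩
      rw [Derivation.leibniz, PowerSeries.derivative_pow, PowerSeries.derivative_pow, tzTh]
      have hd : (d : PowerSeries ℂ) = i + j := by
        have : d = i + j := by omega
        rw [this]; push_cast; rfl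
      rw [hd]
      have hs : ∀ Z : PowerSeries ℂ, ((i:ℂ)+1) • Z = ((i : PowerSeries ℂ) + 1) * Z := by
        intro Z; rw [add_smul, one_smul, Nat.cast_smul_eq_nsmul, nsmul_eq_mul]; ring
      rw [hs]
      rcases j with _ | j
      · simp; ring
      · simp; ring
  | zero => exact ⟨0, Submodule.zero_mem _, by simp⟩
  | add F F' _ _ h h' =>
    obtain ⟨G, hG, h⟩ := h
    obtain ⟨G', hG', h'⟩ := h'
    refine ⟨G + G', Submodule.add_mem _ hG hG', ?_⟩
    rw [map_add]
    linear_combination h + h'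
  | smul a F _ h =>
    obtain ⟨G, hG, h⟩ := h
    refine ⟨a • G, Submodule.smul_mem _ _ hG, ?_⟩
    rw [Derivation.map_smul, mul_smul_comm, mul_smul_comm, mul_smul_comm, ← smul_sub, h]

lemma tz_coeff (d : ℕ) {F : PowerSeries ℂ} (hF : F ∈ tzW d) : PowerSeries.coeff (d+1) (tzTh * F) = 0 := by
  induction hF using Submodule.span_induction with
  | mem F h =>
    obtain ⟨i, j, rfl, rfl⟩ := h
    have h1 : ((i:ℂ)+1) • (tzTh * (tzT tzy ^ i * PowerSeries.X ^ j)) =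
        PowerSeries.X ^ j * (PowerSeries.X * PowerSeries.derivative ℂ (tzT tzy ^ (i+1)) - ((i:ℂ)+1) • tzT tzy ^ (i+1)) := by
      have hs : ∀ Z : PowerSeries ℂ, ((i:ℂ)+1) • Z = ((i : PowerSeries ℂ) + 1) * Z := by
        intro Z; rw [add_smul, one_smul, Nat.cast_smul_eq_nsmul, nsmul_eq_mul]; ring
      rw [hs, hs, PowerSeries.derivative_pow, tzTh]
      simp
      ring
    have h2 := congrArg (PowerSeries.coeff (i+j+1)) h1
    rw [show i + j + 1 = (i+1) + j by ring, PowerSeries.coeff_X_pow_mul] at h2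
    rw [map_sub, PowerSeries.coeff_succ_X_mul, PowerSeries.coeff_derivative] at h2
    simp only [map_smul, smul_eq_mul] at h2
    have h3 : ((i:ℂ)+1) ≠ 0 := by exact_mod_cast Nat.succ_ne_zero i
    rw [show i + j + 1 = (i+1) + j by ring]
    refine (mul_eq_zero.1 ?_).resolve_left h3
    rw [h2]; ring
  | zero => simp
  | add F F' _ _ h h' => rw [mul_add, map_add, h, h', add_zero]
  | smul a F _ h => rw [mul_smul_comm, map_smul, h, smul_zero]

noncomputable def tzD (n : ℕ) : PowerSeries ℂ :=
  PowerSeries.C ((-1)^n * (n.factorial : ℂ)) + PowerSeries.X^(n+1) * tzG n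

lemma tzD_zero : tzD 0 = tzT tzy := by
  rw [tzT_y, tzD]
  simp [tzG, tzT]

lemma tzD_succ (n : ℕ) : tzD (n+1) = PowerSeries.X * PowerSeries.derivative ℂ (tzD n) - ((n:PowerSeries ℂ)+1) * tzD n := by
  unfold tzD
  rw [map_add, PowerSeries.derivative_C, Derivation.leibniz, PowerSeries.derivative_pow, tzG_deriv, Nat.factorial_succ]
  simp
  ring

lemma tzD_mem (n : ℕ) : tzD n ∈ tzW (n+1) ∧ ∃ F ∈ tzW n, tzD (n+1) = tzTh * F := by
  have key : ∀ m, tzD m ∈ tzW (m+1) → ∃ F ∈ tzW m, tzD (m+1) = tzTh * F := by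
    intro m hm
    rw [tzD_succ]
    exact tz_L m hm
  have : tzD n ∈ tzW (n+1) := by
    induction n with
    | zero => rw [tzD_zero]; simpa using tzW_mem 1 0 1 rfl
    | succ n ih =>
      obtain ⟨F, hF, h⟩ := key n ih
      rw [h]
      exact tzW_mul (by omega) tzTh_mem hF
  exact ⟨this, key n this⟩

lemma tzD_cube (n : ℕ) (hn : 1 ≤ n) : PowerSeries.coeff (3*n+2) (tzD n ^ 3) = 0 := by
  obtain ⟨m, rfl⟩ : ∃ m, n = m + 1 := ⟨n-1, by omega⟩
  obtain ⟨F, hF, h⟩ := (tzD_mem m).2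
  have h1 := (tzD_mem (m+1)).1
  have : tzD (m+1) ^ 3 = tzTh * (F * (tzD (m+1) * tzD (m+1))) := by
    rw [show tzD (m+1) ^ 3 = tzD (m+1) * (tzD (m+1) * tzD (m+1)) by ring]
    nth_rewrite 1 [h]
    ring
  rw [this]
  exact tz_coeff (3*(m+1)+1) (tzW_mul (b := 2*m+4) (by ring) hF (tzW_mul (by ring) h1 h1))

lemma tze_neg (n k : ℕ) : tze k (-(n:ℂ)) = (-1)^n * PowerSeries.coeff k (tzG n) := by
  rw [tze, show -(n:ℂ) - k = -((n+k:ℕ):ℂ) by push_cast; ring, tzc_neg_nat]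
  simp only [tzG, PowerSeries.coeff_mk]
  rw [pow_add]
  have : ((-1:ℂ)^k) * (-1)^k = 1 := by rw [← mul_pow]; simp
  linear_combination ((-1)^n * iteratedDeriv (n+k) tzH 0 / (k.factorial:ℂ)) * this

theorem tz_residue (n : ℕ) (hn : 1 ≤ n) : (n.factorial : ℂ) * tze (2*n+1) (-(n:ℂ)) +
    ∑ p ∈ Finset.HasAntidiagonal.antidiagonal n, tze p.1 (-(n:ℂ)) * tze p.2 (-(n:ℂ)) = 0 := by
  have h := tzD_cube n hn
  have h1 : tzD n ^ 3 = PowerSeries.C (((-1)^n * (n.factorial : ℂ))^3)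
     + PowerSeries.C (3*((-1)^n * (n.factorial : ℂ))^2) * (PowerSeries.X^(n+1) * tzG n)
     + PowerSeries.C (3*((-1)^n * (n.factorial : ℂ))) * (PowerSeries.X^(2*n+2) * (tzG n * tzG n))
     + PowerSeries.X^(3*n+3) * tzG n ^ 3 := by
    unfold tzD
    rw [map_pow, map_mul _ 3, map_mul _ 3, map_pow]
    have : (PowerSeries.C (3:ℂ)) = (3 : PowerSeries ℂ) := map_ofNat _ 3
    rw [this]
    ring
  rw [h1] at h
  simp only [map_add, PowerSeries.coeff_C_mul] at h
  rw [PowerSeries.coeff_C, if_neg (by omega), PowerSeries.coeff_X_pow_mul' _ (3*n+3), if_neg (by omega),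
    show 3*n+2 = (2*n+1) + (n+1) by ring, PowerSeries.coeff_X_pow_mul,
    show (2*n+1) + (n+1) = n + (2*n+2) by ring, PowerSeries.coeff_X_pow_mul, PowerSeries.coeff_mul] at h
  simp only [tze_neg]
  have hs : ((-1:ℂ)^n) * (-1)^n = 1 := by rw [← mul_pow]; simp
  have h5 : ∑ p ∈ Finset.HasAntidiagonal.antidiagonal n, (-1:ℂ)^n * PowerSeries.coeff p.1 (tzG n) * ((-1)^n * PowerSeries.coeff p.2 (tzG n))
      = ∑ p ∈ Finset.HasAntidiagonal.antidiagonal n, PowerSeries.coeff p.1 (tzG n) * PowerSeries.coeff p.2 (tzG n) := by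
    refine Finset.sum_congr rfl fun p _ => ?_
    linear_combination (PowerSeries.coeff p.1 (tzG n) * PowerSeries.coeff p.2 (tzG n)) * hs
  rw [h5]
  have hn0 : (n.factorial : ℂ) ≠ 0 := by exact_mod_cast n.factorial_ne_zero
  have hs0 : (-1:ℂ)^n ≠ 0 := by simp
  have h6 : 3 * ((-1:ℂ)^n * (n.factorial : ℂ)) ≠ 0 := mul_ne_zero three_ne_zero (mul_ne_zero hs0 hn0)
  refine (mul_eq_zero.1 ?_).resolve_left h6
  linear_combination h

open MeasureTheory Set Filter Topology in
lemma tz_diff_both {μ : Measure ℝ} {F : ℂ → ℝ → ℂ} {s₀ : ℂ} {b : ℝ → ℝ}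
    (hmeas : ∀ᶠ s in 𝓝 s₀, AEStronglyMeasurable (F s) μ)
    (h : ∃ U ∈ 𝓝 s₀, ∀ᵐ a ∂μ, ∀ s ∈ U, DifferentiableAt ℂ (fun s => F s a) s ∧ ‖F s a‖ ≤ b a)
    (hb : Integrable b μ) :
    DifferentiableAt ℂ (fun s => ∫ a, F s a ∂μ) s₀ ∧ Integrable (F s₀) μ := by
  refine ⟨tz_differentiableAt_integral hmeas h hb, ?_⟩
  obtain ⟨U, hU, h⟩ := h
  exact hb.mono' hmeas.self_of_nhds (h.mono fun a ha => (ha s₀ (mem_of_mem_nhds hU)).2)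

lemma tz_cpow_contOn (a : ℂ) : ContinuousOn (fun x : ℝ => (x:ℂ)^a) (Set.Ioi 0) := by
  intro x hx
  refine ContinuousAt.continuousWithinAt ?_
  exact Complex.continuousAt_ofReal_cpow_const x a (Or.inr (ne_of_gt hx))

open MeasureTheory Set Filter Topology in
lemma tz_diff_aux {F : ℂ → ℝ → ℂ} {φ : ℂ → ℂ} {s₀ : ℂ} (K : ℕ) (hφ : Differentiable ℂ φ)
    (hbd : ∃ C : ℝ, ∃ U ∈ 𝓝 s₀, ∀ s ∈ U, ∀ x : ℝ, 0 < x → x ≤ 1 → ‖F s x‖ ≤ C * x^K)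
    (hdiff : ∀ᶠ s in 𝓝 s₀, ∀ x : ℝ, 0 < x → DifferentiableAt ℂ (fun s => F s x) s)
    (hcont : ∀ᶠ s in 𝓝 s₀, ContinuousOn (F s) (Ioi 0)) (h : -1 < (φ s₀).re + K) :
    DifferentiableAt ℂ (fun s => ∫ x in Ioc (0:ℝ) 1, (x:ℂ)^(φ s) * F s x) s₀ ∧
      IntegrableOn (fun x : ℝ => (x:ℂ)^(φ s₀) * F s₀ x) (Ioc 0 1) := by
  obtain ⟨C, U, hU, hC⟩ := hbd
  obtain ⟨r, hr1, hr2⟩ := exists_between (show -1 - (K:ℝ) < (φ s₀).re by linarith)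
  have hC0 : 0 ≤ C := by
    have := (norm_nonneg _).trans (hC _ (mem_of_mem_nhds hU) 1 one_pos le_rfl); simpa using this
  have hre : ∀ᶠ s in 𝓝 s₀, r < (φ s).re :=
    (Complex.continuous_re.comp hφ.continuous).continuousAt.eventually (lt_mem_nhds hr2)
  refine tz_diff_both (b := fun x => C * x ^ (r + K)) ?_ ?_ ?_
  · filter_upwards [hcont] with s hs
    exact (((tz_cpow_contOn _).mul hs).mono Ioc_subset_Ioi_self).aestronglyMeasurable measurableSet_Ioc
  · refine ⟨_, inter_mem hU (inter_mem hdiff hre), ?_⟩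
    refine (ae_restrict_iff' measurableSet_Ioc).2 (ae_of_all _ ?_)
    rintro x ⟨hx0, hx1⟩ s ⟨hs1, hs2, hs3⟩
    constructor
    · refine DifferentiableAt.mul ?_ (hs2 x hx0)
      exact DifferentiableAt.const_cpow (hφ s) (Or.inl (by exact_mod_cast hx0.ne'))
    · rw [norm_mul, Complex.norm_cpow_eq_rpow_re_of_pos hx0, Real.rpow_add hx0, Real.rpow_natCast]
      have h1 : x ^ (φ s).re ≤ x ^ r := Real.rpow_le_rpow_of_exponent_ge hx0 hx1 (le_of_lt hs3)
      have h2 := hC s hs1 x hx0 hx1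
      calc x ^ (φ s).re * ‖F s x‖ ≤ x ^ r * (C * x^K) := by gcongr
        _ = _ := by ring
  · have := intervalIntegral.intervalIntegrable_rpow' (a := 0) (b := 1) (r := r + K) (by linarith)
    rw [intervalIntegrable_iff_integrableOn_Ioc_of_le zero_le_one] at this
    exact this.const_mul C

noncomputable def tzA (s : ℂ) : ℂ := ∫ x in Set.Ioi (1:ℝ), (x:ℂ)^(s-1) * tzL s x ^ 2

open MeasureTheory Set Filter Topology in
lemma tzA_diff (s₀ : ℂ) : DifferentiableAt ℂ tzA s₀ ∧
    IntegrableOn (fun x : ℝ => (x:ℂ)^(s₀-1) * tzL s₀ x ^ 2) (Ioi 1) := by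
  set C : ℝ := ∑' a : ℕ+, (a : ℝ) ^ (-(s₀.re-1)) * Real.exp (-((a:ℝ) * 1)) with hC
  have hC0 : 0 ≤ C := tsum_nonneg fun a => by positivity
  refine tz_diff_both (b := fun x => C^2 * Real.exp 1 * (Real.exp (-x) * x ^ ((|s₀.re| + 1) - 1))) ?_ ?_ ?_
  · refine Eventually.of_forall fun s => ?_
    have : ContinuousOn (tzL s) (Ioi 0) := fun x hx => (tzL_hasDerivAt s hx).continuousAt.continuousWithinAt
    exact (((tz_cpow_contOn _).mul (this.pow 2)).mono (Ioi_subset_Ioi zero_le_one)).aestronglyMeasurable measurableSet_Ioi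
  · refine ⟨{s | s₀.re - 1 < s.re} ∩ {s | s.re < s₀.re + 1}, inter_mem
      ((isOpen_lt continuous_const Complex.continuous_re).mem_nhds (by simp))
      ((isOpen_lt Complex.continuous_re continuous_const).mem_nhds (by simp)), ?_⟩
    refine (ae_restrict_iff' measurableSet_Ioi).2 (ae_of_all _ ?_)
    rintro x hx s ⟨hs1, hs2⟩
    have hx : 1 < x := hx
    have hs1 : s₀.re - 1 < s.re := hs1
    have hs2 : s.re < s₀.re + 1 := hs2
    have hx0 : 0 < x := by linarith
    constructor
    · refine DifferentiableAt.mul ?_ ((tzL_differentiable hx0 s).pow 2)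
      exact DifferentiableAt.const_cpow (by fun_prop) (Or.inl (by exact_mod_cast hx0.ne'))
    · rw [norm_mul, Complex.norm_cpow_eq_rpow_re_of_pos hx0, norm_pow]
      have h1 : x ^ (s-1).re ≤ x ^ ((|s₀.re| + 1) - 1) := by
        refine Real.rpow_le_rpow_of_exponent_le hx.le ?_
        simp only [sub_re, one_re]
        linarith [le_abs_self s₀.re]
      have h2 := tzL_norm_le s hs1.le one_pos hx.le
      rw [← hC] at h2
      have h3 : Real.exp (-(x-1)) ^ 2 ≤ Real.exp 1 * Real.exp (-x) := by
        rw [← Real.exp_add, ← Real.exp_nat_mul, Real.exp_le_exp]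
        push_cast; linarith
      calc x ^ (s-1).re * ‖tzL s x‖^2 ≤ x ^ ((|s₀.re| + 1) - 1) * (C * Real.exp (-(x-1)))^2 := by gcongr
        _ = x ^ ((|s₀.re| + 1) - 1) * C^2 * Real.exp (-(x-1))^2 := by ring
        _ ≤ x ^ ((|s₀.re| + 1) - 1) * C^2 * (Real.exp 1 * Real.exp (-x)) := by gcongr
        _ = _ := by ring
  · refine Integrable.const_mul ?_ _
    exact (Real.GammaIntegral_convergent (by positivity)).mono_set (Ioi_subset_Ioi zero_le_one)

noncomputable def tzρ₁ (K : ℕ) (s : ℂ) : ℂ :=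
  ∫ x in Set.Ioc (0:ℝ) 1, (x:ℂ)^(2*s-2) * (tzE s x - tzP K s x)
noncomputable def tzρ₂ (K : ℕ) (s : ℂ) : ℂ :=
  ∫ x in Set.Ioc (0:ℝ) 1, (x:ℂ)^(s-1) * ((tzE s x - tzP K s x) * (tzE s x + tzP K s x))

lemma tz_re_nhds {s : ℂ} (hs : s.re < 1) : ∀ᶠ z in nhds s, z.re < 1 :=
  (isOpen_lt Complex.continuous_re continuous_const).mem_nhds hs

lemma tzP_diff (K : ℕ) {s : ℂ} (hs : s.re < 1) (x : ℝ) : DifferentiableAt ℂ (fun s => tzP K s x) s := by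
  unfold tzP
  refine DifferentiableAt.fun_sum fun k _ => (tze_differentiableAt k hs).mul_const _

lemma tzP_cont (K : ℕ) (s : ℂ) : Continuous (tzP K s) := by
  unfold tzP; fun_prop

open MeasureTheory Set Filter Topology in
lemma tzρ₁_diff (K : ℕ) {s : ℂ} (hs : s.re < 1) (h : -1 < (2*s-2).re + K) :
    DifferentiableAt ℂ (tzρ₁ K) s ∧
      IntegrableOn (fun x : ℝ => (x:ℂ)^(2*s-2) * (tzE s x - tzP K s x)) (Ioc 0 1) := by
  refine tz_diff_aux (F := fun s x => tzE s x - tzP K s x) (φ := fun s => 2*s-2) K (by fun_prop) ?_ ?_ ?_ h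
  · obtain ⟨C, U, hU, hC⟩ := tz_taylor K hs
    exact ⟨C, U, hU, fun s hs x hx _ => hC s hs x hx⟩
  · filter_upwards [tz_re_nhds hs] with z hz x hx
    exact (tzE_differentiableAt hz hx).sub (tzP_diff K hz x)
  · filter_upwards [tz_re_nhds hs] with z hz
    exact (tzE_cont hz).sub (tzP_cont K z).continuousOn

open MeasureTheory Set Filter Topology in
lemma tzρ₂_diff (K : ℕ) {s : ℂ} (hs : s.re < 1) (h : -1 < (s-1).re + K) :
    DifferentiableAt ℂ (tzρ₂ K) s ∧
      IntegrableOn (fun x : ℝ => (x:ℂ)^(s-1) * ((tzE s x - tzP K s x) * (tzE s x + tzP K s x))) (Ioc 0 1) := by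
  refine tz_diff_aux (F := fun s x => (tzE s x - tzP K s x) * (tzE s x + tzP K s x))
    (φ := fun s => s-1) K (by fun_prop) ?_ ?_ ?_ h
  · obtain ⟨C, U, hU, hC⟩ := tz_taylor K hs
    obtain ⟨C', U', hU', hC'⟩ := tzE_bdd hs
    have hC0 : 0 ≤ C := by
      have := (norm_nonneg _).trans (hC _ (mem_of_mem_nhds hU) 1 one_pos); simpa using this
    refine ⟨C * (2*C' + C), U ∩ U', inter_mem hU hU', ?_⟩
    rintro s ⟨hs, hs'⟩ x hx hx1
    have h1 := hC s hs x hx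
    have h2 := hC' s hs' x hx
    have h3 : ‖tzE s x + tzP K s x‖ ≤ 2*C' + C := by
      have : tzE s x + tzP K s x = tzE s x + tzE s x - (tzE s x - tzP K s x) := by ring
      rw [this]
      have h4 : C * x^K ≤ C := mul_le_of_le_one_right hC0 (pow_le_one₀ hx.le hx1)
      have := norm_sub_le (tzE s x + tzE s x) (tzE s x - tzP K s x)
      have := norm_add_le (tzE s x) (tzE s x)
      linarith
    rw [norm_mul]
    calc _ ≤ (C * x^K) * (2*C' + C) := by gcongr
      _ = _ := by ring
  · filter_upwards [tz_re_nhds hs] with z hz x hx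
    exact ((tzE_differentiableAt hz hx).sub (tzP_diff K hz x)).mul
      ((tzE_differentiableAt hz hx).add (tzP_diff K hz x))
  · filter_upwards [tz_re_nhds hs] with z hz
    exact ((tzE_cont hz).sub (tzP_cont K z).continuousOn).mul ((tzE_cont hz).add (tzP_cont K z).continuousOn)

open MeasureTheory Set Filter Topology in
lemma tz_int_cpow {a : ℂ} (ha : -1 < a.re) : IntegrableOn (fun x : ℝ => (x:ℂ)^a) (Ioc 0 1) ∧
    ∫ x in Ioc (0:ℝ) 1, (x:ℂ)^a = 1 / (a+1) := by
  have h := intervalIntegral.intervalIntegrable_cpow' (a := 0) (b := 1) ha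
  rw [intervalIntegrable_iff_integrableOn_Ioc_of_le zero_le_one] at h
  refine ⟨h, ?_⟩
  rw [← intervalIntegral.integral_of_le zero_le_one, integral_cpow (Or.inl ha)]
  have : a + 1 ≠ 0 := by
    intro h
    have := congrArg Complex.re h
    simp at this; linarith
  simp [Complex.zero_cpow this]

noncomputable def tzg (K : ℕ) (s : ℂ) : ℂ :=
  tzA s + 2 * Complex.Gamma (1-s) * tzρ₁ K s + tzρ₂ K s + Complex.Gamma (1-s)^2 / (3*s-2)
    + 2 * Complex.Gamma (1-s) * ∑ k ∈ Finset.range K, tze k s / (2*s-1+k)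
    + ∑ j ∈ Finset.range K, ∑ k ∈ Finset.range K, tze j s * tze k s / (s+j+k)

open MeasureTheory Set Filter Topology in
lemma tz_expand (K : ℕ) {s : ℂ} (h1 : 2/3 < s.re) (h2 : s.re < 1) :
    Complex.Gamma s * tornheim s s s = tzg K s := by
  have hK : (0:ℝ) ≤ K := Nat.cast_nonneg K
  have i1 := tz_int_cpow (a := 3*s-3) (by simp; linarith)
  have i2 : ∀ k : ℕ, _ := fun k => tz_int_cpow (a := 2*s-2+k) (by
    simp; linarith [(Nat.cast_nonneg k : (0:ℝ) ≤ k)])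
  have i3 : ∀ j k : ℕ, _ := fun j k => tz_int_cpow (a := s-1+j+k) (by
    simp; linarith [(Nat.cast_nonneg k : (0:ℝ) ≤ k), (Nat.cast_nonneg j : (0:ℝ) ≤ j)])
  have r1 := (tzρ₁_diff K h2 (by simp; linarith)).2
  have r2 := (tzρ₂_diff K h2 (by simp; linarith)).2
  set Γ := Complex.Gamma (1-s) with hΓ
  have hexp : ∀ x ∈ Ioc (0:ℝ) 1, (x:ℂ)^(s-1) * tzL s x ^ 2 =
      (Γ^2 * (x:ℂ)^(3*s-3) + (2*Γ) * ((x:ℂ)^(2*s-2) * (tzE s x - tzP K s x))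
      + (x:ℂ)^(s-1) * ((tzE s x - tzP K s x) * (tzE s x + tzP K s x))
      + (2*Γ) * ∑ k ∈ Finset.range K, tze k s * (x:ℂ)^(2*s-2+k))
      + ∑ j ∈ Finset.range K, ∑ k ∈ Finset.range K, tze j s * tze k s * (x:ℂ)^(s-1+j+k) := by
    intro x hx
    have hx0 : (x:ℂ) ≠ 0 := by exact_mod_cast hx.1.ne'
    have e1 : (x:ℂ)^(3*s-3) = (x:ℂ)^(s-1) * (x:ℂ)^(s-1) * (x:ℂ)^(s-1) := by
      rw [← Complex.cpow_add _ _ hx0, ← Complex.cpow_add _ _ hx0]; congr 1; ring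
    have e2 : (x:ℂ)^(2*s-2) = (x:ℂ)^(s-1) * (x:ℂ)^(s-1) := by
      rw [← Complex.cpow_add _ _ hx0]; congr 1; ring
    have e3 : ∑ k ∈ Finset.range K, tze k s * (x:ℂ)^(2*s-2+k) = (x:ℂ)^(2*s-2) * tzP K s x := by
      rw [tzP, Finset.mul_sum]
      refine Finset.sum_congr rfl fun k _ => ?_
      rw [Complex.cpow_add _ _ hx0, Complex.cpow_natCast]; ring
    have e4 : ∑ j ∈ Finset.range K, ∑ k ∈ Finset.range K, tze j s * tze k s * (x:ℂ)^(s-1+j+k)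
        = (x:ℂ)^(s-1) * (tzP K s x * tzP K s x) := by
      rw [tzP, Finset.sum_mul_sum, Finset.mul_sum]
      refine Finset.sum_congr rfl fun j _ => ?_
      rw [Finset.mul_sum]
      refine Finset.sum_congr rfl fun k _ => ?_
      rw [Complex.cpow_add _ _ hx0, Complex.cpow_add _ _ hx0, Complex.cpow_natCast, Complex.cpow_natCast]; ring
    have e5 : tzL s x = Γ * (x:ℂ)^(s-1) + tzE s x := by rw [tzE]; ring
    rw [e3, e4, e5, e2, e1]; ring
  have j1 := i1.1.const_mul (Γ^2)
  have j2 := r1.const_mul (2*Γ)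
  have j4 : IntegrableOn (fun x : ℝ => ∑ k ∈ Finset.range K, tze k s * (x:ℂ)^(2*s-2+k)) (Ioc 0 1) :=
    integrable_finsetSum _ fun k _ => (i2 k).1.const_mul _
  have j5' : ∀ j, IntegrableOn (fun x : ℝ => ∑ k ∈ Finset.range K, tze j s * tze k s * (x:ℂ)^(s-1+j+k)) (Ioc 0 1) :=
    fun j => integrable_finsetSum _ fun k _ => (i3 j k).1.const_mul _
  have j5 : IntegrableOn (fun x : ℝ => ∑ j ∈ Finset.range K, ∑ k ∈ Finset.range K, tze j s * tze k s * (x:ℂ)^(s-1+j+k)) (Ioc 0 1) :=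
    integrable_finsetSum _ fun j _ => j5' j
  have j4' := j4.const_mul (2*Γ)
  have k3 := (j1.add j2).add r2
  have k4 := k3.add j4'
  have hint : IntegrableOn (fun x : ℝ => (x:ℂ)^(s-1) * tzL s x ^ 2) (Ioc 0 1) := by
    rw [integrableOn_congr_fun hexp measurableSet_Ioc]
    exact k4.add j5
  rw [tz_mellin h1, ← Ioc_union_Ioi_eq_Ioi (zero_le_one (α := ℝ)),
    setIntegral_union (Ioc_disjoint_Ioi le_rfl) measurableSet_Ioi hint (tzA_diff s).2,
    setIntegral_congr_fun measurableSet_Ioc hexp]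
  have t1 : ∫ x in Ioc (0:ℝ) 1, ∑ k ∈ Finset.range K, tze k s * (x:ℂ)^(2*s-2+k) =
      ∑ k ∈ Finset.range K, tze k s / (2*s-1+k) := by
    rw [integral_finsetSum _ fun k _ => (i2 k).1.const_mul _]
    refine Finset.sum_congr rfl fun k _ => ?_
    rw [integral_const_mul, (i2 k).2, mul_one_div]
    congr 1; ring
  have t2 : ∫ x in Ioc (0:ℝ) 1, ∑ j ∈ Finset.range K, ∑ k ∈ Finset.range K, tze j s * tze k s * (x:ℂ)^(s-1+j+k) =
      ∑ j ∈ Finset.range K, ∑ k ∈ Finset.range K, tze j s * tze k s / (s+j+k) := by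
    rw [integral_finsetSum _ fun j _ => j5' j]
    refine Finset.sum_congr rfl fun j _ => ?_
    rw [integral_finsetSum _ fun k _ => (i3 j k).1.const_mul _]
    refine Finset.sum_congr rfl fun k _ => ?_
    rw [integral_const_mul, (i3 j k).2, mul_one_div]
    congr 1; ring
  have a1 := integral_add k4 j5
  have a2 := integral_add k3 j4'
  have a3 := integral_add (j1.add j2) r2
  have a4 := integral_add j1 j2
  simp only [Pi.add_apply] at a1 a2 a3 a4
  rw [a1, a2, a3, a4, t2, integral_const_mul, integral_const_mul, integral_const_mul, t1, i1.2]
  unfold tzg tzA tzρ₁ tzρ₂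
  rw [show 3*s-3+1 = 3*s-2 by ring, ← hΓ]
  ring

def tzV (n : ℕ) : Set ℂ := {s | -(n:ℝ) - 1/4 < s.re} ∩ {s | s.re < 1}

lemma tzV_open (n : ℕ) : IsOpen (tzV n) :=
  (isOpen_lt continuous_const Complex.continuous_re).inter (isOpen_lt Complex.continuous_re continuous_const)

lemma tzV_preconnected (n : ℕ) : IsPreconnected (tzV n) :=
  ((convex_halfSpace_re_gt _).inter (convex_halfSpace_re_lt _)).isPreconnected

lemma tz_Gamma_diff {s : ℂ} (hs : s.re < 1) : DifferentiableAt ℂ (fun s => Complex.Gamma (1-s)) s := by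
  refine DifferentiableAt.comp (g := Complex.Gamma) s (Complex.differentiableAt_Gamma _ fun m h => ?_) (by fun_prop)
  have := congrArg Complex.re h
  simp at this
  linarith [(Nat.cast_nonneg m : (0:ℝ) ≤ m)]

lemma tz_analytic {n : ℕ} {F : ℂ → ℂ} (hF : ∀ s ∈ tzV n, DifferentiableAt ℂ F s) {s : ℂ} (hs : s ∈ tzV n) :
    AnalyticAt ℂ F s := by
  have : DifferentiableOn ℂ F (tzV n) := fun z hz => (hF z hz).differentiableWithinAt
  exact this.analyticAt ((tzV_open n).mem_nhds hs)

lemma tz_hol_diff (n : ℕ) {s : ℂ} (hs : s ∈ tzV n) : DifferentiableAt ℂ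
    (fun s => tzA s + 2 * Complex.Gamma (1-s) * tzρ₁ (2*n+4) s + tzρ₂ (2*n+4) s) s := by
  have h1 : -(n:ℝ) - 1/4 < s.re := hs.1
  have h2 : s.re < 1 := hs.2
  have a := (tzA_diff s).1
  have b := (tzρ₁_diff (2*n+4) h2 (by simp; linarith)).1
  have hn : (0:ℝ) ≤ n := Nat.cast_nonneg n
  have c := (tzρ₂_diff (2*n+4) h2 (by simp; linarith)).1
  have d := tz_Gamma_diff h2
  fun_prop

lemma tzg_meromorphic (n : ℕ) {s : ℂ} (hs : s ∈ tzV n) : MeromorphicAt (tzg (2*n+4)) s := by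
  have a := (tz_analytic (fun s hs => tz_hol_diff n hs) hs).meromorphicAt
  have b : MeromorphicAt (fun s => Complex.Gamma (1-s)) s :=
    (tz_analytic (fun s hs => tz_Gamma_diff hs.2) hs).meromorphicAt
  have c : ∀ k, MeromorphicAt (tze k) s := fun k =>
    (tz_analytic (fun s hs => tze_differentiableAt k hs.2) hs).meromorphicAt
  unfold tzg
  fun_prop

open Filter Topology in
lemma tz_frac_tendsto (n : ℕ) (a b : ℂ) (ha : a ≠ 0) :
    Tendsto (fun s : ℂ => (s + n) / (a * s + b)) (𝓝[≠] (-(n:ℂ))) (𝓝 (if b = a * n then 1/a else 0)) := by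
  split_ifs with h
  · refine tendsto_const_nhds.congr' ?_
    filter_upwards [self_mem_nhdsWithin] with s hs
    have : s + n ≠ 0 := fun h => hs (eq_neg_of_add_eq_zero_left h)
    rw [h, ← mul_add]
    field_simp
  · have h1 : a * (-(n:ℂ)) + b ≠ 0 := fun h' => h (by linear_combination h')
    have : ContinuousAt (fun s : ℂ => (s + n) / (a * s + b)) (-(n:ℂ)) := by
      refine ContinuousAt.div (by fun_prop) (by fun_prop) h1
    have := this.tendsto
    simp only [neg_add_cancel, zero_div] at this
    exact this.mono_left nhdsWithin_le_nhds

lemma tzV_neg (n : ℕ) : -(n:ℂ) ∈ tzV n := by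
  have hn : (0:ℝ) ≤ n := Nat.cast_nonneg n
  constructor <;> simp <;> linarith

open Filter Topology in
lemma tzg_limit (n : ℕ) (hn : 1 ≤ n) :
    Tendsto (fun s : ℂ => (s + n) * tzg (2*n+4) s) (𝓝[≠] (-(n:ℂ))) (𝓝 0) := by
  have hV := tzV_neg n
  have t0 : Tendsto (fun s : ℂ => s + n) (𝓝[≠] (-(n:ℂ))) (𝓝 0) := by
    have : ContinuousAt (fun s : ℂ => s + n) (-(n:ℂ)) := by fun_prop
    have := this.tendsto
    rw [neg_add_cancel] at this
    exact this.mono_left nhdsWithin_le_nhds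
  have t1 := (tz_hol_diff n hV).continuousAt.tendsto.mono_left (nhdsWithin_le_nhds (s := {-(n:ℂ)}ᶜ))
  have t2 := (tz_Gamma_diff (s := -(n:ℂ)) hV.2).continuousAt.tendsto.mono_left (nhdsWithin_le_nhds (s := {-(n:ℂ)}ᶜ))
  have t3 : ∀ k, Tendsto (tze k) (𝓝[≠] (-(n:ℂ))) (𝓝 (tze k (-(n:ℂ)))) := fun k =>
    (tze_differentiableAt k hV.2).continuousAt.tendsto.mono_left nhdsWithin_le_nhds
  have hG : Complex.Gamma (1 - -(n:ℂ)) = (n.factorial : ℂ) := by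
    rw [← Complex.Gamma_nat_eq_factorial]; congr 1; ring
  rw [hG] at t2
  have u1 := t0.mul t1
  have u2 := (t2.pow 2).mul (tz_frac_tendsto n 3 (-2) (by norm_num))
  have u3 := (t2.const_mul 2).mul (tendsto_finsetSum (Finset.range (2*n+4))
    fun k _ => (t3 k).mul (tz_frac_tendsto n 2 (-1 + k) (by norm_num)))
  have u4 := tendsto_finsetSum (Finset.range (2*n+4)) fun j _ => tendsto_finsetSum (Finset.range (2*n+4))
    fun k _ => ((t3 j).mul (t3 k)).mul (tz_frac_tendsto n 1 (j + k) (by norm_num))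
  have u := ((u1.add u2).add u3).add u4
  have hval : (0 * (tzA (-(n:ℂ)) + 2 * Complex.Gamma (1 - -(n:ℂ)) * tzρ₁ (2*n+4) (-(n:ℂ)) + tzρ₂ (2*n+4) (-(n:ℂ)))
      + (n.factorial:ℂ)^2 * (if (-2:ℂ) = 3 * n then 1/3 else 0)
      + 2 * (n.factorial:ℂ) * ∑ k ∈ Finset.range (2*n+4), tze k (-(n:ℂ)) * (if (-1:ℂ) + k = 2 * n then 1/2 else 0)
      + ∑ j ∈ Finset.range (2*n+4), ∑ k ∈ Finset.range (2*n+4), tze j (-(n:ℂ)) * tze k (-(n:ℂ)) *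
        (if (j:ℂ) + k = 1 * n then 1/1 else 0)) = 0 := by
    have e1 : ¬ ((-2:ℂ) = 3 * n) := by
      intro h
      have := congrArg Complex.re h
      simp at this
      linarith [(Nat.cast_nonneg n : (0:ℝ) ≤ n)]
    have e2 : ∑ k ∈ Finset.range (2*n+4), tze k (-(n:ℂ)) * (if (-1:ℂ) + k = 2 * n then 1/2 else 0)
        = tze (2*n+1) (-(n:ℂ)) * (1/2) := by
      rw [Finset.sum_eq_single (2*n+1)]
      · rw [if_pos (by push_cast; ring)]
      · intro k _ hk
        rw [if_neg, mul_zero]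
        intro h
        apply hk
        have : (k:ℂ) = ((2*n+1:ℕ):ℂ) := by push_cast; linear_combination h
        exact_mod_cast this
      · intro h; exact absurd (Finset.mem_range.2 (by omega)) h
    have e3 : ∑ j ∈ Finset.range (2*n+4), ∑ k ∈ Finset.range (2*n+4), tze j (-(n:ℂ)) * tze k (-(n:ℂ)) *
        (if (j:ℂ) + k = 1 * n then 1/1 else 0) =
        ∑ p ∈ Finset.HasAntidiagonal.antidiagonal n, tze p.1 (-(n:ℂ)) * tze p.2 (-(n:ℂ)) := by
      rw [← Finset.sum_product']
      have : ∀ p : ℕ × ℕ, tze p.1 (-(n:ℂ)) * tze p.2 (-(n:ℂ)) * (if (p.1:ℂ) + p.2 = 1 * n then 1/1 else 0)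
          = if p.1 + p.2 = n then tze p.1 (-(n:ℂ)) * tze p.2 (-(n:ℂ)) else 0 := by
        intro p
        have : ((p.1:ℂ) + p.2 = 1 * n) ↔ p.1 + p.2 = n := by rw [one_mul]; exact_mod_cast Iff.rfl
        simp only [this]
        split_ifs <;> simp
      rw [Finset.sum_congr rfl fun p _ => this p, ← Finset.sum_filter]
      refine Finset.sum_congr ?_ fun _ _ => rfl
      ext p
      simp only [Finset.mem_filter, Finset.mem_product, Finset.mem_range, Finset.HasAntidiagonal.mem_antidiagonal]
      omega
    rw [if_neg e1, e2, e3]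
    linear_combination tz_residue n hn
  rw [hval] at u
  refine u.congr fun s => ?_
  unfold tzg
  simp only [mul_add, Finset.mul_sum]
  have v1 : ∀ k : ℕ, 2 * Complex.Gamma (1-s) * (tze k s * ((s+n) / (2*s + (-1+k)))) =
      (s+n) * (2 * Complex.Gamma (1-s) * (tze k s / (2*s-1+k))) := by
    intro k; rw [show 2*s + (-1+(k:ℂ)) = 2*s-1+k by ring]; ring
  have v2 : ∀ j k : ℕ, tze j s * tze k s * ((s+n) / (1*s+(j+k))) = (s+n) * (tze j s * tze k s / (s+j+k)) := by
    intro j k; rw [show 1*s + ((j:ℂ)+(k:ℂ)) = s+j+k by ring]; ring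
  simp only [v1, v2]
  rw [show 3*s+(-2) = 3*s-2 by ring]
  ring

open Filter Topology in
lemma tz_final (f : ℂ → ℂ) (hf : ∀ z : ℂ, MeromorphicAt f z)
    (heq : ∀ s : ℂ, 2 / 3 < s.re → f s = tornheim s s s) (n : ℕ) (hn : 1 ≤ n) :
    Tendsto f (𝓝[≠] (-(n:ℂ))) (𝓝 0) := by
  set g : ℂ → ℂ := fun s => (Complex.Gamma s)⁻¹ * tzg (2*n+4) s with hg
  have hGa : ∀ s, AnalyticAt ℂ (fun s => (Complex.Gamma s)⁻¹) s := fun s =>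
    Complex.differentiable_one_div_Gamma.analyticAt s
  have hm : MeromorphicOn (f - g) (tzV n) := fun s hs =>
    (hf s).sub ((hGa s).meromorphicAt.mul (tzg_meromorphic n hs))
  have hp : (5/6:ℂ) ∈ tzV n := by
    have hn : (0:ℝ) ≤ n := Nat.cast_nonneg n
    constructor <;> norm_num <;> linarith
  have h1 : meromorphicOrderAt (f - g) (5/6) = ⊤ := by
    rw [meromorphicOrderAt_eq_top_iff]
    refine Filter.Eventually.filter_mono nhdsWithin_le_nhds ?_
    have o1 : ∀ᶠ s : ℂ in 𝓝 (5/6), 2/3 < s.re :=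
      (isOpen_lt continuous_const Complex.continuous_re).mem_nhds (by norm_num)
    have o2 : ∀ᶠ s : ℂ in 𝓝 (5/6), s.re < 1 := tz_re_nhds (by norm_num)
    filter_upwards [o1, o2] with s h1 h2
    have : Complex.Gamma s ≠ 0 := Complex.Gamma_ne_zero_of_re_pos (by linarith)
    simp only [Pi.sub_apply, hg]
    rw [heq s h1, ← tz_expand (2*n+4) h1 h2, inv_mul_cancel_left₀ this, sub_self]
  have h2 : meromorphicOrderAt (f - g) (-(n:ℂ)) = ⊤ := by
    by_contra h
    exact hm.meromorphicOrderAt_ne_top_of_isPreconnected (tzV_preconnected n) (tzV_neg n) hp h h1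
  rw [meromorphicOrderAt_eq_top_iff] at h2
  have h3 := hasDerivAt_iff_tendsto_slope.1 (hGa (-(n:ℂ))).differentiableAt.hasDerivAt
  have h4 := h3.mul (tzg_limit n hn)
  rw [mul_zero] at h4
  refine h4.congr' ?_
  filter_upwards [h2, self_mem_nhdsWithin] with s hs hs'
  have hs0 : s + n ≠ 0 := fun h => hs' (eq_neg_of_add_eq_zero_left h)
  have hs1 : f s = g s := sub_eq_zero.1 hs
  rw [hs1, hg, slope_def_field, Complex.Gamma_neg_nat_eq_zero]
  simp only [inv_zero, sub_zero, sub_neg_eq_add]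
  field_simp

theorem tornheim_diag_value_at_neg_int (f : ℂ → ℂ) (hf : ∀ z : ℂ, MeromorphicAt f z)
    (heq : ∀ s : ℂ, 2 / 3 < s.re → f s = tornheim s s s) :
    ∀ k : ℤ, k < 0 →
      Filter.Tendsto f (nhdsWithin (k : ℂ) {((k : ℂ))}ᶜ) (nhds 0) := by
  intro k hk
  obtain ⟨n, hn⟩ := Int.eq_ofNat_of_zero_le (show 0 ≤ -k by omega)
  have hk' : (k:ℂ) = -(n:ℂ) := by
    rw [show k = -(n:ℤ) by omega]; simp
  rw [hk']
  exact tz_final f hf heq n (by omega)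
end

section
/- Let a be a real number with 0 < a < 1 and let s be a complex number that is not a nonnegative integer. Then the series below converges and ζ(1−s, a) + ζ(1−s, 1−a) = a^{s−1} + 2 Σ_{k=0}^∞ C(2k−s, 2k) ζ(1−s+2k) a^{2k}. -/
open Real Complex HurwitzZeta

/-- Generalized binomial coefficient `C(w, k) = w(w-1)⋯(w-k+1)/k!`. -/
noncomputable def genBinom (w : ℂ) (k : ℕ) : ℂ :=
  (∏ j ∈ Finset.range k, (w - j)) / (k.factorial : ℂ)

/-- The rising factorial quotient `w (w+1) ⋯ (w+m-1) / m!`. -/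
noncomputable def risingQ (w : ℂ) (m : ℕ) : ℂ :=
  (∏ j ∈ Finset.range m, (w + j)) / (m.factorial : ℂ)

lemma genBinom_eq_risingQ (w : ℂ) (m : ℕ) : genBinom (w + m - 1) m = risingQ w m := by
  unfold genBinom risingQ
  rw [← Finset.prod_range_reflect (fun j : ℕ => w + (j : ℂ)) m]
  congr 1
  refine Finset.prod_congr rfl fun j hj => ?_
  have : j + 1 ≤ m := by simpa using hj
  rw [Nat.sub_sub, Nat.cast_sub (by omega)]
  push_cast
  ring

lemma ascPoch_eval_prod (w : ℂ) (m : ℕ) :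
    (ascPochhammer ℂ m).eval w = ∏ j ∈ Finset.range m, (w + j) := by
  induction m with
  | zero => simp
  | succ m ih => rw [ascPochhammer_succ_eval, ih, Finset.prod_range_succ]

lemma choose_eq_risingQ (w : ℂ) (m : ℕ) : Ring.choose (w + m - 1) m = risingQ w m := by
  rw [← Ring.multichoose_eq]
  have h := Ring.factorial_nsmul_multichoose_eq_ascPochhammer w m
  rw [Polynomial.ascPochhammer_smeval_cast, Polynomial.ascPochhammer_smeval_eq_eval,
    ascPoch_eval_prod, nsmul_eq_mul] at h
  unfold risingQ
  rw [← h, mul_div_cancel_left₀]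
  exact_mod_cast m.factorial_ne_zero

lemma hasSum_risingQ (w x : ℂ) (hx : ‖x‖ < 1) :
    HasSum (fun m : ℕ => risingQ w m * x ^ m) (1 / (1 - x) ^ w) := by
  have h := (Complex.one_div_one_sub_cpow_hasFPowerSeriesOnBall_zero w).hasSum (y := x)
    (by simpa [← ENNReal.ofReal_one, Metric.eball_ofReal] using hx)
  simp only [zero_add] at h
  convert! h using 2 with m
  rw [FormalMultilinearSeries.ofScalars_apply_eq, choose_eq_risingQ, smul_eq_mul]

lemma norm_risingQ_le (w : ℂ) (R : ℝ) (hw : ‖w‖ ≤ R) (m : ℕ) :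
    ‖risingQ w m‖ ≤ ‖risingQ (R : ℂ) m‖ := by
  unfold risingQ
  rw [norm_div, norm_div]
  gcongr
  rw [norm_prod, norm_prod]
  refine Finset.prod_le_prod (fun _ _ => norm_nonneg _) fun j _ => ?_
  have hR : 0 ≤ R := (norm_nonneg w).trans hw
  calc ‖w + j‖ ≤ ‖w‖ + ‖(j : ℂ)‖ := norm_add_le _ _
    _ ≤ R + j := by simpa using hw
    _ = ‖(R : ℂ) + j‖ := by
      rw [← Complex.ofReal_natCast, ← Complex.ofReal_add, Complex.norm_of_nonneg (by positivity)]

lemma summable_norm_risingQ (w : ℂ) (a : ℝ) (ha : 0 < a) (ha' : a < 1) :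
    Summable (fun k : ℕ => ‖risingQ w (2 * k)‖ * a ^ (2 * k)) := by
  have h := (hasSum_risingQ w a (by simpa [abs_of_pos ha] using ha')).summable.norm
  have h2 := h.comp_injective (i := fun k : ℕ => 2 * k) (fun a b h => by simpa using h)
  refine h2.congr fun k => ?_
  simp [abs_of_pos ha]

lemma hasSum_even_risingQ (w x : ℂ) (hx : ‖x‖ < 1) :
    HasSum (fun k : ℕ => 2 * (risingQ w (2 * k) * x ^ (2 * k)))
      (1 / (1 + x) ^ w + 1 / (1 - x) ^ w) := by
  have h := (hasSum_risingQ w (-x) (by simpa using hx)).add (hasSum_risingQ w x hx)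
  rw [sub_neg_eq_add] at h
  have hi : Function.Injective (fun k : ℕ => 2 * k) := fun a b h => by simpa using h
  rw [← hi.hasSum_iff] at h
  · refine h.congr_fun fun k => ?_
    simp [pow_mul]
    ring
  · intro m hm
    have : Odd m := by
      rw [← Nat.not_even_iff_odd]
      rintro ⟨k, hk⟩
      exact hm ⟨k, by simp; omega⟩
    rw [this.neg_pow]; ring

lemma norm_zeta_le (z : ℂ) (hz : 2 ≤ z.re) : ‖riemannZeta z‖ ≤ ∑' n : ℕ, 1 / ((n : ℝ) + 1) ^ 2 := by
  rw [zeta_eq_tsum_one_div_nat_add_one_cpow (by linarith)]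
  have hs : Summable (fun n : ℕ => 1 / ((n : ℝ) + 1) ^ 2) := by
    have := (summable_nat_add_iff 1).mpr (Real.summable_one_div_nat_pow.mpr (one_lt_two))
    simpa using this
  refine tsum_of_norm_bounded hs.hasSum fun n => ?_
  have : ((n : ℂ) + 1) = (((n : ℝ) + 1 : ℝ) : ℂ) := by push_cast; rfl
  rw [this, norm_div, norm_one, Complex.norm_cpow_eq_rpow_re_of_pos (by positivity)]
  gcongr
  rw [← Real.rpow_natCast]
  exact Real.rpow_le_rpow_of_exponent_le (by linarith [n.cast_nonneg (α := ℝ)]) (by simpa using hz)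

/-- The general term. -/
noncomputable def termF (a : ℝ) (k : ℕ) (w : ℂ) : ℂ :=
  risingQ w (2 * k) * riemannZeta (w + 2 * k) * (a : ℂ) ^ (2 * k)

/-- The domain. -/
def domU : Set ℂ := {w | ∀ n : ℕ, w ≠ 1 - n}

lemma domU_eq : domU = (Set.range (fun n : ℕ => (1 - n : ℂ)))ᶜ := by
  ext w; simp [domU, eq_comm]

lemma isOpen_domU : IsOpen domU := by
  rw [domU_eq, isOpen_compl_iff]
  have h : IsClosed ((fun n : ℤ => (n : ℂ)) '' {n | n ≤ 1}) :=
    Complex.isClosedEmbedding_intCast.isClosedMap _ (isClosed_discrete _)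
  convert h using 1
  ext z
  constructor
  · rintro ⟨n, rfl⟩
    exact ⟨1 - n, by simp, by simp⟩
  · rintro ⟨n, hn, rfl⟩
    refine ⟨(1 - n).toNat, ?_⟩
    have : (((1 - n).toNat : ℤ) : ℂ) = ((1 - n : ℤ) : ℂ) := by
      rw [Int.toNat_of_nonneg]; simpa using hn
    simp only
    rw [← Int.cast_natCast, this]; push_cast; ring

lemma isPreconnected_domU : IsPreconnected domU := by
  rw [domU_eq]
  refine ((Set.countable_range _).isConnected_compl_of_one_lt_rank ?_).isPreconnected
  simp [Complex.rank_real_complex]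

lemma differentiableAt_termF (a : ℝ) (k : ℕ) (w : ℂ) (hw : w + 2 * k ≠ 1) :
    DifferentiableAt ℂ (termF a k) w := by
  unfold termF risingQ
  refine DifferentiableAt.mul (DifferentiableAt.mul (by fun_prop) ?_) (by fun_prop)
  exact (differentiableAt_riemannZeta hw).comp w (f := fun w : ℂ => w + 2 * k) (by fun_prop)

/-- Tail estimate -/
lemma tail_bound (a : ℝ) (ha : 0 < a) (R : ℝ) (N : ℕ) (hN : R + 2 ≤ N)
    (w : ℂ) (hw : ‖w‖ ≤ R) (k : ℕ) :
    ‖termF a (k + N) w‖ ≤ (∑' n : ℕ, 1 / ((n : ℝ) + 1) ^ 2) *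
      (‖risingQ (R : ℂ) (2 * (k + N))‖ * a ^ (2 * (k + N))) := by
  have hre : -R ≤ w.re := by
    have := (abs_le.mp (Complex.abs_re_le_norm w)).1; linarith
  have hk : (0 : ℝ) ≤ k := k.cast_nonneg
  have hNn : (0 : ℝ) ≤ N := N.cast_nonneg
  have hz := norm_zeta_le (w + 2 * ((k + N : ℕ) : ℂ)) (by simp; linarith)
  have hq := norm_risingQ_le w R hw (2 * (k + N))
  unfold termF
  rw [norm_mul, norm_mul, norm_pow, Complex.norm_of_nonneg ha.le]
  calc _ ≤ ‖risingQ (R : ℂ) (2 * (k + N))‖ * (∑' n : ℕ, 1 / ((n : ℝ) + 1) ^ 2) * a ^ (2 * (k + N)) := by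
        gcongr
    _ = _ := by ring

lemma summable_tail (a : ℝ) (ha : 0 < a) (ha' : a < 1) (R : ℝ) (N : ℕ) :
    Summable (fun k : ℕ => (∑' n : ℕ, 1 / ((n : ℝ) + 1) ^ 2) *
      (‖risingQ (R : ℂ) (2 * (k + N))‖ * a ^ (2 * (k + N)))) :=
  ((summable_nat_add_iff (f := fun k : ℕ => ‖risingQ (R : ℂ) (2 * k)‖ * a ^ (2 * k)) N).mpr
    (summable_norm_risingQ R a ha ha')).mul_left _

lemma summable_termF (a : ℝ) (ha : 0 < a) (ha' : a < 1) (w : ℂ) :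
    Summable (fun k => termF a k w) := by
  obtain ⟨N, hN⟩ := exists_nat_ge (‖w‖ + 2)
  rw [← summable_nat_add_iff N]
  exact Summable.of_norm_bounded (summable_tail a ha ha' ‖w‖ N)
    (tail_bound a ha ‖w‖ N hN w le_rfl)

lemma differentiableAt_tsum (a : ℝ) (ha : 0 < a) (ha' : a < 1) (w : ℂ) (hw : w ∈ domU) :
    DifferentiableAt ℂ (fun w => ∑' k, termF a k w) w := by
  obtain ⟨N, hN⟩ := exists_nat_ge (‖w‖ + 1 + 2)
  have heq : (fun w => ∑' k, termF a k w) =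
      fun w => ∑ k ∈ Finset.range N, termF a k w + ∑' k, termF a (k + N) w := by
    ext w
    exact ((summable_termF a ha ha' w).sum_add_tsum_nat_add N).symm
  rw [heq]
  have hdom : ∀ k : ℕ, w + 2 * k ≠ 1 := fun k h =>
    hw (2 * k) (by push_cast; rw [← h]; ring)
  refine DifferentiableAt.add (DifferentiableAt.fun_sum fun k _ =>
    differentiableAt_termF a k w (hdom k)) ?_
  have hd : DifferentiableOn ℂ (fun w => ∑' k, termF a (k + N) w)
      (Metric.ball 0 (‖w‖ + 1)) := by
    refine differentiableOn_tsum_of_summable_norm (summable_tail a ha ha' (‖w‖ + 1) N)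
      (fun k z hz => ?_) Metric.isOpen_ball fun k z hz => ?_
    · have hz' : ‖z‖ < ‖w‖ + 1 := by simpa using hz
      refine (differentiableAt_termF a _ z fun h => ?_).differentiableWithinAt
      have h1 := congrArg Complex.re h
      have h2 := (abs_le.mp (Complex.abs_re_le_norm z)).1
      have hk : (0 : ℝ) ≤ k := k.cast_nonneg
      simp at h1
      linarith [norm_nonneg w]
    · exact tail_bound a ha _ N hN z (by simpa using (show ‖z‖ < ‖w‖ + 1 by simpa using hz).le) k
  exact hd.differentiableAt (Metric.isOpen_ball.mem_nhds (by simp))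

lemma pair_hasSum (a : ℝ) (ha : 0 < a) (ha' : a < 1) (w : ℂ) (n : ℕ) :
    HasSum (fun k : ℕ => 2 * (risingQ w (2 * k) * (a : ℂ) ^ (2 * k) *
        (1 / ((n : ℂ) + 1) ^ (w + 2 * k))))
      (1 / ((n : ℂ) + 1 + a) ^ w + 1 / ((n : ℂ) + 1 - a) ^ w) := by
  set N : ℝ := (n : ℝ) + 1 with hN
  have hN1 : 1 ≤ N := by simp [hN]
  have hN0 : (0 : ℝ) < N := by linarith
  have hNc : ((n : ℂ) + 1) = (N : ℂ) := by simp [hN]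
  have hNne : (N : ℂ) ≠ 0 := by exact_mod_cast hN0.ne'
  have hx1 : a / N < 1 := by rw [div_lt_one hN0]; linarith
  have hx0 : 0 < a / N := by positivity
  have h := (hasSum_even_risingQ w ((a / N : ℝ) : ℂ)
    (by rw [Complex.norm_of_nonneg hx0.le]; exact hx1)).mul_left (1 / (N : ℂ) ^ w)
  rw [hNc]
  have e1 : ((N : ℂ) + a) ^ w = (N : ℂ) ^ w * (1 + ((a / N : ℝ) : ℂ)) ^ w := by
    rw [show (1 : ℂ) + ((a / N : ℝ) : ℂ) = ((1 + a / N : ℝ) : ℂ) by push_cast; rfl,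
      ← Complex.mul_cpow_ofReal_nonneg hN0.le (by positivity), ← Complex.ofReal_mul,
      mul_add, mul_div_cancel₀ _ hN0.ne']
    push_cast; simp
  have e2 : ((N : ℂ) - a) ^ w = (N : ℂ) ^ w * (1 - ((a / N : ℝ) : ℂ)) ^ w := by
    rw [show (1 : ℂ) - ((a / N : ℝ) : ℂ) = ((1 - a / N : ℝ) : ℂ) by push_cast; rfl,
      ← Complex.mul_cpow_ofReal_nonneg hN0.le (by linarith), ← Complex.ofReal_mul,
      mul_sub, mul_div_cancel₀ _ hN0.ne']
    push_cast; simp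
  convert! h using 1
  · ext k
    rw [Complex.cpow_add _ _ hNne, show (2 * (k : ℂ)) = ((2 * k : ℕ) : ℂ) by push_cast; rfl,
      Complex.cpow_natCast]
    push_cast
    rw [div_pow]
    field_simp
  · rw [e1, e2]
    simp only [one_div, mul_inv]
    ring

lemma one_lt_case (a : ℝ) (ha : 0 < a) (ha' : a < 1) (w : ℂ) (hw : 1 < w.re) :
    hurwitzZeta (a : UnitAddCircle) w + hurwitzZeta ((1 - a : ℝ) : UnitAddCircle) w
      = (a : ℂ) ^ (-w) + 2 * ∑' k, termF a k w := by
  have h1 := hasSum_hurwitzZeta_of_one_lt_re (a := a) ⟨ha.le, ha'.le⟩ hw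
  have h2 := hasSum_hurwitzZeta_of_one_lt_re (a := 1 - a) ⟨by linarith, by linarith⟩ hw
  rw [← hasSum_nat_add_iff' 1] at h1
  have h3 := h1.add h2
  have hpair := fun n => pair_hasSum a ha ha' w n
  have h4 : hurwitzZeta (a : UnitAddCircle) w + hurwitzZeta ((1 - a : ℝ) : UnitAddCircle) w
      = (a : ℂ) ^ (-w) + ∑' n : ℕ, (1 / ((n : ℂ) + 1 + a) ^ w + 1 / ((n : ℂ) + 1 - a) ^ w) := by
    have : ∑' n : ℕ, (1 / ((n : ℂ) + 1 + a) ^ w + 1 / ((n : ℂ) + 1 - a) ^ w) =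
        hurwitzZeta (a : UnitAddCircle) w - ∑ i ∈ Finset.range 1, 1 / ((i : ℂ) + (a : ℂ)) ^ w +
          hurwitzZeta ((1 - a : ℝ) : UnitAddCircle) w := by
      refine (h3.congr_fun fun n => ?_).tsum_eq
      push_cast
      rw [add_sub_assoc]
    rw [this]
    simp [Complex.cpow_neg]
    ring
  rw [h4]
  congr 1
  let g : ℕ → ℕ → ℂ := fun n k => 2 * (risingQ w (2 * k) * (a : ℂ) ^ (2 * k) *
        (1 / ((n : ℂ) + 1) ^ (w + 2 * k)))
  have hzs : Summable (fun n : ℕ => 1 / ((n : ℝ) + 1) ^ w.re) := by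
    have := (summable_nat_add_iff 1).mpr (Real.summable_one_div_nat_rpow.mpr hw)
    simpa using this
  have hg : Summable (Function.uncurry g) := by
    have hb := (hzs.mul_of_nonneg ((summable_norm_risingQ w a ha ha').mul_left 2)
      (fun n => by positivity) (fun k => by positivity))
    refine Summable.of_norm_bounded hb fun ⟨n, k⟩ => ?_
    simp only [Function.uncurry, g]
    have : ((n : ℂ) + 1) = (((n : ℝ) + 1 : ℝ) : ℂ) := by push_cast; rfl
    rw [norm_mul, norm_mul, norm_mul, norm_pow, Complex.norm_of_nonneg ha.le, this, norm_div,
      norm_one, Complex.norm_cpow_eq_rpow_re_of_pos (by positivity), Complex.norm_ofNat, mul_comm (1 / _),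
      ← mul_assoc, show (w + 2 * (k : ℂ)).re = w.re + 2 * k by simp]
    gcongr
    · linarith [n.cast_nonneg (α := ℝ)]
    · linarith [k.cast_nonneg (α := ℝ)]
  calc _ = ∑' n, ∑' k, g n k := tsum_congr fun n => (hpair n).tsum_eq.symm
    _ = ∑' k, ∑' n, g n k := hg.tsum_comm.symm
    _ = ∑' k, 2 * termF a k w := tsum_congr fun k => by
        simp only [g, termF]
        rw [tsum_mul_left, tsum_mul_left, zeta_eq_tsum_one_div_nat_add_one_cpow (by
          have : (0 : ℝ) ≤ k := k.cast_nonneg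
          simp; linarith)]
        ring
    _ = _ := tsum_mul_left

lemma main_w (a : ℝ) (ha : 0 < a) (ha' : a < 1) (w : ℂ) (hw : w ∈ domU) :
    hurwitzZeta (a : UnitAddCircle) w + hurwitzZeta ((1 - a : ℝ) : UnitAddCircle) w
      = (a : ℂ) ^ (-w) + 2 * ∑' k, termF a k w := by
  have hne : (a : ℂ) ≠ 0 := by exact_mod_cast ha.ne'
  have h2 : (2 : ℂ) ∈ domU := fun n h => by
    have := congrArg Complex.re h
    simp at this
    linarith [n.cast_nonneg (α := ℝ)]
  have hf : AnalyticOnNhd ℂ (fun w => hurwitzZeta (a : UnitAddCircle) w +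
      hurwitzZeta ((1 - a : ℝ) : UnitAddCircle) w) domU := by
    refine DifferentiableOn.analyticOnNhd (fun z hz => ?_) isOpen_domU
    have hz1 : z ≠ 1 := by simpa using hz 0
    exact ((differentiableAt_hurwitzZeta _ hz1).add
      (differentiableAt_hurwitzZeta _ hz1)).differentiableWithinAt
  have hg : AnalyticOnNhd ℂ (fun w => (a : ℂ) ^ (-w) + 2 * ∑' k, termF a k w) domU := by
    refine DifferentiableOn.analyticOnNhd (fun z hz => ?_) isOpen_domU
    refine (DifferentiableAt.add ?_
      ((differentiableAt_tsum a ha ha' z hz).const_mul 2)).differentiableWithinAt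
    exact (differentiableAt_id.neg).const_cpow (Or.inl hne)
  refine hf.eqOn_of_preconnected_of_eventuallyEq hg isPreconnected_domU h2 ?_ hw
  have : ∀ᶠ z : ℂ in nhds 2, 1 < z.re :=
    (isOpen_lt continuous_const Complex.continuous_re).mem_nhds (by simp)
  filter_upwards [this] with z hz
  exact one_lt_case a ha ha' z hz

theorem hurwitz_even_expansion (a : ℝ) (ha : 0 < a) (ha' : a < 1) (s : ℂ)
    (hs : ∀ n : ℕ, s ≠ n) :
    Summable (fun k : ℕ =>
      genBinom (2 * (k : ℂ) - s) (2 * k) * riemannZeta (1 - s + 2 * k) * (a : ℂ) ^ (2 * k)) ∧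
    hurwitzZeta (a : UnitAddCircle) (1 - s) + hurwitzZeta ((1 - a : ℝ) : UnitAddCircle) (1 - s)
      = (a : ℂ) ^ (s - 1)
        + 2 * ∑' k : ℕ,
            genBinom (2 * (k : ℂ) - s) (2 * k) * riemannZeta (1 - s + 2 * k) * (a : ℂ) ^ (2 * k) := by
  have hterm : (fun k : ℕ => genBinom (2 * (k : ℂ) - s) (2 * k) * riemannZeta (1 - s + 2 * k) *
      (a : ℂ) ^ (2 * k)) = fun k => termF a k (1 - s) := by
    ext k
    unfold termF
    rw [← genBinom_eq_risingQ]
    congr 3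
    push_cast
    ring
  rw [hterm]
  refine ⟨summable_termF a ha ha' _, ?_⟩
  have h := main_w a ha ha' (1 - s) fun n h => hs n (by linear_combination -h)
  rwa [neg_sub] at h
end
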